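/- For every ε > 0 there exists a constant C = C(ε, q) such that the following holds. Let l ≥ 0 be an integer, let Q ∈ F_q[t] be a nonzero polynomial of degree m ≥ 0, and let F be a function from the monic polynomials of F_q[t] to ℂ such that |F(f)| ≤ 1 for all monic f, and F(f) = F(g) whenever f ≡ g (mod Q) and f, g have the same first l coefficients. Then for every n ≥ 1, |∑_{f monic, deg f = n} F(f) μ(f)| ≤ C · q^{(1/2 + ε)(n + m + l)}. -/

import Mathlib

open Polynomial

/- The Möbius function on `F_q[t]`. -/
open scoped Classical in
noncomputable def polyMu {F : Type*} [Field F] (f : Polynomial F) : ℤ :=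
  if Squarefree f then (-1) ^ (UniqueFactorizationMonoid.normalizedFactors f).card else 0

/-- The monic polynomial of degree `n` whose lower coefficient vector is `x ∈ F_q^n`. -/
noncomputable def monicPoly (F : Type*) [Field F] (n : ℕ) (x : Fin n → F) : Polynomial F :=
  X ^ n + ∑ i : Fin n, C (x i) * X ^ (i : ℕ)

/-- The `i`-th coefficient from the top of `f = t^d + a_1 t^{d-1} + ⋯ + a_d`:
`a_i = coeff (d - i)` for `i ≤ d`, and `0` for `i > d`. -/
noncomputable def firstCoeff {F : Type*} [Field F] (f : Polynomial F) (i : ℕ) : F :=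
  if i ≤ f.natDegree then f.coeff (f.natDegree - i) else 0

section PowerSeriesOrder
variable {κ : Type*} [Field κ]

/-- A finite-dimensional space of power series has a family of `finrank` many nonzero elements with
pairwise distinct orders. -/
theorem PowerSeries.exists_family_order_injective (n : ℕ) (V : Submodule κ (PowerSeries κ))
    [FiniteDimensional κ V] (hn : n ≤ Module.finrank κ V) :
    ∃ t : Fin n → PowerSeries κ, (∀ j, t j ∈ V ∧ t j ≠ 0) ∧
      Function.Injective fun j => (t j).order := by
  induction n generalizing V with
  | zero => exact ⟨Fin.elim0, fun j => j.elim0, fun j => j.elim0⟩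
  | succ n ih =>
    have hex : ∃ m : ℕ, ∃ v ∈ V, v ≠ 0 ∧ v.order = m := by
      have hV : V ≠ ⊥ := by
        rintro rfl
        simp at hn
      obtain ⟨v, hv, hv0⟩ := V.ne_bot_iff.1 hV
      exact ⟨v.order.toNat, v, hv, hv0, by
        rw [ENat.natCast_toNat]; exact fun h => hv0 (PowerSeries.order_eq_top.1 h)⟩
    classical
    obtain ⟨v, hv, hv0, hvm⟩ := Nat.find_spec hex
    set m := Nat.find hex with hm
    let W : Submodule κ (PowerSeries κ) := V ⊓ LinearMap.ker (PowerSeries.coeff (R := κ) m)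
    have hWfin : FiniteDimensional κ W := Submodule.finiteDimensional_inf_left _ _
    have hW : n ≤ Module.finrank κ W := by
      let f : V →ₗ[κ] κ := (PowerSeries.coeff (R := κ) m).comp V.subtype
      have h1 := f.finrank_range_add_finrank_ker
      have h2 : Module.finrank κ (LinearMap.range f) ≤ 1 := by
        simpa using (LinearMap.range f).finrank_le
      have h3 : Module.finrank κ (LinearMap.ker f) ≤ Module.finrank κ W := by
        refine LinearMap.finrank_le_finrank_of_injective
          (f := (V.subtype.comp (LinearMap.ker f).subtype).codRestrict W ?_) ?_
        · intro c
          exact ⟨c.1.2, c.2⟩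
        · intro a b hab
          exact Subtype.ext (Subtype.ext (congrArg (fun x : W => x.1) hab))
      omega
    obtain ⟨t, ht, hti⟩ := ih W hW
    have hlt : ∀ j, (m : ℕ∞) < (t j).order := by
      intro j
      have h1 : (m : ℕ∞) ≤ (t j).order := by
        by_contra hlt
        push Not at hlt
        have hne : (t j).order ≠ ⊤ := fun h => (ht j).2 (PowerSeries.order_eq_top.1 h)
        have := Nat.find_min hex (m := (t j).order.toNat)
          (by rw [← ENat.natCast_toNat hne] at hlt; exact_mod_cast hlt)
        exact this ⟨t j, (ht j).1.1, (ht j).2, (ENat.natCast_toNat hne).symm⟩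
      refine lt_of_le_of_ne h1 fun h => ?_
      have h2 : PowerSeries.coeff m (t j) = 0 := (ht j).1.2
      exact (PowerSeries.order_eq_nat.1 h.symm).1 h2
    refine ⟨Fin.cons v t, ?_, ?_⟩
    · intro j
      refine Fin.cases ?_ (fun i => ?_) j
      · exact ⟨hv, hv0⟩
      · exact ⟨(ht i).1.1, (ht i).2⟩
    · intro i j
      refine Fin.cases ?_ (fun i => ?_) i <;> refine Fin.cases ?_ (fun j => ?_) j
      · simp
      · intro h
        simp only [Fin.cons_zero, Fin.cons_succ] at h
        exact absurd (hvm.symm.trans h) (hlt j).ne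
      · intro h
        simp only [Fin.cons_zero, Fin.cons_succ] at h
        exact absurd (hvm.symm.trans h.symm) (hlt i).ne
      · intro h
        simp only [Fin.cons_succ] at h
        rw [hti h]

theorem PowerSeries.sum_mul_pow_ne_zero {ι : Type*} [Fintype ι] (Q : ℕ)
    (s t : ι → PowerSeries κ) (hs : ∀ j, s j = 0 ∨ (s j).order < Q) (ht : ∀ j, t j ≠ 0)
    (hti : Function.Injective fun j => (t j).order) (hne : ∃ j, s j ≠ 0) :
    ∑ j, s j * t j ^ Q ≠ 0 := by
  classical
  let T : Finset ι := Finset.univ.filter fun j => s j ≠ 0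
  have hT : T.Nonempty := by
    obtain ⟨j, hj⟩ := hne
    exact ⟨j, by simpa [T] using hj⟩
  let o : ι → ℕ := fun j => (s j * t j ^ Q).order.toNat
  have hneT : ∀ j ∈ T, s j * t j ^ Q ≠ 0 := fun j hj =>
    mul_ne_zero (by simpa [T] using hj) (pow_ne_zero _ (ht j))
  have ho : ∀ j ∈ T, (s j * t j ^ Q).order = o j := fun j hj =>
    (ENat.natCast_toNat fun h => hneT j hj (PowerSeries.order_eq_top.1 h)).symm
  have hto : ∀ j, (t j).order = ((t j).order.toNat : ℕ) := fun j =>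
    (ENat.natCast_toNat fun h => ht j (PowerSeries.order_eq_top.1 h)).symm
  have hso : ∀ j ∈ T, (s j).order = ((s j).order.toNat : ℕ) := fun j hj =>
    (ENat.natCast_toNat fun h => (by simpa [T] using hj : s j ≠ 0)
      (PowerSeries.order_eq_top.1 h)).symm
  have hoe : ∀ j ∈ T, o j = (s j).order.toNat + Q * (t j).order.toNat := by
    intro j hj
    have h1 := ho j hj
    rw [PowerSeries.order_mul, PowerSeries.order_pow, hso j hj, hto j, nsmul_eq_mul] at h1
    exact_mod_cast h1.symm
  have hsQ : ∀ j ∈ T, (s j).order.toNat < Q := by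
    intro j hj
    have h1 := (hs j).resolve_left (by simpa [T] using hj)
    rw [hso j hj] at h1
    exact_mod_cast h1
  have hinj : Set.InjOn o T := by
    intro i hi j hj hij
    rw [hoe i hi, hoe j hj] at hij
    have h1 := congrArg (· / Q) hij
    have hQ : 0 < Q := lt_of_le_of_lt (Nat.zero_le _) (hsQ i hi)
    simp only [Nat.add_mul_div_left _ _ hQ, Nat.div_eq_of_lt (hsQ i hi),
      Nat.div_eq_of_lt (hsQ j hj), zero_add] at h1
    exact hti (by simp only; rw [hto i, hto j, h1])
  obtain ⟨j0, hj0, hmin⟩ := T.exists_min_image o hT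
  intro h0
  have h1 : PowerSeries.coeff (o j0) (∑ j, s j * t j ^ Q) =
      PowerSeries.coeff (o j0) (s j0 * t j0 ^ Q) := by
    rw [map_sum]
    refine Finset.sum_eq_single j0 ?_ (by simp)
    intro j _ hj
    by_cases hjT : j ∈ T
    · refine PowerSeries.coeff_of_lt_order _ ?_
      rw [ho j hjT]
      exact_mod_cast lt_of_le_of_ne (hmin j hjT) fun h => hj (hinj hjT hj0 h.symm)
    · have : s j = 0 := by simpa [T] using hjT
      simp [this]
  rw [h0, map_zero] at h1
  exact (PowerSeries.order_eq_nat.1 (ho j0 hj0)).1 h1.symm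

end PowerSeriesOrder

section CoordDegree
variable {κ O : Type*} [Field κ] [CommRing O] [Algebra κ[X] O] {d : ℕ}
  (ω : Module.Basis (Fin d) κ[X] O)

/-- All coordinates of `o` in the basis `ω` have degree at most `n`. -/
def CoordDegLE (n : ℕ) (o : O) : Prop := ∀ i, (ω.repr o i).natDegree ≤ n

variable {ω}

theorem CoordDegLE.mono {m n : ℕ} (h : m ≤ n) {o : O} (ho : CoordDegLE ω m o) :
    CoordDegLE ω n o := fun i => (ho i).trans h

theorem coordDegLE_zero (n : ℕ) : CoordDegLE ω n 0 := fun i => by simp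

theorem CoordDegLE.add {n : ℕ} {o o' : O} (h : CoordDegLE ω n o) (h' : CoordDegLE ω n o') :
    CoordDegLE ω n (o + o') := fun i => by
  simpa using natDegree_add_le_of_degree_le (h i) (h' i)

theorem CoordDegLE.sum {α : Type*} (s : Finset α) {n : ℕ} {o : α → O}
    (h : ∀ a ∈ s, CoordDegLE ω n (o a)) : CoordDegLE ω n (∑ a ∈ s, o a) := by
  classical
  induction s using Finset.induction_on with
  | empty => simpa using coordDegLE_zero n
  | insert a s ha ih =>
    rw [Finset.sum_insert ha]
    exact (h a (by simp)).add (ih fun b hb => h b (by simp [hb]))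

theorem CoordDegLE.smul {m n : ℕ} {f : κ[X]} (hf : f.natDegree ≤ m) {o : O}
    (h : CoordDegLE ω n o) : CoordDegLE ω (m + n) (f • o) := fun i => by
  simpa using natDegree_mul_le_of_le hf (h i)

theorem exists_coordDegLE (o : O) : ∃ n, CoordDegLE ω n o :=
  ⟨Finset.univ.sup fun i => (ω.repr o i).natDegree,
    fun i => Finset.le_sup (f := fun i => (ω.repr o i).natDegree) (Finset.mem_univ i)⟩

theorem exists_coordDegLE_forall {α : Type*} [Finite α] (o : α → O) :
    ∃ n, ∀ a, CoordDegLE ω n (o a) := by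
  cases nonempty_fintype α
  choose n hn using fun a => exists_coordDegLE (ω := ω) (o a)
  exact ⟨Finset.univ.sup n, fun a => (hn a).mono (Finset.le_sup (Finset.mem_univ a))⟩

theorem CoordDegLE.mul {c m n : ℕ} (hc : ∀ i j, CoordDegLE ω c (ω i * ω j)) {o o' : O}
    (h : CoordDegLE ω m o) (h' : CoordDegLE ω n o') : CoordDegLE ω (m + n + c) (o * o') := by
  rw [← ω.sum_repr o, ← ω.sum_repr o', Finset.sum_mul_sum]
  refine CoordDegLE.sum _ fun i _ => CoordDegLE.sum _ fun j _ => ?_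
  rw [smul_mul_smul_comm]
  exact CoordDegLE.smul (natDegree_mul_le_of_le (h i) (h' j)) (hc i j)

theorem CoordDegLE.pow_char_pow {p : ℕ} [hp : Fact p.Prime] [CharP O p] {c : ℕ}
    (hc : ∀ i, CoordDegLE ω c (ω i ^ p)) (r : ℕ) {n : ℕ} {o : O} (h : CoordDegLE ω n o) :
    CoordDegLE ω (p ^ r * (n + c)) (o ^ p ^ r) := by
  induction r generalizing n o with
  | zero => simpa using h.mono (Nat.le_add_right _ _)
  | succ r ih =>
    have h1 : CoordDegLE ω (p * n + c) (o ^ p) := by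
      rw [← ω.sum_repr o, sum_pow_char]
      refine CoordDegLE.sum _ fun i _ => ?_
      rw [_root_.smul_pow]
      exact CoordDegLE.smul (natDegree_pow_le_of_le p (h i)) (hc i)
    rw [pow_succ', pow_mul]
    refine (ih h1).mono ?_
    have := hp.out.two_le
    calc p ^ r * (p * n + c + c) ≤ p ^ r * (p * n + p * c) :=
        Nat.mul_le_mul_left _ (by nlinarith)
      _ = p * p ^ r * (n + c) := by ring

/-- A family of more than `d * (N + 1)` elements with coordinates of degree at most `N` is linearly
dependent over the constants. -/
theorem exists_relation_of_coordDegLE {α : Type*} [Fintype α] {N : ℕ} (v : α → O)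
    (hv : ∀ a, CoordDegLE ω N (v a)) (hcard : d * (N + 1) < Fintype.card α) :
    ∃ c : α → κ, ∑ a, C (c a) • v a = 0 ∧ ∃ a, c a ≠ 0 := by
  let u : α → (Fin d × Fin (N + 1) → κ) := fun a x => (ω.repr (v a) x.1).coeff x.2
  have hu : ¬ LinearIndependent κ u := by
    intro h
    have := h.fintype_card_le_finrank
    simp at this
    omega
  obtain ⟨c, hc, hne⟩ := Fintype.not_linearIndependent_iff.1 hu
  refine ⟨c, ?_, hne⟩
  apply ω.repr.injective
  ext i m
  simp only [map_sum, map_smul, Finsupp.coe_finsetSum, Finset.sum_apply, Finsupp.smul_apply,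
    smul_eq_mul, finsetSum_coeff, coeff_C_mul, map_zero, Finsupp.coe_zero, Pi.zero_apply,
    coeff_zero]
  by_cases hm : m < N + 1
  · have := congrFun hc (i, ⟨m, hm⟩)
    simpa [u, Finset.sum_apply] using this
  · refine Finset.sum_eq_zero fun a _ => ?_
    rw [coeff_eq_zero_of_natDegree_lt (lt_of_le_of_lt (hv a i) (by omega)), mul_zero]

theorem Polynomial.natDegree_det_le {n : ℕ} {e : ℕ} (M : Matrix (Fin n) (Fin n) κ[X])
    (hM : ∀ i j, (M i j).natDegree ≤ e) : M.det.natDegree ≤ n * e := by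
  rw [Matrix.det_apply]
  refine natDegree_sum_le_of_forall_le _ _ fun σ _ => ?_
  rw [Units.smul_def, zsmul_eq_mul]
  have h1 : (((Equiv.Perm.sign σ : ℤ) : κ[X])).natDegree ≤ 0 := by simp
  refine (natDegree_mul_le_of_le h1 (natDegree_prod_le _ _)).trans ?_
  rw [zero_add]
  refine (Finset.sum_le_sum fun i _ => hM (σ i) i).trans ?_
  simp

theorem Algebra.dvd_algebraMap_norm {R S : Type*} [CommRing R] [CommRing S] [Algebra R S]
    [Module.Free R S] [Module.Finite R S] (s : S) : s ∣ algebraMap R S (Algebra.norm R s) := by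
  have h1 := Algebra.aeval_self_charpoly_lmul (R := R) s
  rw [← Polynomial.divX_mul_X_add ((Algebra.lmul R S s).charpoly)] at h1
  simp only [map_add, map_mul, aeval_X, aeval_C] at h1
  rw [Algebra.norm_apply, LinearMap.det_eq_sign_charpoly_coeff, map_mul]
  refine Dvd.dvd.mul_left ?_ _
  rw [eq_neg_of_add_eq_zero_right h1]
  exact (Dvd.intro_left _ rfl).neg_right

theorem PowerSeries.order_polynomial_le_natDegree {f : κ[X]} (hf : f ≠ 0) :
    (f : PowerSeries κ).order ≤ f.natDegree :=
  PowerSeries.order_le _ (by simpa using hf)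

/-- A nonzero element with coordinates of degree at most `n` vanishes to bounded order. -/
theorem CoordDegLE.order_le [IsDomain O] (ev : O →ₐ[κ[X]] PowerSeries κ)
    {c n : ℕ} (hc : ∀ i j, CoordDegLE ω c (ω i * ω j))
    {o : O} (ho : o ≠ 0) (h : CoordDegLE ω n o) : (ev o).order ≤ (d * (n + c) : ℕ) := by
  have := Module.Free.of_basis ω
  have := Module.Finite.of_basis ω
  have hN : Algebra.norm κ[X] o ≠ 0 := Algebra.norm_ne_zero_iff.2 ho
  obtain ⟨o', ho'⟩ := Algebra.dvd_algebraMap_norm (R := κ[X]) o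
  have h1 := congrArg ev ho'
  rw [AlgHom.commutes, map_mul] at h1
  have h2 : (algebraMap κ[X] (PowerSeries κ) (Algebra.norm κ[X] o)).order ≤
      (Algebra.norm κ[X] o).natDegree := by
    rw [PowerSeries.algebraMap_apply']
    simpa using PowerSeries.order_polynomial_le_natDegree hN
  have h3 : (Algebra.norm κ[X] o).natDegree ≤ d * (n + c) := by
    rw [Algebra.norm_eq_matrix_det ω]
    refine Polynomial.natDegree_det_le _ fun i j => ?_
    rw [Algebra.leftMulMatrix_eq_repr_mul]
    have : CoordDegLE ω (n + c) (o * ω j) := by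
      rw [← ω.sum_repr o, Finset.sum_mul]
      refine CoordDegLE.sum _ fun k _ => ?_
      rw [smul_mul_assoc]
      exact CoordDegLE.smul (h k) (hc k j)
    exact this i
  rw [h1, PowerSeries.order_mul] at h2
  exact (le_self_add.trans h2).trans (by exact_mod_cast h3)

end CoordDegree

section Stepanov
variable {κ O : Type*} [Field κ] [CommRing O] [Algebra κ[X] O] {d : ℕ}
  (ω : Module.Basis (Fin d) κ[X] O)

/-- The polynomial with the given coefficient vector. -/
noncomputable def vecPoly {b : ℕ} (c : Fin d × Fin (b + 1) → κ) (i : Fin d) : κ[X] :=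
  ∑ j : Fin (b + 1), C (c (i, j)) * X ^ (j : ℕ)

/-- The element of `O` with the given coefficient vector. -/
noncomputable def vecElt {b : ℕ} (c : Fin d × Fin (b + 1) → κ) : O :=
  ∑ x, (C (c x) * X ^ (x.2 : ℕ)) • ω x.1

theorem vecElt_eq {b : ℕ} (c : Fin d × Fin (b + 1) → κ) :
    vecElt ω c = ∑ i, vecPoly c i • ω i := by
  simp only [vecElt, vecPoly, Fintype.sum_prod_type, Finset.sum_smul]

theorem repr_vecElt {b : ℕ} (c : Fin d × Fin (b + 1) → κ) (i : Fin d) :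
    ω.repr (vecElt ω c) i = vecPoly c i := by
  rw [vecElt_eq, Module.Basis.repr_sum_self]

theorem coeff_vecPoly {b : ℕ} (c : Fin d × Fin (b + 1) → κ) (i : Fin d) (j : Fin (b + 1)) :
    (vecPoly c i).coeff j = c (i, j) := by
  simp only [vecPoly, finsetSum_coeff, coeff_C_mul, coeff_X_pow]
  rw [Finset.sum_eq_single j]
  · simp
  · intro k _ hk
    rw [if_neg (fun h => hk (Fin.ext h.symm)), mul_zero]
  · simp

theorem coordDegLE_vecElt {b : ℕ} (c : Fin d × Fin (b + 1) → κ) :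
    CoordDegLE ω b (vecElt ω c) := fun i => by
  rw [repr_vecElt]
  refine natDegree_sum_le_of_forall_le _ _ fun j _ => ?_
  exact (natDegree_C_mul_X_pow_le _ _).trans (Nat.lt_succ_iff.1 j.2)

theorem vecElt_injective {b : ℕ} :
    Function.Injective (vecElt ω : (Fin d × Fin (b + 1) → κ) → O) := by
  intro c c' h
  ext ⟨i, j⟩
  rw [← coeff_vecPoly c, ← coeff_vecPoly c', ← repr_vecElt ω, ← repr_vecElt ω, h]

theorem exists_vecElt_order_injective (ev : O →ₐ[κ[X]] PowerSeries κ)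
    (hev : Function.Injective ev) (b : ℕ) :
    ∃ t : Fin (d * (b + 1)) → (Fin d × Fin (b + 1) → κ),
      (∀ j, ev (vecElt ω (t j)) ≠ 0) ∧
      Function.Injective fun j => (ev (vecElt ω (t j))).order := by
  let Ψ : (Fin d × Fin (b + 1) → κ) →ₗ[κ] PowerSeries κ :=
    { toFun := fun c => ev (vecElt ω c)
      map_add' := fun c c' => by
        simp only [vecElt, Pi.add_apply, add_mul, add_smul, Finset.sum_add_distrib, map_add]
      map_smul' := fun a c => by
        have h : vecElt ω (a • c) = (C a : κ[X]) • vecElt ω c := by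
          simp only [vecElt, Pi.smul_apply, smul_eq_mul, C_mul, Finset.smul_sum, smul_smul,
            mul_assoc]
        rw [h, map_smul, Algebra.smul_def, PowerSeries.algebraMap_apply']
        simp [PowerSeries.smul_eq_C_mul] }
  have hΨ : Function.Injective Ψ := hev.comp (vecElt_injective ω)
  have hrank : d * (b + 1) ≤ Module.finrank κ (LinearMap.range Ψ) := by
    rw [LinearMap.finrank_range_of_inj hΨ]
    simp
  obtain ⟨t, ht, hti⟩ := PowerSeries.exists_family_order_injective _ _ hrank
  choose c hc using fun j => (ht j).1
  have hc' : ∀ j, ev (vecElt ω (c j)) = t j := hc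
  refine ⟨c, fun j => ?_, ?_⟩
  · rw [hc']; exact (ht j).2
  · simpa only [hc'] using hti

/-- The inequality produced by the auxiliary function in Stepanov's method. -/
theorem stepanov_card_le [IsDomain O] [IsAlgClosed κ] {p : ℕ} [hp : Fact p.Prime] [CharP κ p]
    [CharP O p] (ev : O →ₐ[κ[X]] PowerSeries κ) (hev : Function.Injective ev) {c₀ c₁ : ℕ}
    (hmul : ∀ i j, CoordDegLE ω c₀ (ω i * ω j)) (hpow : ∀ i, CoordDegLE ω c₀ (ω i ^ p))
    (r : ℕ) (τ : Fin d → O) (hτ : ∀ i, CoordDegLE ω c₁ (τ i)) (Z : Finset κ)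
    (hZ : ∀ z ∈ Z, z ^ p ^ (r + r) = z ∧
      (∀ i, algebraMap κ[X] O (X - C z) ∣ ω i ^ p ^ (r + r) - τ i) ∧
      ∀ o : O, algebraMap κ[X] O (X - C z) ∣ o ^ p → algebraMap κ[X] O (X - C z) ∣ o)
    (a b : ℕ) (ha : d * (a + c₀) < p ^ r)
    (hab : d * (p ^ r * (a + c₀) + (b + c₁) + c₀ + 1) < d * (b + 1) * (d * (a + 1))) :
    Z.card ≤ a + p ^ r * (b + c₀) + c₀ := by
  obtain ⟨t, ht0, hti⟩ := exists_vecElt_order_injective ω ev hev b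
  -- the reductions of the `p ^ (2 * r)`-th powers of the `t j`
  let T : Fin (d * (b + 1)) → O := fun j =>
    ∑ x, (C (t j x ^ p ^ (r + r)) * X ^ (x.2 : ℕ)) • τ x.1
  have hT : ∀ j, CoordDegLE ω (b + c₁) (T j) := fun j =>
    CoordDegLE.sum _ fun x _ => CoordDegLE.smul
      ((natDegree_C_mul_X_pow_le _ _).trans (Nat.lt_succ_iff.1 x.2.2)) (hτ _)
  let e : Fin d × Fin (a + 1) → O := fun x => (X ^ (x.2 : ℕ) : κ[X]) • ω x.1
  have he : ∀ x, CoordDegLE ω a (e x) := by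
    intro x i
    simp only [e, map_smul, Finsupp.smul_apply, smul_eq_mul, Module.Basis.repr_self]
    refine (natDegree_mul_le_of_le (natDegree_X_pow_le _) (n := 0) ?_).trans
      (Nat.lt_succ_iff.1 x.2.2)
    rw [Finsupp.single_apply]
    split_ifs <;> simp
  let v : Fin (d * (b + 1)) × (Fin d × Fin (a + 1)) → O := fun y => e y.2 ^ p ^ r * T y.1
  have hv : ∀ y, CoordDegLE ω (p ^ r * (a + c₀) + (b + c₁) + c₀) (v y) := fun y =>
    CoordDegLE.mul hmul ((he y.2).pow_char_pow hpow r) (hT y.1)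
  obtain ⟨c, hc, y₀, hy₀⟩ := exists_relation_of_coordDegLE v hv (by simpa using hab)
  choose c' hc' using fun y => IsAlgClosed.exists_pow_nat_eq (c y) (pow_pos hp.out.pos r)
  let s : Fin (d * (b + 1)) → O := fun j => vecElt ω fun x => c' (j, x)
  let g : O := ∑ j, s j * vecElt ω (t j) ^ p ^ r
  have hg0 : g ≠ 0 := by
    intro h0
    have h1 := congrArg ev h0
    simp only [g, map_sum, map_mul, map_pow, map_zero] at h1
    refine PowerSeries.sum_mul_pow_ne_zero (p ^ r) _ _ ?_ ht0 hti ?_ h1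
    · intro j
      by_cases hj : s j = 0
      · left; rw [hj, map_zero]
      · right
        refine lt_of_le_of_lt (CoordDegLE.order_le ev hmul hj (coordDegLE_vecElt ω _)) ?_
        exact_mod_cast ha
    · refine ⟨y₀.1, fun h => hy₀ ?_⟩
      have h2 : s y₀.1 = 0 := hev (by rw [h, map_zero])
      have h3 : vecElt ω (0 : Fin d × Fin (a + 1) → κ) = 0 := by simp [vecElt]
      have h4 := congrFun (vecElt_injective ω (h2.trans h3.symm)) y₀.2
      rw [← hc' y₀]
      simp only [Pi.zero_apply] at h4
      rw [h4, zero_pow (pow_pos hp.out.pos r).ne']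
  have hsp : ∀ j, s j ^ p ^ r = ∑ x, C (c (j, x)) • e x ^ p ^ r := by
    intro j
    simp only [s, vecElt]
    rw [sum_pow_char_pow]
    refine Finset.sum_congr rfl fun x _ => ?_
    rw [mul_smul, _root_.smul_pow, ← C_pow, hc']
  have hrel : ∑ j, s j ^ p ^ r * T j = 0 := by
    rw [← hc, Fintype.sum_prod_type]
    refine Finset.sum_congr rfl fun j _ => ?_
    rw [hsp, Finset.sum_mul]
    refine Finset.sum_congr rfl fun x _ => ?_
    rw [smul_mul_assoc]
  have hgp : ∀ z ∈ Z, algebraMap κ[X] O (X - C z) ∣ g := by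
    intro z hz
    obtain ⟨hz1, hz2, hz3⟩ := hZ z hz
    have htT : ∀ j, algebraMap κ[X] O (X - C z) ∣ vecElt ω (t j) ^ p ^ (r + r) - T j := by
      intro j
      simp only [vecElt, T]
      rw [sum_pow_char_pow, ← Finset.sum_sub_distrib]
      refine Finset.dvd_sum fun x _ => ?_
      have h1 : (X - C z : κ[X]) ∣
          (X ^ (x.2 : ℕ)) ^ p ^ (r + r) - X ^ (x.2 : ℕ) := by
        rw [dvd_iff_isRoot]
        simp only [IsRoot.def, eval_sub, eval_pow, eval_X]
        rw [← pow_mul, mul_comm, pow_mul, hz1, sub_self]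
      rw [_root_.smul_pow, mul_pow, ← C_pow, Algebra.smul_def, Algebra.smul_def]
      have h2 := map_dvd (algebraMap κ[X] O) h1
      rw [map_sub (algebraMap κ[X] O) ((X ^ (x.2 : ℕ)) ^ p ^ (r + r)) _] at h2
      have h3 : algebraMap κ[X] O (C (t j x ^ p ^ (r + r)) * (X ^ (x.2 : ℕ)) ^ p ^ (r + r)) *
          ω x.1 ^ p ^ (r + r) - algebraMap κ[X] O (C (t j x ^ p ^ (r + r)) * X ^ (x.2 : ℕ)) *
            τ x.1 =
          (algebraMap κ[X] O ((X ^ (x.2 : ℕ)) ^ p ^ (r + r)) - algebraMap κ[X] O (X ^ (x.2 : ℕ)))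
            * (algebraMap κ[X] O (C (t j x ^ p ^ (r + r))) * ω x.1 ^ p ^ (r + r)) +
          algebraMap κ[X] O (C (t j x ^ p ^ (r + r)) * X ^ (x.2 : ℕ)) *
            (ω x.1 ^ p ^ (r + r) - τ x.1) := by
        simp only [map_mul]; ring
      rw [h3]
      exact dvd_add (h2.mul_right _) ((hz2 _).mul_left _)
    have h1 : algebraMap κ[X] O (X - C z) ∣ g ^ p ^ r := by
      have h2 : g ^ p ^ r = ∑ j, s j ^ p ^ r * (vecElt ω (t j) ^ p ^ (r + r) - T j) := by
        simp only [mul_sub, Finset.sum_sub_distrib, hrel, sub_zero, g]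
        rw [sum_pow_char_pow]
        refine Finset.sum_congr rfl fun j _ => ?_
        rw [mul_pow, ← pow_mul, ← pow_add]
      rw [h2]
      exact Finset.dvd_sum fun j _ => (htT j).mul_left _
    have h3 : ∀ m : ℕ, algebraMap κ[X] O (X - C z) ∣ g ^ p ^ m →
        algebraMap κ[X] O (X - C z) ∣ g := by
      intro m
      induction m with
      | zero => simp
      | succ m ih =>
        intro h
        rw [pow_succ, pow_mul] at h
        exact ih (hz3 _ h)
    exact h3 r h1
  have hgdeg : CoordDegLE ω (a + p ^ r * (b + c₀) + c₀) g :=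
    CoordDegLE.sum _ fun j _ =>
      CoordDegLE.mul hmul (coordDegLE_vecElt ω _) ((coordDegLE_vecElt ω _).pow_char_pow hpow r)
  obtain ⟨i, hi⟩ : ∃ i, ω.repr g i ≠ 0 := by
    by_contra! h
    exact hg0 (ω.repr.injective (Finsupp.ext fun i => by simpa using h i))
  refine le_trans ?_ (hgdeg i)
  classical
  refine (Finset.card_le_card fun z hz => ?_).trans
    ((Multiset.toFinset_card_le (ω.repr g i).roots).trans (card_roots' _))
  rw [Multiset.mem_toFinset, mem_roots hi]
  obtain ⟨g', hg'⟩ := hgp z hz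
  rw [hg', ← Algebra.smul_def, map_smul]
  simp

/-- **Stepanov's method**: `d * card Z ≤ Q ^ 2 + O(Q)`. -/
theorem exists_stepanov_bound [IsDomain O] [IsAlgClosed κ] {p : ℕ} [hp : Fact p.Prime] [CharP κ p]
    [CharP O p] (ev : O →ₐ[κ[X]] PowerSeries κ) (hev : Function.Injective ev) (c₁ : ℕ) :
    ∃ K : ℕ, ∀ (r : ℕ) (τ : Fin d → O), 0 < r → (∀ i, CoordDegLE ω c₁ (τ i)) → ∀ Z : Finset κ,
      (∀ z ∈ Z, z ^ p ^ (r + r) = z ∧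
        (∀ i, algebraMap κ[X] O (X - C z) ∣ ω i ^ p ^ (r + r) - τ i) ∧
        ∀ o : O, algebraMap κ[X] O (X - C z) ∣ o ^ p → algebraMap κ[X] O (X - C z) ∣ o) →
      d * Z.card ≤ p ^ (r + r) + K * p ^ r := by
  obtain ⟨m₁, hm₁⟩ := exists_coordDegLE_forall (ω := ω) fun x : Fin d × Fin d => ω x.1 * ω x.2
  obtain ⟨m₂, hm₂⟩ := exists_coordDegLE_forall (ω := ω) fun i => ω i ^ p
  set c₀ := max m₁ m₂
  have hmul : ∀ i j, CoordDegLE ω c₀ (ω i * ω j) := fun i j =>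
    (hm₁ (i, j)).mono (le_max_left _ _)
  have hpow : ∀ i, CoordDegLE ω c₀ (ω i ^ p) := fun i => (hm₂ i).mono (le_max_right _ _)
  have hd : 0 < d := by
    rcases Nat.eq_zero_or_pos d with rfl | h
    · have : Subsingleton O := ω.repr.toEquiv.subsingleton
      exact absurd (zero_ne_one (α := O)) (by simp [Subsingleton.elim (0 : O) 1])
    · exact h
  set L := 2 * d * c₀ + 2 * d + 3 * c₀ + c₁ + 6
  refine ⟨d * L + 1 + d * (2 * c₀ + 5) + 2 * d * c₀, fun r τ hr hτ Z hZ => ?_⟩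
  set Q := p ^ r with hQ
  have hQ2 : p ^ (r + r) = Q * Q := pow_add _ _ _
  have hQ1 : 1 ≤ Q := Nat.one_le_pow _ _ hp.out.pos
  by_cases hL : Q ≤ L
  · have h1 : Z.card ≤ Q * Q := by
      rw [← hQ2]
      classical
      have h0 := FiniteField.X_pow_card_pow_sub_X_ne_zero κ (p := p) (n := r + r) (by omega)
        hp.out.one_lt
      rw [← FiniteField.X_pow_card_pow_sub_X_natDegree_eq κ (p := p) (n := r + r) (by omega)
        hp.out.one_lt]
      refine (Finset.card_le_card fun z hz => ?_).trans
        ((Multiset.toFinset_card_le _).trans (card_roots' _))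
      rw [Multiset.mem_toFinset, mem_roots h0]
      simp [(hZ z hz).1]
    calc d * Z.card ≤ d * (Q * Q) := by gcongr
      _ ≤ d * (L * Q) := by gcongr
      _ ≤ _ := by rw [hQ2]; nlinarith [Nat.zero_le (Q * Q), Nat.zero_le (1 * Q),
        Nat.zero_le (d * (2 * c₀ + 5) * Q), Nat.zero_le (2 * d * c₀ * Q)]
  · push Not at hL
    have hdiv := Nat.div_add_mod (Q - 1) d
    have hmod := Nat.mod_lt (Q - 1) hd
    have hdiv' := Nat.div_add_mod Q d
    have hmod' := Nat.mod_lt Q hd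
    have hca : c₀ ≤ (Q - 1) / d := by
      rw [Nat.le_div_iff_mul_le hd]
      have : c₀ * d ≤ L := by simp only [L]; nlinarith
      omega
    obtain ⟨a, ha⟩ := Nat.exists_eq_add_of_le hca
    set E := 2 * c₀ + 5
    obtain ⟨b, hb⟩ : ∃ b, b + 1 = Q / d + E := ⟨Q / d + E - 1,
      Nat.sub_add_cancel (by simp only [E]; exact Nat.succ_le_of_lt (by positivity))⟩
    have hda : d * (a + c₀) < Q := by
      rw [add_comm a, ← ha]; omega
    have hda' : Q ≤ 2 * (d * (a + 1)) := by
      have : d * (a + 1) + d * c₀ = d * ((Q - 1) / d) + d := by rw [ha]; ring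
      have : 2 * (d * c₀) ≤ L := by simp only [L]; nlinarith
      omega
    have hdb : Q + d * (E - 1) ≤ d * (b + 1) := by
      rw [hb, mul_add]
      have : d * E = d * (E - 1) + d := by
        obtain ⟨E', hE'⟩ : ∃ E', E = E' + 1 := ⟨E - 1, by omega⟩
        rw [hE']; simp; ring
      omega
    have hdb' : d * b ≤ Q + d * E := by
      have : d * (b + 1) = d * (Q / d) + d * E := by rw [hb, mul_add]
      rw [mul_add] at this
      omega
    have hbQ : b + 1 ≤ Q + E := by
      have := Nat.div_le_self Q d
      omega
    have hab : d * (Q * (a + c₀) + (b + c₁) + c₀ + 1) < d * (b + 1) * (d * (a + 1)) := by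
      have h1 : Q * (a + c₀) + (b + c₁) + c₀ + 1 < (b + 1) * (d * (a + 1)) := by
        have h2 : (Q + d * (E - 1)) * (a + 1) ≤ d * (b + 1) * (a + 1) := by gcongr
        have h3 : E - 1 = 2 * c₀ + 4 := by omega
        rw [h3] at h2
        have h4 : Q * (c₀ + 2) ≤ 2 * (d * (a + 1)) * (c₀ + 2) := by gcongr
        have h5 : E = 2 * c₀ + 5 := rfl
        have h6 : 3 * c₀ + c₁ + 6 ≤ L := by simp only [L]; omega
        nlinarith
      calc _ < d * ((b + 1) * (d * (a + 1))) := Nat.mul_lt_mul_of_pos_left h1 hd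
        _ = _ := by ring
    have h1 := stepanov_card_le ω ev hev hmul hpow r τ hτ Z hZ a b hda hab
    calc d * Z.card ≤ d * (a + Q * (b + c₀) + c₀) := by gcongr
      _ = d * (a + c₀) + Q * (d * b) + Q * (d * c₀) := by ring
      _ ≤ Q + Q * (Q + d * E) + Q * (d * c₀) := by gcongr
      _ ≤ _ := by rw [hQ2]; nlinarith [Nat.zero_le (d * L * Q), Nat.zero_le (d * c₀ * Q)]

end Stepanov

section Frobenius
variable (F : Type*) [Field F] [Fintype F]

/-- The ring endomorphism `x ↦ x ^ (q ^ k)` of an algebra over the field with `q` elements. -/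
noncomputable def qFrob (S : Type*) [CommRing S] [Algebra F S] (k : ℕ) : S →ₐ[F] S :=
  FiniteField.frobeniusAlgHom F S ^ k

theorem qFrob_apply {S : Type*} [CommRing S] [Algebra F S] (k : ℕ) (x : S) :
    qFrob F S k x = x ^ Fintype.card F ^ k := by
  induction k generalizing x with
  | zero => simp [qFrob]
  | succ k ih =>
    have h : qFrob F S (k + 1) x = qFrob F S k (FiniteField.frobeniusAlgHom F S x) := by
      simp [qFrob, pow_succ]
    rw [h, ih, FiniteField.coe_frobeniusAlgHom, ← pow_mul, pow_succ']

variable {F} {ι S T : Type*} [Fintype ι] [DecidableEq ι] [CommRing S] [Algebra F S]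
  [CommRing T] [Algebra F T]

variable (F) in
/-- The twisted norm `φ ^ (k - 1) u ⋯ φ u · u` of a matrix. -/
noncomputable def frobNorm (u : Matrix ι ι S) : ℕ → Matrix ι ι S
  | 0 => 1
  | k + 1 => (qFrob F S 1).mapMatrix (frobNorm u k) * u

theorem map_qFrob (θ : S →+* T) (k : ℕ) (x : S) : θ (qFrob F S k x) = qFrob F T k (θ x) := by
  simp [qFrob_apply]

theorem map_frobNorm (θ : S →+* T) (u : Matrix ι ι S) (k : ℕ) :
    θ.mapMatrix (frobNorm F u k) = frobNorm F (θ.mapMatrix u) k := by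
  induction k with
  | zero => simp [frobNorm]
  | succ k ih =>
    rw [frobNorm, frobNorm, map_mul, ← ih]
    congr 1
    ext i j
    simp [map_qFrob]

theorem mapMatrix_qFrob_eq_frobNorm_mul {u w : Matrix ι ι S}
    (h : (qFrob F S 1).mapMatrix w = u * w) (k : ℕ) :
    (qFrob F S k).mapMatrix w = frobNorm F u k * w := by
  induction k with
  | zero => ext; simp [frobNorm, qFrob]
  | succ k ih =>
    have h1 : (qFrob F S (k + 1)).mapMatrix w =
        (qFrob F S 1).mapMatrix ((qFrob F S k).mapMatrix w) := by
      ext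
      simp [qFrob_apply, ← pow_mul, pow_succ]
    rw [h1, ih, map_mul, h, frobNorm, mul_assoc]

end Frobenius

section PowerSeriesSolution
variable {F : Type*} [Field F] [Fintype F] {κ : Type*} [Field κ] [Algebra F κ]
  {ι : Type*} [Fintype ι] [DecidableEq ι]

variable (F) in
theorem succ_div_card_lt (n : ℕ) : (n + 1) / Fintype.card F < n + 1 :=
  Nat.div_lt_self n.succ_pos Fintype.one_lt_card

variable (F) in
/-- The coefficients of the solution `w = 1 + ⋯` of `φ w = (1 - γ X) w`. -/
noncomputable def langCoeff (γ : Matrix ι ι κ) : ℕ → Matrix ι ι κ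
  | 0 => 1
  | n + 1 =>
    have := succ_div_card_lt F n
    γ * langCoeff γ n + if Fintype.card F ∣ n + 1 then
      (qFrob F κ 1).mapMatrix (langCoeff γ ((n + 1) / Fintype.card F)) else 0

variable (F) in
/-- The solution `w = 1 + ⋯` of `φ w = (1 - γ X) w` in power series. -/
noncomputable def langSol (γ : Matrix ι ι κ) : Matrix ι ι (PowerSeries κ) :=
  Matrix.of fun i j => PowerSeries.mk fun n => langCoeff F γ n i j

theorem coeff_langSol (γ : Matrix ι ι κ) (n : ℕ) (i j : ι) :
    PowerSeries.coeff n (langSol F γ i j) = langCoeff F γ n i j := by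
  simp [langSol]

theorem coeff_pow_card (f : PowerSeries κ) (n : ℕ) :
    PowerSeries.coeff n (f ^ Fintype.card F) = if Fintype.card F ∣ n then
      PowerSeries.coeff (n / Fintype.card F) f ^ Fintype.card F else 0 := by
  obtain ⟨p, hp, e, hpp, hq⟩ := FiniteField.card' F
  have : Fact p.Prime := ⟨hpp⟩
  have : CharP κ p := (Algebra.charP_iff F κ p).1 hp
  rw [hq]
  have h : PowerSeries.map (iterateFrobenius κ p e)
      (PowerSeries.expand (p ^ (e : ℕ)) (pow_ne_zero e hpp.ne_zero) f) = f ^ p ^ (e : ℕ) :=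
    MvPowerSeries.map_iterateFrobenius_expand p hpp.ne_zero f e
  rw [← h, PowerSeries.coeff_map, PowerSeries.coeff_expand, apply_ite (iterateFrobenius κ p e),
    map_zero, iterateFrobenius_def]

theorem map_langSol (γ : Matrix ι ι κ) :
    (qFrob F (PowerSeries κ) 1).mapMatrix (langSol F γ) =
      (1 - (PowerSeries.X : PowerSeries κ) • γ.map PowerSeries.C) * langSol F γ := by
  ext i j n
  have hq : 0 < Fintype.card F := Fintype.card_pos
  rw [AlgHom.mapMatrix_apply, Matrix.map_apply, qFrob_apply, pow_one, coeff_pow_card, sub_mul,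
    one_mul, Matrix.sub_apply, map_sub, coeff_langSol, coeff_langSol, Matrix.smul_mul,
    Matrix.smul_apply, smul_eq_mul]
  cases n with
  | zero => by_cases h : i = j <;> simp [langCoeff, h, hq.ne']
  | succ n =>
    rw [PowerSeries.coeff_succ_X_mul, langCoeff, Matrix.add_apply, Matrix.mul_apply,
      Matrix.mul_apply, map_sum]
    simp only [Matrix.map_apply, PowerSeries.coeff_C_mul, coeff_langSol]
    split_ifs <;> simp [qFrob_apply]

theorem langCoeff_pow (γ : Matrix ι ι κ) (s : ℕ)
    (hγ : (qFrob F κ s).mapMatrix γ = γ) (n : ℕ) :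
    (qFrob F κ s).mapMatrix (langCoeff F γ n) = langCoeff F γ n := by
  induction n using Nat.strong_induction_on with
  | _ n ih =>
    cases n with
    | zero => simp [langCoeff]
    | succ n =>
      rw [langCoeff, map_add, map_mul, hγ, ih n n.lt_succ_self]
      split_ifs
      · congr 1
        have h := ih ((n + 1) / Fintype.card F)
          (Nat.div_lt_self n.succ_pos Fintype.one_lt_card)
        nth_rewrite 2 [← h]
        ext
        simp [qFrob_apply, ← pow_mul, mul_comm]
      · simp

end PowerSeriesSolution

theorem Module.finite_of_pow_mem_span {R O σ : Type*} [CommRing R] [CommRing O] [Algebra R O]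
    [Finite σ] (v : σ → O) (hv : Function.Surjective (MvPolynomial.aeval (R := R) v)) {q : ℕ}
    (hq : 2 ≤ q) (h : ∀ x, v x ^ q ∈ Submodule.span R (Set.range v)) : Module.Finite R O := by
  classical
  cases nonempty_fintype σ
  let S : Submodule R O := Submodule.span R (Set.range fun e : σ → Fin q => ∏ x, v x ^ (e x : ℕ))
  have key : ∀ N : ℕ, ∀ s : σ → ℕ, ∑ x, s x = N → ∏ x, v x ^ s x ∈ S := by
    intro N
    induction N using Nat.strong_induction_on with
    | _ N ih =>
      intro s hs
      by_cases hlt : ∀ x, s x < q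
      · exact Submodule.subset_span ⟨fun x => ⟨s x, hlt x⟩, rfl⟩
      · push Not at hlt
        obtain ⟨x, hx⟩ := hlt
        let s' : σ → ℕ := s - Pi.single x q
        have hs' : s = s' + Pi.single x q := by
          ext y
          by_cases hy : y = x
          · subst hy; simp [s', hx]
          · simp [s', hy]
        have hprod : ∀ (t : σ → ℕ) (y : σ) (m : ℕ),
            ∏ z, v z ^ (t + Pi.single y m : σ → ℕ) z = (∏ z, v z ^ t z) * v y ^ m := by
          intro t y m
          simp only [Pi.add_apply, pow_add, Finset.prod_mul_distrib]
          congr 1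
          rw [Finset.prod_eq_single y]
          · simp
          · intro z _ hz; simp [hz]
          · simp
        have hsum : ∀ (t : σ → ℕ) (y : σ) (m : ℕ),
            ∑ z, (t + Pi.single y m : σ → ℕ) z = (∑ z, t z) + m := by
          intro t y m
          simp [Finset.sum_add_distrib]
        rw [hs', hprod]
        have hle : Submodule.span R (Set.range v) ≤
            S.comap (LinearMap.mulLeft R (∏ z, v z ^ s' z)) := by
          rw [Submodule.span_le]
          rintro _ ⟨y, rfl⟩
          have h1 := hprod s' y 1
          rw [pow_one] at h1
          rw [SetLike.mem_coe, Submodule.mem_comap, LinearMap.mulLeft_apply, ← h1]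
          refine ih _ ?_ _ rfl
          have h2 := hsum s' x q
          rw [← hs', hs] at h2
          rw [hsum, h2]
          omega
        exact hle (h x)
  refine ⟨Submodule.fg_def.2 ⟨_, Set.finite_range fun e : σ → Fin q => ∏ x, v x ^ (e x : ℕ), ?_⟩⟩
  change S = ⊤
  rw [eq_top_iff]
  intro o _
  obtain ⟨Φ, rfl⟩ := hv o
  rw [Φ.as_sum, map_sum]
  refine Submodule.sum_mem _ fun s _ => ?_
  rw [MvPolynomial.aeval_monomial, ← Algebra.smul_def, Finsupp.prod_fintype _ _ (by simp)]
  exact Submodule.smul_mem _ _ (key _ _ rfl)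

theorem RingHom.injective_of_surjective_of_isNoetherianRing {R : Type*} [CommRing R]
    [IsNoetherianRing R] (φ : R →+* R) (h : Function.Surjective φ) : Function.Injective φ := by
  rw [injective_iff_map_eq_zero]
  intro x hx
  have hmono : Monotone fun n : ℕ => RingHom.ker (φ ^ n) := monotone_nat_of_le_succ fun n y hy => by
    rw [RingHom.mem_ker] at hy ⊢
    rw [pow_succ', RingHom.mul_def, RingHom.comp_apply, hy, map_zero]
  obtain ⟨n, hn⟩ := monotone_stabilizes_iff_noetherian.2 ‹IsNoetherianRing R› ⟨_, hmono⟩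
  obtain ⟨y, rfl⟩ : ∃ y, (φ ^ n) y = x := by
    rw [RingHom.coe_pow]
    exact h.iterate n x
  have h1 : y ∈ RingHom.ker (φ ^ (n + 1)) := by
    rw [RingHom.mem_ker, pow_succ', RingHom.mul_def, RingHom.comp_apply, hx]
  have h2 : RingHom.ker (φ ^ n) = RingHom.ker (φ ^ (n + 1)) := hn (n + 1) n.le_succ
  rw [← h2] at h1
  exact h1

section Curve
variable {F κ O ι : Type*} [Field F] [Fintype F] [Field κ] [CommRing O]
  [Algebra κ[X] O] [Fintype ι] [DecidableEq ι]

/-- The matrix `1 - X γ`. -/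
noncomputable def langMat (γ : Matrix ι ι κ) : Matrix ι ι κ[X] := 1 - (X : κ[X]) • γ.map C

variable (O) in
/-- Scalars of `κ` in `O`. -/
noncomputable def cst : κ →+* O := (algebraMap κ[X] O).comp C

/-- Polynomials in the entries of a matrix. -/
noncomputable def matEval (w : Matrix ι ι O) : MvPolynomial (ι × ι) κ[X] →ₐ[κ[X]] O :=
  MvPolynomial.aeval fun x => w x.1 x.2

/-- Raise the coefficients in `κ` to the power `q ^ k`. -/
noncomputable def frobCoeff (F : Type*) [Field F] [Fintype F] [Algebra F κ] (k : ℕ) :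
    MvPolynomial (ι × ι) κ[X] →+* MvPolynomial (ι × ι) κ[X] :=
  MvPolynomial.map (mapRingHom (qFrob F κ k : κ →+* κ))

variable [Algebra F O] {w : Matrix ι ι O} {γ : Matrix ι ι κ}

theorem finite_of_langMat
    (hw : (qFrob F O 1).mapMatrix w = (algebraMap κ[X] O).mapMatrix (langMat γ) * w)
    (hgen : Function.Surjective (matEval (κ := κ) w)) : Module.Finite κ[X] O := by
  refine Module.finite_of_pow_mem_span _ hgen (Fintype.one_lt_card (α := F)) fun x => ?_
  have h := congrFun (congrFun hw x.1) x.2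
  rw [AlgHom.mapMatrix_apply, Matrix.map_apply, qFrob_apply, pow_one] at h
  rw [h, Matrix.mul_apply]
  refine Submodule.sum_mem _ fun l _ => ?_
  rw [RingHom.mapMatrix_apply, Matrix.map_apply, ← Algebra.smul_def]
  exact Submodule.smul_mem _ _ (Submodule.subset_span ⟨(l, x.2), rfl⟩)

theorem map_eval_langMat (γ : Matrix ι ι κ) (z : κ) :
    (evalRingHom z).mapMatrix (langMat γ) = 1 - z • γ := by
  ext i j
  by_cases h : i = j <;> simp [langMat, h, mul_comm z]

theorem dvd_of_dvd_pow_card [IsAlgClosed κ]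
    (hw : (qFrob F O 1).mapMatrix w = (algebraMap κ[X] O).mapMatrix (langMat γ) * w)
    (hgen : Function.Surjective (matEval (κ := κ) w)) {z : κ} (hz : IsUnit (1 - z • γ)) {o : O}
    (ho : algebraMap κ[X] O (X - C z) ∣ o ^ Fintype.card F) :
    algebraMap κ[X] O (X - C z) ∣ o := by
  have := finite_of_langMat hw hgen
  have : IsNoetherianRing O := IsNoetherianRing.of_finite κ[X] O
  set I := Ideal.span {algebraMap κ[X] O (X - C z)}
  set π := Ideal.Quotient.mk I
  have hπ : ∀ f : κ[X], π (algebraMap κ[X] O f) = π (cst O (f.eval z)) := by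
    intro f
    rw [cst, RingHom.comp_apply, Ideal.Quotient.eq, ← map_sub, Ideal.mem_span_singleton]
    exact map_dvd _ (X_sub_C_dvd_sub_C_eval)
  let φ : O ⧸ I →+* O ⧸ I := qFrob F (O ⧸ I) 1
  have hφ : ∀ x, φ x = x ^ Fintype.card F := fun x => by
    simp only [φ, RingHom.coe_coe, qFrob_apply, pow_one]
  have hcst : ∀ c : κ, π (cst O c) ∈ φ.range := by
    intro c
    obtain ⟨c', hc'⟩ := IsAlgClosed.exists_pow_nat_eq c (Fintype.card_pos (α := F))
    exact ⟨π (cst O c'), by rw [hφ, ← map_pow, ← map_pow, hc']⟩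
  have hwr : ∀ i j, π (w i j) ∈ φ.range := by
    intro i j
    have h1 : π.mapMatrix w = (π.comp (cst O)).mapMatrix (1 - z • γ)⁻¹ *
        (qFrob F (O ⧸ I) 1).mapMatrix (π.mapMatrix w) := by
      have h2 := congrArg π.mapMatrix hw
      have h3 : π.mapMatrix ((qFrob F O 1).mapMatrix w) =
          (qFrob F (O ⧸ I) 1).mapMatrix (π.mapMatrix w) := by
        ext; simp [qFrob_apply]
      have h4 : π.mapMatrix ((algebraMap κ[X] O).mapMatrix (langMat γ)) =
          (π.comp (cst O)).mapMatrix (1 - z • γ) := by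
        rw [← map_eval_langMat]
        ext
        exact hπ _
      rw [h3, map_mul, h4] at h2
      rw [h2, ← mul_assoc, ← map_mul, Matrix.nonsing_inv_mul _
        ((Matrix.isUnit_iff_isUnit_det _).1 hz), map_one, one_mul]
    have h2 := congrFun (congrFun h1 i) j
    rw [RingHom.mapMatrix_apply, Matrix.map_apply] at h2
    rw [h2, Matrix.mul_apply]
    refine Subring.sum_mem _ fun l _ => Subring.mul_mem _ (hcst _) ⟨π (w l j), rfl⟩
  have hsurj : Function.Surjective φ := by
    intro x
    obtain ⟨y, rfl⟩ := Ideal.Quotient.mk_surjective x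
    obtain ⟨Φ, rfl⟩ := hgen y
    change _ ∈ φ.range
    induction Φ using MvPolynomial.induction_on with
    | C f =>
      rw [matEval, MvPolynomial.aeval_C]
      exact (hπ f) ▸ hcst _
    | add f g hf hg => rw [map_add, map_add]; exact Subring.add_mem _ hf hg
    | mul_X f x hf =>
      rw [map_mul, map_mul]
      refine Subring.mul_mem _ hf ?_
      simpa [matEval] using hwr x.1 x.2
  have hinj := φ.injective_of_surjective_of_isNoetherianRing hsurj
  rw [← Ideal.mem_span_singleton, ← Ideal.Quotient.eq_zero_iff_mem] at ho ⊢
  refine hinj ?_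
  rw [map_zero, hφ, ← map_pow]
  exact ho

variable [Algebra F κ]

theorem frobCoeff_dvd
    (hw : (qFrob F O 1).mapMatrix w = (algebraMap κ[X] O).mapMatrix (langMat γ) * w)
    {k : ℕ} {z : κ} (hz : z ^ Fintype.card F ^ k = z) (Φ : MvPolynomial (ι × ι) κ[X]) :
    algebraMap κ[X] O (X - C z) ∣ matEval w Φ ^ Fintype.card F ^ k -
      matEval ((cst O).mapMatrix (frobNorm F (1 - z • γ) k) * w) (frobCoeff F k Φ) := by
  rw [← Ideal.mem_span_singleton, ← Ideal.Quotient.eq]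
  set π := Ideal.Quotient.mk (Ideal.span {algebraMap κ[X] O (X - C z)})
  have hπ : ∀ f : κ[X], π (algebraMap κ[X] O f) = π (cst O (f.eval z)) := by
    intro f
    rw [cst, RingHom.comp_apply, Ideal.Quotient.eq, ← map_sub, Ideal.mem_span_singleton]
    exact map_dvd _ (X_sub_C_dvd_sub_C_eval)
  have h1 : (π.comp (qFrob F O k : O →+* O)).comp (matEval (κ := κ) w).toRingHom =
      (π.comp (matEval (κ := κ) ((cst O).mapMatrix (frobNorm F (1 - z • γ) k) * w)).toRingHom).comp
        (frobCoeff F k) := by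
    refine MvPolynomial.ringHom_ext (fun f => ?_) fun x => ?_
    · simp only [matEval, frobCoeff, RingHom.comp_apply, AlgHom.toRingHom_eq_coe, RingHom.coe_coe,
        MvPolynomial.aeval_C,
        MvPolynomial.map_C, qFrob_apply]
      have h2 : eval z (f.map (qFrob F κ k : κ →+* κ)) = eval z f ^ Fintype.card F ^ k := by
        have h3 := eval_map_apply (f := (qFrob F κ k : κ →+* κ)) (p := f) z
        simpa only [RingHom.coe_coe, qFrob_apply, hz] using h3
      rw [← map_pow, hπ, hπ, eval_pow, coe_mapRingHom, h2]
    · simp only [matEval, frobCoeff, RingHom.comp_apply, AlgHom.toRingHom_eq_coe, RingHom.coe_coe,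
        MvPolynomial.aeval_X,
        MvPolynomial.map_X]
      have h2 := congrFun (congrFun (mapMatrix_qFrob_eq_frobNorm_mul hw k) x.1) x.2
      rw [AlgHom.mapMatrix_apply, Matrix.map_apply] at h2
      rw [h2, ← map_frobNorm, ← map_eval_langMat, ← map_frobNorm, Matrix.mul_apply,
        Matrix.mul_apply, map_sum, map_sum]
      refine Finset.sum_congr rfl fun l _ => ?_
      rw [map_mul, map_mul]
      congr 1
      exact hπ _
  have h2 := RingHom.congr_fun h1 Φ
  simpa [qFrob_apply] using h2

end Curve

theorem exists_coordDegLE_frobCoeff {F κ O ι : Type*} [Field F] [Fintype F] [Field κ]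
    [Algebra F κ] [CommRing O] [Algebra κ[X] O] {d : ℕ} (ω : Module.Basis (Fin d) κ[X] O)
      (v : Matrix ι ι O)
    (Φ : MvPolynomial (ι × ι) κ[X]) :
    ∃ c, ∀ k, CoordDegLE ω c (matEval v (frobCoeff F k Φ)) := by
  obtain ⟨c₀, hc₀⟩ := exists_coordDegLE_forall (ω := ω) fun x : Fin d × Fin d => ω x.1 * ω x.2
  induction Φ using MvPolynomial.induction_on with
  | C f =>
    obtain ⟨c, hc⟩ := exists_coordDegLE (ω := ω) (1 : O)
    refine ⟨f.natDegree + c, fun k => ?_⟩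
    rw [frobCoeff, MvPolynomial.map_C, matEval, MvPolynomial.aeval_C,
      Algebra.algebraMap_eq_smul_one]
    exact CoordDegLE.smul natDegree_map_le hc
  | add f g hf hg =>
    obtain ⟨c, hc⟩ := hf
    obtain ⟨c', hc'⟩ := hg
    refine ⟨max c c', fun k => ?_⟩
    rw [map_add, map_add]
    exact ((hc k).mono (le_max_left _ _)).add ((hc' k).mono (le_max_right _ _))
  | mul_X f x hf =>
    obtain ⟨c, hc⟩ := hf
    obtain ⟨c', hc'⟩ := exists_coordDegLE (ω := ω) (v x.1 x.2)
    refine ⟨c + c' + c₀, fun k => ?_⟩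
    rw [map_mul, map_mul]
    refine CoordDegLE.mul (fun i j => hc₀ (i, j)) (hc k) ?_
    simpa [frobCoeff, matEval] using hc'

theorem AlgHom.card_le_finrank_of_isDomain {R O α : Type*} [CommRing R] [Nontrivial R] [CommRing O]
    [IsDomain O] [Algebra R O] [Module.Free R O] [Module.Finite R O] [Fintype α]
    (g : α → (O →ₐ[R] O)) (hg : Function.Injective g) :
    Fintype.card α ≤ Module.finrank R O := by
  have h := ((linearIndependent_toLinearMap R O O).comp g hg).fintype_card_le_finrank
  rwa [Module.finrank_linearMap_self] at h

section CurveGroup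
variable {κ O ι G : Type*} [Field κ] [CommRing O]
  [Algebra κ[X] O] [Fintype ι] [DecidableEq ι] [Group G]

/-- The group elements whose matrix induces an endomorphism of the curve. -/
def curveMonoid (w : Matrix ι ι O) (ρ : G →* Matrix ι ι κ) : Submonoid G where
  carrier := {c | ∃ g : O →ₐ[κ[X]] O, g.mapMatrix w = (cst O).mapMatrix (ρ c) * w}
  one_mem' := ⟨AlgHom.id _ _, by ext; simp⟩
  mul_mem' := by
    rintro a b ⟨g, hg⟩ ⟨g', hg'⟩
    refine ⟨g'.comp g, ?_⟩
    have h1 : (g'.comp g).mapMatrix w = g'.mapMatrix (g.mapMatrix w) := by ext; simp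
    have h2 : g'.mapMatrix ((cst O).mapMatrix (ρ a)) = (cst O).mapMatrix (ρ a) := by
      ext
      simp [cst]
    rw [h1, hg, map_mul, h2, hg', map_mul, map_mul, mul_assoc]

/-- The group elements whose matrix induces an automorphism of the curve. -/
def curveGroup [Finite G] (w : Matrix ι ι O) (ρ : G →* Matrix ι ι κ) : Subgroup G where
  __ := curveMonoid w ρ
  inv_mem' := by
    intro a ha
    have h1 : a⁻¹ = a ^ (orderOf a - 1) := by
      refine inv_eq_of_mul_eq_one_left ?_
      rw [← pow_succ, Nat.sub_add_cancel (orderOf_pos a), pow_orderOf_eq_one]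
    rw [h1]
    exact (curveMonoid w ρ).pow_mem ha _

theorem exists_matEval_ne_zero_of_notMem_curveGroup [Finite G] {w : Matrix ι ι O}
    {ρ : G →* Matrix ι ι κ} (hgen : Function.Surjective (matEval (κ := κ) w)) {a : G}
    (ha : a ∉ curveGroup w ρ) :
    ∃ Φ : MvPolynomial (ι × ι) κ[X], matEval w Φ = 0 ∧ matEval ((cst O).mapMatrix (ρ a) * w) Φ ≠
      0 := by
  by_contra! h
  obtain ⟨g, hg⟩ : ∃ g : O →ₐ[κ[X]] O,
      ∀ Φ, g (matEval w Φ) = matEval ((cst O).mapMatrix (ρ a) * w) Φ :=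
    ⟨_, AlgHom.liftOfSurjective_apply (matEval w) hgen (matEval ((cst O).mapMatrix (ρ a) * w))
      fun Φ hΦ => RingHom.mem_ker.2 (h Φ (RingHom.mem_ker.1 hΦ))⟩
  refine ha ⟨g, ?_⟩
  ext i j
  simpa [matEval] using hg (MvPolynomial.X (i, j))

variable {F : Type*} [Field F] [Fintype F] [Algebra F κ] [Algebra F O]
  {w : Matrix ι ι O} {γ : Matrix ι ι κ}

theorem card_curveGroup_le [IsDomain O] [Finite G] [Module.Free κ[X] O] [Module.Finite κ[X] O]
    (ev : O →ₐ[κ[X]] PowerSeries κ)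
    (hev0 : ∀ i j, PowerSeries.constantCoeff (ev (w i j)) = (1 : Matrix ι ι κ) i j)
    {ρ : G →* Matrix ι ι κ} (hρ : Function.Injective ρ) :
    Nat.card (curveGroup w ρ) ≤ Module.finrank κ[X] O := by
  cases nonempty_fintype (curveGroup w ρ)
  rw [Nat.card_eq_fintype_card]
  choose g hg using fun c : curveGroup w ρ => c.2
  refine AlgHom.card_le_finrank_of_isDomain g fun c c' hcc => ?_
  have key : ∀ c : curveGroup w ρ, ∀ i j, PowerSeries.constantCoeff (ev (g c (w i j))) =
      ρ c i j := by
    intro c i j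
    have h1 := congrFun (congrFun (hg c) i) j
    rw [AlgHom.mapMatrix_apply, Matrix.map_apply] at h1
    rw [h1, Matrix.mul_apply, map_sum, map_sum]
    simp only [map_mul, hev0, cst, RingHom.mapMatrix_apply, Matrix.map_apply, RingHom.comp_apply,
      AlgHom.commutes, PowerSeries.algebraMap_apply']
    simp [Matrix.one_apply]
  refine Subtype.ext (hρ ?_)
  ext i j
  rw [← key, ← key, hcc]

theorem finite_badPoints [Finite G] [IsAlgClosed κ] [Module.Free κ[X] O] [Module.Finite κ[X] O]
    (hw : (qFrob F O 1).mapMatrix w = (algebraMap κ[X] O).mapMatrix (langMat γ) * w)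
    (hgen : Function.Surjective (matEval (κ := κ) w))
    (ev : O →ₐ[κ[X]] PowerSeries κ) (hev : Function.Injective ev) {s : ℕ}
    (hs : ∀ i j n, PowerSeries.coeff n (ev (w i j)) ^ Fintype.card F ^ s =
      PowerSeries.coeff n (ev (w i j)))
    (ρ : G →* Matrix ι ι κ) :
    ∃ bad : Finset κ, ∀ k, s ∣ k → ∀ z ∉ bad, z ^ Fintype.card F ^ k = z → ∀ a,
      frobNorm F (1 - z • γ) k = ρ a → a ∈ curveGroup w ρ := by
  classical
  cases nonempty_fintype G
  have h1 : ∀ a : G, ∃ bad : Finset κ, ∀ k, s ∣ k → ∀ z ∉ bad, z ^ Fintype.card F ^ k = z →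
      frobNorm F (1 - z • γ) k = ρ a → a ∈ curveGroup w ρ := by
    intro a
    by_cases ha : a ∈ curveGroup w ρ
    · exact ⟨∅, fun _ _ _ _ _ _ => ha⟩
    obtain ⟨Φ, hΦ, hΦ'⟩ := exists_matEval_ne_zero_of_notMem_curveGroup hgen ha
    let ω := Module.finBasis κ[X] O
    obtain ⟨i, hi⟩ : ∃ i, ω.repr (matEval ((cst O).mapMatrix (ρ a) * w) Φ) i ≠ 0 := by
      by_contra! h
      exact hΦ' (ω.repr.injective (Finsupp.ext fun i => by simpa using h i))
    refine ⟨(ω.repr (matEval ((cst O).mapMatrix (ρ a) * w) Φ) i).roots.toFinset,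
      fun k hk z hz hzk hN => absurd ?_ hz⟩
    have hσ : Function.Surjective (qFrob F κ k : κ →+* κ) := by
      intro c
      obtain ⟨c', hc'⟩ := IsAlgClosed.exists_pow_nat_eq c
        (pow_pos (Fintype.card_pos (α := F)) k)
      exact ⟨c', by rw [RingHom.coe_coe, qFrob_apply, hc']⟩
    obtain ⟨Ψ, hΨ⟩ : ∃ Ψ, frobCoeff F k Ψ = Φ :=
      MvPolynomial.map_surjective _ (Polynomial.map_surjective _ hσ) Φ
    have hws : ∀ i j, PowerSeries.map (qFrob F κ k : κ →+* κ) (ev (w i j)) = ev (w i j) := by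
      intro i j
      obtain ⟨m, rfl⟩ := hk
      ext n
      rw [PowerSeries.coeff_map, RingHom.coe_coe]
      clear hzk hN hσ hΨ
      induction m with
      | zero => simp [qFrob]
      | succ m ih =>
        rw [qFrob_apply] at ih ⊢
        rw [mul_add, mul_one, pow_add, mul_comm, pow_mul, hs, ih]
    have htw : PowerSeries.map (qFrob F κ k : κ →+* κ) (ev (matEval w Ψ)) = ev (matEval w Φ) := by
      have h2 : ((PowerSeries.map (qFrob F κ k : κ →+* κ)).comp (ev : O →+* _)).comp
          (matEval (κ := κ) w).toRingHom =
          ((ev : O →+* _).comp (matEval (κ := κ) w).toRingHom).comp (frobCoeff F k) := by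
        refine MvPolynomial.ringHom_ext (fun f => ?_) fun x => ?_
        · simp only [matEval, frobCoeff, RingHom.comp_apply, AlgHom.toRingHom_eq_coe,
            RingHom.coe_coe, MvPolynomial.aeval_C, MvPolynomial.map_C, AlgHom.commutes,
            PowerSeries.algebraMap_apply']
          ext n
          simp
        · simpa [matEval, frobCoeff] using hws x.1 x.2
      have h3 := RingHom.congr_fun h2 Ψ
      simpa [hΨ] using h3
    rw [hΦ, map_zero] at htw
    have hΨ0 : matEval w Ψ = 0 := by
      refine hev (PowerSeries.ext fun n => ?_)
      have h3 := congrArg (PowerSeries.coeff n) htw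
      rw [PowerSeries.coeff_map, map_zero] at h3
      rw [map_zero, map_zero]
      exact (map_eq_zero _).1 h3
    have hdvd := frobCoeff_dvd hw hzk Ψ
    rw [hΨ0, hΨ, hN, zero_pow (pow_pos (Fintype.card_pos (α := F)) k).ne', zero_sub, dvd_neg]
      at hdvd
    rw [Multiset.mem_toFinset, mem_roots hi]
    obtain ⟨o, ho⟩ := hdvd
    rw [ho, ← Algebra.smul_def, map_smul]
    simp
  choose bad hbad using h1
  refine ⟨Finset.univ.biUnion bad, fun k hk z hz hzk a hN => hbad a k hk z (fun h => hz ?_) hzk hN⟩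
  exact Finset.mem_biUnion.2 ⟨a, Finset.mem_univ _, h⟩

theorem exists_curve_bound [IsDomain O] [IsAlgClosed κ] [Module.Free κ[X] O] [Module.Finite κ[X] O]
    (hw : (qFrob F O 1).mapMatrix w = (algebraMap κ[X] O).mapMatrix (langMat γ) * w)
    (hgen : Function.Surjective (matEval (κ := κ) w))
    (ev : O →ₐ[κ[X]] PowerSeries κ) (hev : Function.Injective ev)
    (A : Finset (Matrix ι ι κ)) (hA : ∀ a ∈ A, IsUnit a) :
    ∃ K : ℕ, ∀ k, 0 < k → ∀ a ∈ A, ∀ Z : Finset κ,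
      (∀ z ∈ Z, z ^ Fintype.card F ^ (k + k) = z ∧ frobNorm F (1 - z • γ) (k + k) = a) →
      Module.finrank κ[X] O * Z.card ≤ Fintype.card F ^ (k + k) + K * Fintype.card F ^ k := by
  obtain ⟨p, hp, e, hpp, hq⟩ := FiniteField.card' F
  have : Fact p.Prime := ⟨hpp⟩
  have : CharP κ p := (Algebra.charP_iff F κ p).1 hp
  have : CharP O p := (Algebra.charP_iff F O p).1 hp
  let ω := Module.finBasis κ[X] O
  choose Φ hΦ using fun i => hgen (ω i)
  choose c hc using fun (a : Matrix ι ι κ) (i : Fin (Module.finrank κ[X] O)) =>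
    exists_coordDegLE_frobCoeff (F := F) ω ((cst O).mapMatrix a * w) (Φ i)
  obtain ⟨K, hK⟩ := exists_stepanov_bound (p := p) ω ev hev
    (A.sup fun a => Finset.univ.sup fun i => c a i)
  refine ⟨K, fun k hk a ha Z hZ => ?_⟩
  have hqk : ∀ k, Fintype.card F ^ k = p ^ ((e : ℕ) * k) := fun k => by rw [hq, pow_mul]
  have h := hK ((e : ℕ) * k) (fun i => matEval ((cst O).mapMatrix a * w)
    (frobCoeff F (k + k) (Φ i)))
    (by positivity) (fun i => (hc a i _).mono ?_) Z fun z hz => ?_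
  · rwa [← mul_add, ← hqk, ← hqk] at h
  · exact (Finset.le_sup (f := fun i => c a i) (Finset.mem_univ i)).trans
      (Finset.le_sup (f := fun a => Finset.univ.sup fun i => c a i) ha)
  · obtain ⟨hz1, hz2⟩ := hZ z hz
    rw [← mul_add, ← hqk]
    refine ⟨hz1, fun i => ?_, fun o ho => ?_⟩
    · have h1 := frobCoeff_dvd hw hz1 (Φ i)
      rwa [hΦ, hz2] at h1
    · refine dvd_of_dvd_pow_card hw hgen (γ := γ) (F := F) ?_ ?_
      · have h1 : k + k = (k + k - 1) + 1 := by omega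
        have h2 := hA a ha
        rw [← hz2, h1, frobNorm] at h2
        rw [Matrix.isUnit_iff_isUnit_det, Matrix.det_mul] at h2
        rw [Matrix.isUnit_iff_isUnit_det]
        exact isUnit_of_mul_isUnit_right h2
      · rw [hq]
        refine ho.trans (pow_dvd_pow _ ?_)
        exact Nat.le_self_pow e.pos.ne' p

end CurveGroup

section
variable {F κ ι G : Type*} [Field F] [Fintype F] [Field κ] [Algebra F κ] [IsAlgClosed κ]
  [Fintype ι] [DecidableEq ι] [Group G] [Finite G]

/-- Point counts on the Lang covering attached to `γ`. -/
theorem exists_lang_curve (γ : Matrix ι ι κ) (s : ℕ) (hs : (qFrob F κ s).mapMatrix γ = γ)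
    (ρ : G →* Matrix ι ι κ) (hρ : Function.Injective ρ) :
    ∃ (d K : ℕ) (H : Subgroup G) (bad : Finset κ), Nat.card H ≤ d ∧
      (∀ k, s ∣ k → ∀ z ∉ bad, z ^ Fintype.card F ^ k = z → ∀ a,
        frobNorm F (1 - z • γ) k = ρ a → a ∈ H) ∧
      ∀ k, 0 < k → ∀ a, ∀ Z : Finset κ,
        (∀ z ∈ Z, z ^ Fintype.card F ^ (k + k) = z ∧ frobNorm F (1 - z • γ) (k + k) = ρ a) →
        d * Z.card ≤ Fintype.card F ^ (k + k) + K * Fintype.card F ^ k := by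
  classical
  let W := langSol F γ
  let O := Algebra.adjoin κ[X] (Set.range fun x : ι × ι => W x.1 x.2)
  let : Algebra F O := ((algebraMap κ[X] O).comp (C.comp (algebraMap F κ))).toAlgebra
  have hmem : ∀ i j, W i j ∈ O := fun i j => Algebra.subset_adjoin ⟨(i, j), rfl⟩
  let w : Matrix ι ι O := Matrix.of fun i j => ⟨W i j, hmem i j⟩
  have hw : (qFrob F O 1).mapMatrix w = (algebraMap κ[X] O).mapMatrix (langMat γ) * w := by
    refine Matrix.ext fun i j => Subtype.ext ?_
    have h := congrFun (congrFun (map_langSol (F := F) γ) i) j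
    rw [AlgHom.mapMatrix_apply, Matrix.map_apply, qFrob_apply] at h ⊢
    refine h.trans ?_
    rw [Matrix.mul_apply, Matrix.mul_apply, AddSubmonoidClass.coe_finsetSum]
    refine Finset.sum_congr rfl fun l _ => ?_
    change _ = algebraMap κ[X] (PowerSeries κ) (langMat γ i l) * W l j
    rw [PowerSeries.algebraMap_apply']
    congr 1
    by_cases h : i = l <;> simp [langMat, h, mul_comm (PowerSeries.X : PowerSeries κ)]
  have hgen : Function.Surjective (matEval (κ := κ) w) := by
    rintro ⟨o, ho⟩
    have ho' := ho
    simp only [O] at ho'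
    rw [Algebra.adjoin_range_eq_range_aeval] at ho'
    obtain ⟨Φ, rfl⟩ := ho'
    refine ⟨Φ, Subtype.ext ?_⟩
    have h1 : O.val (matEval w Φ) = MvPolynomial.aeval (fun x : ι × ι => W x.1 x.2) Φ := by
      rw [matEval, MvPolynomial.comp_aeval_apply]
      rfl
    exact h1
  have := finite_of_langMat hw hgen
  have : Module.IsTorsionFree κ[X] O := by
    refine Module.isTorsionFree_iff_algebraMap_injective.2 fun x y hxy => ?_
    have h : algebraMap κ[X] (PowerSeries κ) x = algebraMap κ[X] (PowerSeries κ) y :=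
      congrArg Subtype.val hxy
    rw [PowerSeries.algebraMap_apply', PowerSeries.algebraMap_apply'] at h
    simpa using h
  have : Module.Free κ[X] O := Module.free_of_finite_type_torsion_free'
  have hev : Function.Injective O.val := Subtype.val_injective
  cases nonempty_fintype G
  have hev0 : ∀ i j, PowerSeries.constantCoeff (O.val (w i j)) = (1 : Matrix ι ι κ) i j := by
    intro i j
    rw [← PowerSeries.coeff_zero_eq_constantCoeff_apply]
    exact (coeff_langSol γ 0 i j).trans (by rw [langCoeff])
  obtain ⟨bad, hbad⟩ := finite_badPoints hw hgen O.val hev (s := s) (fun i j n => by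
    have h := congrFun (congrFun (langCoeff_pow γ s hs n) i) j
    rw [AlgHom.mapMatrix_apply, Matrix.map_apply, qFrob_apply, ← coeff_langSol] at h
    exact h) ρ
  obtain ⟨K, hK⟩ := exists_curve_bound hw hgen O.val hev (Finset.univ.image ρ) (by
    intro a ha
    obtain ⟨c, -, rfl⟩ := Finset.mem_image.1 ha
    exact (Group.isUnit c).map ρ)
  exact ⟨Module.finrank κ[X] O, K, curveGroup w ρ, bad, card_curveGroup_le O.val hev0 hρ, hbad,
    fun k hk a Z hZ => hK k hk (ρ a) (Finset.mem_image_of_mem _ (Finset.mem_univ _)) Z hZ⟩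
end

section
variable {F κ : Type*} [Field F] [Fintype F] [Field κ] [Algebra F κ]

theorem exists_algebraMap_eq_of_pow_card_eq {y : κ} (hy : y ^ Fintype.card F = y) :
    ∃ a : F, algebraMap F κ a = y := by
  have hp : 1 < Fintype.card F := Fintype.one_lt_card
  have h := roots_map_of_injective_of_card_eq_natDegree (algebraMap F κ).injective
    (p := X ^ Fintype.card F - X) (by
    rw [FiniteField.roots_X_pow_card_sub_X, FiniteField.X_pow_card_sub_X_natDegree_eq F hp]
    rfl)
  have hy' : y ∈ ((X ^ Fintype.card F - X : F[X]).map (algebraMap F κ)).roots := by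
    rw [mem_roots (Polynomial.map_ne_zero (FiniteField.X_pow_card_sub_X_ne_zero F hp))]
    simp [hy]
  rw [← h, Multiset.mem_map] at hy'
  obtain ⟨a, -, ha⟩ := hy'
  exact ⟨a, ha⟩

/-- The power of the minimal polynomial of `x` that has degree `k`. -/
noncomputable def normPoly (F : Type*) [Field F] {κ : Type*} [Field κ] [Algebra F κ]
    (x : κ) (k : ℕ) : F[X] :=
  minpoly F x ^ (k / (minpoly F x).natDegree)

theorem map_normPoly [IsAlgClosed κ] (x : κ) (k : ℕ) (hk : 0 < k)
    (hx : x ^ Fintype.card F ^ k = x) :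
    (minpoly F x).natDegree ∣ k ∧ (normPoly F x k).map (algebraMap F κ) =
      ∏ i ∈ Finset.range k, (X - C (x ^ Fintype.card F ^ i)) := by
  classical
  set g : κ[X] := ∏ i ∈ Finset.range k, (X - C (x ^ Fintype.card F ^ i)) with hg
  have hxint : IsIntegral F x := by
    refine ⟨X ^ Fintype.card F ^ k - X, monic_X_pow_sub ?_, by simp [hx]⟩
    rw [degree_X]
    exact_mod_cast Nat.one_lt_pow hk.ne' Fintype.one_lt_card
  have hgm : g.Monic := monic_prod_X_sub_C _ _
  have hfix : g.map (qFrob F κ 1 : κ →+* κ) = g := by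
    have h1 : g.map (qFrob F κ 1 : κ →+* κ) =
        ∏ i ∈ Finset.range k, (X - C (x ^ Fintype.card F ^ (i + 1))) := by
      rw [hg, Polynomial.map_prod]
      refine Finset.prod_congr rfl fun i _ => ?_
      simp [qFrob_apply, ← pow_mul, pow_succ']
    have h2 := (Finset.prod_range_succ (fun i => (X - C (x ^ Fintype.card F ^ i) : κ[X]))
      k).symm.trans
      (Finset.prod_range_succ' (fun i => (X - C (x ^ Fintype.card F ^ i) : κ[X])) k)
    rw [hx, pow_zero, pow_one] at h2
    rw [h1]
    exact (mul_right_cancel₀ (X_sub_C_ne_zero x) h2).symm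
  obtain ⟨f, hf⟩ : ∃ f : F[X], f.map (algebraMap F κ) = g := by
    rw [← mem_lifts, lifts_iff_coeff_lifts]
    intro n
    have := congrArg (fun p => coeff p n) hfix
    simp only [coeff_map] at this
    rw [RingHom.coe_coe, qFrob_apply, pow_one] at this
    exact exists_algebraMap_eq_of_pow_card_eq this
  have hfm : f.Monic := by
    rw [← hf] at hgm
    exact monic_of_injective (algebraMap F κ).injective hgm
  have hroot : ∀ y : κ, aeval y f = 0 → minpoly F y = minpoly F x := by
    intro y hy
    rw [← eval_map_algebraMap, hf, hg, eval_prod, Finset.prod_eq_zero_iff] at hy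
    obtain ⟨i, -, hi⟩ := hy
    have : y = qFrob F κ i x := by
      rw [qFrob_apply]
      simpa [sub_eq_zero] using hi
    rw [this]
    exact minpoly.algHom_eq _ (qFrob F κ i : κ →+* κ).injective x
  have hP : ¬ IsUnit (minpoly F x) := (minpoly.irreducible hxint).not_isUnit
  obtain ⟨h, hfh, hh⟩ :=
    (FiniteMultiplicity.of_not_isUnit hP hfm.ne_zero).exists_eq_pow_mul_and_not_dvd
  generalize multiplicity (minpoly F x) f = v at hfh
  have hh1 : h = 1 := by
    have hhm : h.Monic := by
      refine ((minpoly.monic hxint).pow v).of_mul_monic_left (q := h) ?_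
      rw [← hfh]
      exact hfm
    rw [← hhm.natDegree_eq_zero]
    by_contra hd
    obtain ⟨y, hy⟩ := IsAlgClosed.exists_aeval_eq_zero κ h (by
      rw [degree_eq_natDegree hhm.ne_zero]
      exact_mod_cast hd)
    refine hh ?_
    rw [← hroot y (by rw [hfh, map_mul, hy, mul_zero])]
    exact minpoly.dvd F y hy
  rw [hh1, mul_one] at hfh
  have hdeg : f.natDegree = k := by
    rw [← natDegree_map (algebraMap F κ), hf, hg, natDegree_prod_of_monic _ _ fun _ _ =>
      monic_X_sub_C _]
    simp only [natDegree_X_sub_C]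
    simp
  rw [hfh, natDegree_pow] at hdeg
  have hd : 0 < (minpoly F x).natDegree := minpoly.natDegree_pos hxint
  refine ⟨⟨_, by rw [mul_comm, hdeg]⟩, ?_⟩
  rw [← hf, normPoly, hfh]
  congr 2
  exact Nat.div_eq_of_eq_mul_left hd hdeg.symm
end

section
variable {F κ : Type*} [Field F] [Fintype F] [Field κ]

open scoped Classical in
/-- The elements of `κ` fixed by the `k`-th power of the Frobenius of `F`. -/
noncomputable def frobFix (F κ : Type*) [Field F] [Fintype F] [Field κ] (k : ℕ) : Finset κ :=
  (X ^ Fintype.card F ^ k - X : κ[X]).roots.toFinset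

theorem mem_frobFix {k : ℕ} (hk : 0 < k) {x : κ} :
    x ∈ frobFix F κ k ↔ x ^ Fintype.card F ^ k = x := by
  classical
  rw [frobFix, Multiset.mem_toFinset, mem_roots
    (FiniteField.X_pow_card_pow_sub_X_ne_zero κ hk.ne' Fintype.one_lt_card)]
  simp [sub_eq_zero]

variable [Algebra F κ]

theorem card_frobFix [IsAlgClosed κ] {k : ℕ} (hk : 0 < k) :
    (frobFix F κ k).card = Fintype.card F ^ k := by
  classical
  have hp : 1 < Fintype.card F := Fintype.one_lt_card
  rw [frobFix, Multiset.toFinset_card_of_nodup, IsAlgClosed.card_roots_eq_natDegree,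
    FiniteField.X_pow_card_pow_sub_X_natDegree_eq κ hk.ne' hp]
  refine nodup_roots ?_
  rw [separable_def]
  have : ((Fintype.card F : ℕ) : κ) = 0 := by
    rw [← map_natCast (algebraMap F κ), Nat.cast_card_eq_zero, map_zero]
  convert! isCoprime_one_right.neg_right (R := κ[X]) using 1
  simp [derivative_X_pow, this, hk.ne']

theorem pow_dvd_iff_le_count_roots [IsAlgClosed κ] [DecidableEq κ] {x : κ} (hx : IsIntegral F x)
    {f : F[X]} (hf : f ≠ 0) (j : ℕ) :
    minpoly F x ^ j ∣ f ↔ j ≤ (f.map (algebraMap F κ)).roots.count x := by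
  have hirr := minpoly.irreducible hx
  have hfin := FiniteMultiplicity.of_not_isUnit hirr.not_isUnit hf
  rw [hfin.pow_dvd_iff_le_multiplicity]
  obtain ⟨h, hfh, hh⟩ := hfin.exists_eq_pow_mul_and_not_dvd
  generalize multiplicity (minpoly F x) f = v at hfh
  subst hfh
  have hne := Polynomial.map_ne_zero (f := algebraMap F κ) hf
  rw [Polynomial.map_mul, Polynomial.map_pow] at hne ⊢
  rw [roots_mul hne, roots_pow, Multiset.count_add, Multiset.count_nsmul,
    Multiset.count_eq_one_of_mem, Multiset.count_eq_zero_of_notMem]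
  · simp
  · intro hy
    refine hh (minpoly.dvd F x ?_)
    rw [← eval_map_algebraMap]
    exact (mem_roots'.1 hy).2
  · exact nodup_roots (PerfectField.separable_of_irreducible hirr).map
  · rw [mem_roots (Polynomial.map_ne_zero hirr.ne_zero), IsRoot.def, eval_map_algebraMap,
      minpoly.aeval]

theorem pow_card_pow_eq_self {x : κ} (hx : IsIntegral F x) {k : ℕ}
    (h : (minpoly F x).natDegree ∣ k) : x ^ Fintype.card F ^ k = x := by
  rw [(minpoly.irreducible hx).natDegree_dvd_iff_dvd_X_pow_card_pow_sub_X,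
    Nat.card_eq_fintype_card] at h
  have := aeval_eq_zero_of_dvd_aeval_eq_zero h (minpoly.aeval F x)
  simpa [sub_eq_zero] using this

open scoped Classical in
theorem sum_card_normPoly_dvd [IsAlgClosed κ] {f : F[X]} (hf : f ≠ 0) :
    ∑ k ∈ Finset.Icc 1 f.natDegree,
      ((frobFix F κ k).filter fun x => normPoly F x k ∣ f).card = f.natDegree := by
  set R := (f.map (algebraMap F κ)).roots with hR
  have hroot : ∀ {x}, x ∈ R ↔ aeval x f = 0 := by
    intro x
    rw [hR, mem_roots (Polynomial.map_ne_zero hf), IsRoot.def, eval_map_algebraMap]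
  have hint : ∀ {x}, x ∈ R → IsIntegral F x := fun hx =>
    IsAlgebraic.isIntegral ⟨f, hf, hroot.1 hx⟩
  have h1 : ∀ k ∈ Finset.Icc 1 f.natDegree,
      ((frobFix F κ k).filter fun x => normPoly F x k ∣ f) =
        R.toFinset.filter fun x => (minpoly F x).natDegree ∣ k ∧ normPoly F x k ∣ f := by
    intro k hk
    have hk0 : 0 < k := (Finset.mem_Icc.1 hk).1
    ext x
    simp only [Finset.mem_filter, mem_frobFix hk0, Multiset.mem_toFinset]
    constructor
    · rintro ⟨hx, hd⟩
      have hdk := (map_normPoly (F := F) x k hk0 hx).1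
      refine ⟨hroot.2 (aeval_eq_zero_of_dvd_aeval_eq_zero hd ?_), hdk, hd⟩
      rw [normPoly, map_pow, minpoly.aeval, zero_pow]
      exact (Nat.div_pos (Nat.le_of_dvd hk0 hdk) (Nat.pos_of_dvd_of_pos hdk hk0)).ne'
    · rintro ⟨hx, hdk, hd⟩
      exact ⟨pow_card_pow_eq_self (hint hx) hdk, hd⟩
  have h2 : ∀ x ∈ R.toFinset, ((Finset.Icc 1 f.natDegree).filter fun k =>
      (minpoly F x).natDegree ∣ k ∧ normPoly F x k ∣ f).card = R.count x := by
    intro x hx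
    have hxi := hint (Multiset.mem_toFinset.1 hx)
    have hd : 0 < (minpoly F x).natDegree := minpoly.natDegree_pos hxi
    have hc : (Finset.Icc 1 (R.count x)).card = R.count x := by simp
    refine Eq.trans (Eq.symm ?_) hc
    refine Finset.card_bij (fun j _ => (minpoly F x).natDegree * j) ?_ ?_ ?_
    · intro j hj
      rw [Finset.mem_Icc] at hj
      have hdvd := (pow_dvd_iff_le_count_roots hxi hf j).2 hj.2
      have := natDegree_le_of_dvd hdvd hf
      rw [natDegree_pow, mul_comm] at this
      rw [Finset.mem_filter, Finset.mem_Icc, normPoly, Nat.mul_div_cancel_left _ hd]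
      exact ⟨⟨Nat.mul_pos hd hj.1, this⟩, dvd_mul_right _ _, hdvd⟩
    · intro i _ j _ h
      exact Nat.eq_of_mul_eq_mul_left hd h
    · rintro k hk
      rw [Finset.mem_filter, Finset.mem_Icc] at hk
      obtain ⟨⟨hk1, -⟩, ⟨j, rfl⟩, hj⟩ := hk
      rw [normPoly, Nat.mul_div_cancel_left _ hd] at hj
      exact ⟨j, Finset.mem_Icc.2 ⟨Nat.pos_of_mul_pos_left hk1,
        (pow_dvd_iff_le_count_roots hxi hf j).1 hj⟩, rfl⟩
  rw [Finset.sum_congr rfl fun k hk => congrArg Finset.card (h1 k hk)]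
  simp only [Finset.card_filter]
  rw [Finset.sum_comm]
  simp only [← Finset.card_filter]
  rw [Finset.sum_congr rfl h2, Multiset.toFinset_sum_count_eq, hR,
    IsAlgClosed.card_roots_eq_natDegree, natDegree_map]
end

section
variable {F : Type*} [Field F]

theorem polyMu_one : polyMu (1 : F[X]) = 1 := by
  simp [polyMu]

theorem abs_polyMu_le (f : F[X]) : |polyMu f| ≤ 1 := by
  unfold polyMu
  split_ifs <;> simp

theorem polyMu_mul {f g : F[X]} (h : IsRelPrime f g) :
    polyMu (f * g) = polyMu f * polyMu g := by
  classical
  unfold polyMu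
  by_cases hf : Squarefree f
  · by_cases hg : Squarefree g
    · rw [if_pos hf, if_pos hg, if_pos (squarefree_mul_iff.2 ⟨h, hf, hg⟩),
        UniqueFactorizationMonoid.normalizedFactors_mul hf.ne_zero hg.ne_zero, Multiset.card_add,
        pow_add]
    · rw [if_neg hg, mul_zero, if_neg fun hh => hg (squarefree_mul_iff.1 hh).2.2]
  · rw [if_neg hf, zero_mul, if_neg fun hh => hf (squarefree_mul_iff.1 hh).2.1]

theorem polyMu_irreducible {p : F[X]} (hp : Irreducible p) : polyMu p = -1 := by
  classical
  rw [polyMu, if_pos hp.squarefree, UniqueFactorizationMonoid.normalizedFactors_irreducible hp]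
  simp

theorem monicPoly_eq (n : ℕ) (x : Fin n → F) :
    (monicPoly F n x).Monic ∧ (monicPoly F n x).natDegree = n ∧
      ∀ i : Fin n, (monicPoly F n x).coeff i = x i := by
  have hd : (∑ i : Fin n, C (x i) * X ^ (i : ℕ)).degree < (n : WithBot ℕ) :=
    degree_sum_fin_lt x
  refine ⟨monic_X_pow_add hd, natDegree_eq_of_degree_eq_some ?_, fun i => ?_⟩
  · rw [monicPoly, degree_add_eq_left_of_degree_lt] <;> simp [hd]
  · rw [monicPoly, coeff_add, coeff_X_pow, if_neg i.2.ne, zero_add, finsetSum_coeff,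
      Finset.sum_eq_single i]
    · simp
    · intro b _ hb
      rw [coeff_C_mul, coeff_X_pow, if_neg, mul_zero]
      exact fun h => hb (Fin.ext h.symm)
    · simp

theorem monicPoly_injective (n : ℕ) : Function.Injective (monicPoly F n) := by
  intro x y h
  funext i
  rw [← (monicPoly_eq n x).2.2 i, h, (monicPoly_eq n y).2.2 i]

theorem exists_monicPoly {f : F[X]} (hf : f.Monic) : ∃ x, monicPoly F f.natDegree x = f := by
  refine ⟨fun i => f.coeff i, ?_⟩
  obtain ⟨h1, h2, h3⟩ := monicPoly_eq f.natDegree fun i : Fin f.natDegree => f.coeff i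
  ext j
  rcases lt_trichotomy j f.natDegree with h | rfl | h
  · exact h3 ⟨j, h⟩
  · rw [hf.coeff_natDegree]
    have := h1.coeff_natDegree
    rwa [h2] at this
  · rw [coeff_eq_zero_of_natDegree_lt h, coeff_eq_zero_of_natDegree_lt (h2.trans_lt h)]

variable [Fintype F]

open scoped Classical in
/-- The monic polynomials of degree `n`. -/
noncomputable def monics (F : Type*) [Field F] [Fintype F] (n : ℕ) : Finset F[X] :=
  Finset.univ.image (monicPoly F n)

theorem mem_monics {n : ℕ} {f : F[X]} : f ∈ monics F n ↔ f.Monic ∧ f.natDegree = n := by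
  classical
  rw [monics, Finset.mem_image]
  constructor
  · rintro ⟨x, -, rfl⟩
    exact ⟨(monicPoly_eq n x).1, (monicPoly_eq n x).2.1⟩
  · rintro ⟨h, rfl⟩
    obtain ⟨x, hx⟩ := exists_monicPoly h
    exact ⟨x, Finset.mem_univ _, hx⟩

theorem sum_monics {M : Type*} [AddCommMonoid M] (n : ℕ) (φ : F[X] → M) :
    ∑ f ∈ monics F n, φ f = ∑ x, φ (monicPoly F n x) := by
  classical
  rw [monics, Finset.sum_image fun _ _ _ _ h => monicPoly_injective n h]

theorem monics_zero : monics F 0 = {1} := by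
  ext f
  rw [mem_monics, Finset.mem_singleton]
  constructor
  · rintro ⟨h, h0⟩
    exact h.natDegree_eq_zero.1 h0
  · rintro rfl
    exact ⟨monic_one, natDegree_one⟩

open scoped Classical in
theorem sum_monics_mul {M : Type*} [AddCommMonoid M] {g : F[X]} (hg : g.Monic) {i j n : ℕ}
    (hi : g.natDegree = i) (hij : i + j = n) (φ : F[X] → M) :
    ∑ h ∈ monics F j, φ (g * h) = ∑ f ∈ (monics F n).filter (g ∣ ·), φ f := by
  refine Finset.sum_bij (fun h _ => g * h) ?_ ?_ ?_ fun _ _ => rfl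
  · intro h hh
    rw [mem_monics] at hh
    rw [Finset.mem_filter, mem_monics]
    exact ⟨⟨hg.mul hh.1, by rw [hg.natDegree_mul hh.1, hi, hh.2, hij]⟩, dvd_mul_right _ _⟩
  · intro a _ b _ h
    exact mul_left_cancel₀ hg.ne_zero h
  · rintro f hf
    rw [Finset.mem_filter, mem_monics] at hf
    obtain ⟨⟨hm, hd⟩, h, rfl⟩ := hf
    have hh := hg.of_mul_monic_left hm
    rw [hg.natDegree_mul hh, hi] at hd
    exact ⟨h, mem_monics.2 ⟨hh, by omega⟩, rfl⟩

open scoped Classical in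
theorem sum_polyMu_dvd {f : F[X]} (hf : f.Monic) (hd : f.natDegree ≠ 0) :
    ∑ k ∈ Finset.range (f.natDegree + 1), ∑ g ∈ (monics F k).filter (· ∣ f), polyMu g = 0 := by
  rw [← Finset.sum_biUnion]
  swap
  · intro i _ j _ hij
    refine Finset.disjoint_left.2 fun g hg hg' => hij ?_
    rw [Finset.mem_filter, mem_monics] at hg hg'
    exact hg.1.2.symm.trans hg'.1.2
  set T := (Finset.range (f.natDegree + 1)).biUnion fun k => (monics F k).filter (· ∣ f) with hT
  have hmem : ∀ {g}, g ∈ T ↔ g.Monic ∧ g ∣ f := by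
    intro g
    simp only [hT, Finset.mem_biUnion, Finset.mem_range, Finset.mem_filter, mem_monics]
    constructor
    · rintro ⟨k, -, h⟩
      exact ⟨h.1.1, h.2⟩
    · rintro ⟨h1, h2⟩
      exact ⟨_, Nat.lt_succ_of_le (natDegree_le_of_dvd h2 hf.ne_zero), ⟨h1, rfl⟩, h2⟩
  obtain ⟨p, hpm, hp, hpf⟩ := exists_monic_irreducible_factor f
    (fun h => hd (natDegree_eq_zero_of_isUnit h))
  rw [← Finset.sum_filter_of_ne (p := Squarefree)]
  swap
  · intro g _ h
    by_contra hg
    exact h (by rw [polyMu, if_neg hg])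
  have hmul : ∀ g, ¬ p ∣ g → polyMu (p * g) = - polyMu g := fun g hg => by
    rw [polyMu_mul (hp.isRelPrime_iff_not_dvd.2 hg), polyMu_irreducible hp, neg_one_mul]
  have hsq : ∀ g, Squarefree (p * g) → ¬ p ∣ g := by
    rintro g hg ⟨r, rfl⟩
    exact hp.not_isUnit (hg p ⟨r, by ring⟩)
  refine Finset.sum_involution (fun g _ => if p ∣ g then g / p else p * g) ?_ ?_ ?_ ?_
  · intro g hg
    rw [Finset.mem_filter] at hg
    split_ifs with h
    · obtain ⟨r, rfl⟩ := h
      rw [mul_div_cancel_left₀ _ hp.ne_zero, hmul r (hsq r hg.2), neg_add_cancel]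
    · rw [hmul g h, add_neg_cancel]
  · intro g hg _
    rw [Finset.mem_filter] at hg
    split_ifs with h
    · obtain ⟨r, rfl⟩ := h
      rw [mul_div_cancel_left₀ _ hp.ne_zero]
      intro h
      exact hsq r hg.2 (h ▸ dvd_mul_right _ _)
    · intro h'
      exact h (h' ▸ dvd_mul_right _ _)
  · intro g hg
    rw [Finset.mem_filter, hmem] at hg ⊢
    split_ifs with h
    · obtain ⟨r, rfl⟩ := h
      rw [mul_div_cancel_left₀ _ hp.ne_zero]
      exact ⟨⟨hpm.of_mul_monic_left hg.1.1, (dvd_mul_left _ _).trans hg.1.2⟩,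
        hg.2.squarefree_of_dvd (dvd_mul_left _ _)⟩
    · have hrel := hp.isRelPrime_iff_not_dvd.2 h
      exact ⟨⟨hpm.mul hg.1.1, hrel.mul_dvd hpf hg.1.2⟩,
        squarefree_mul_iff.2 ⟨hrel, hp.squarefree, hg.2⟩⟩
  · intro g hg
    rw [Finset.mem_filter] at hg
    by_cases h : p ∣ g
    · obtain ⟨r, rfl⟩ := h
      rw [if_pos (dvd_mul_right _ _), mul_div_cancel_left₀ _ hp.ne_zero, if_neg (hsq r hg.2)]
    · rw [if_neg h, if_pos (dvd_mul_right _ _), mul_div_cancel_left₀ _ hp.ne_zero]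
end

section
variable {F : Type*} [Field F] [Fintype F] (κ : Type*) [Field κ] [Algebra F κ]
  (c : F[X] →* ℂ)

/-- The generating series of `c` over monic polynomials. -/
noncomputable def monicSeries : PowerSeries ℂ :=
  PowerSeries.mk fun n => ∑ f ∈ monics F n, c f

/-- The generating series of `μ c` over monic polynomials. -/
noncomputable def moebiusSeries : PowerSeries ℂ :=
  PowerSeries.mk fun n => ∑ f ∈ monics F n, (polyMu f : ℂ) * c f

/-- The sum of `c` over the norm polynomials of the points of degree dividing `k`. -/
noncomputable def pointSum (k : ℕ) : ℂ :=
  if k = 0 then 0 else ∑ x ∈ frobFix F κ k, c (normPoly F x k)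

theorem moebiusSeries_mul_monicSeries : moebiusSeries c * monicSeries c = 1 := by
  classical
  ext n
  rw [PowerSeries.coeff_mul, PowerSeries.coeff_one]
  have h1 : ∀ p ∈ Finset.HasAntidiagonal.antidiagonal n, PowerSeries.coeff p.1 (moebiusSeries c) *
      PowerSeries.coeff p.2 (monicSeries c) = ∑ f ∈ monics F n,
        (∑ g ∈ (monics F p.1).filter (· ∣ f), (polyMu g : ℂ)) * c f := by
    intro p hp
    rw [moebiusSeries, monicSeries, PowerSeries.coeff_mk, PowerSeries.coeff_mk, Finset.sum_mul]
    have h2 : ∀ g ∈ monics F p.1, (polyMu g : ℂ) * c g * ∑ h ∈ monics F p.2, c h =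
        ∑ f ∈ monics F n, if g ∣ f then (polyMu g : ℂ) * c f else 0 := by
      intro g hg
      rw [mem_monics] at hg
      rw [← Finset.sum_filter, ← sum_monics_mul hg.1 hg.2
        (Finset.HasAntidiagonal.mem_antidiagonal.1 hp),
        Finset.mul_sum]
      refine Finset.sum_congr rfl fun h _ => ?_
      rw [map_mul, mul_assoc]
    rw [Finset.sum_congr rfl h2, Finset.sum_comm]
    refine Finset.sum_congr rfl fun f _ => ?_
    rw [Finset.sum_filter, Finset.sum_mul]
    refine Finset.sum_congr rfl fun g _ => ?_
    split_ifs <;> simp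
  rw [Finset.sum_congr rfl h1, Finset.sum_comm]
  split_ifs with hn
  · subst hn
    simp [monics_zero, Finset.filter_singleton, polyMu_one]
  · refine Finset.sum_eq_zero fun f hf => ?_
    rw [mem_monics] at hf
    rw [← Finset.sum_mul, Finset.Nat.sum_antidiagonal_eq_sum_range_succ_mk]
    have := sum_polyMu_dvd hf.1 (hf.2.trans_ne hn)
    rw [hf.2] at this
    have h3 := congrArg (Int.cast : ℤ → ℂ) this
    push_cast at h3
    rw [h3, zero_mul]

theorem monicSeries_logDeriv [IsAlgClosed κ] :
    PowerSeries.X * PowerSeries.derivative (R := ℂ) (monicSeries c) =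
      PowerSeries.mk (pointSum κ c) * monicSeries c := by
  classical
  ext n
  rcases n with - | n
  · simp [pointSum]
  rw [PowerSeries.coeff_succ_X_mul, PowerSeries.coeff_derivative, PowerSeries.coeff_mul]
  have h1 : ∀ p ∈ Finset.HasAntidiagonal.antidiagonal (n + 1),
      PowerSeries.coeff p.1 (PowerSeries.mk (pointSum κ c)) *
      PowerSeries.coeff p.2 (monicSeries c) = if p.1 = 0 then 0 else ∑ f ∈ monics F (n + 1),
        (((frobFix F κ p.1).filter fun x => normPoly F x p.1 ∣ f).card : ℂ) * c f := by
    intro p hp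
    rw [monicSeries, PowerSeries.coeff_mk, PowerSeries.coeff_mk, pointSum]
    split_ifs with h0
    · rw [zero_mul]
    rw [Finset.sum_mul]
    have h2 : ∀ x ∈ frobFix F κ p.1, c (normPoly F x p.1) * ∑ h ∈ monics F p.2, c h =
        ∑ f ∈ monics F (n + 1), if normPoly F x p.1 ∣ f then c f else 0 := by
      intro x hx
      have hk := Nat.pos_of_ne_zero h0
      rw [mem_frobFix hk] at hx
      obtain ⟨h3, h4⟩ := map_normPoly (F := F) x p.1 hk hx
      have hm : (normPoly F x p.1).Monic ∧ (normPoly F x p.1).natDegree = p.1 := by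
        constructor
        · refine monic_of_injective (algebraMap F κ).injective ?_
          rw [h4]
          exact monic_prod_X_sub_C _ _
        · rw [normPoly, natDegree_pow, Nat.div_mul_cancel h3]
      rw [← Finset.sum_filter, ← sum_monics_mul hm.1 hm.2
        (Finset.HasAntidiagonal.mem_antidiagonal.1 hp),
        Finset.mul_sum]
      exact Finset.sum_congr rfl fun h _ => (map_mul _ _ _).symm
    rw [Finset.sum_congr rfl h2, Finset.sum_comm]
    refine Finset.sum_congr rfl fun f _ => ?_
    rw [← Finset.sum_filter, Finset.sum_const, nsmul_eq_mul]
  rw [Finset.sum_congr rfl h1, Finset.Nat.sum_antidiagonal_eq_sum_range_succ_mk]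
  simp only
  rw [Finset.sum_range_succ' _ (n + 1), if_pos rfl, add_zero]
  simp only [Nat.succ_ne_zero, if_false]
  rw [Finset.sum_comm, monicSeries, PowerSeries.coeff_mk, mul_comm, Finset.mul_sum]
  refine Finset.sum_congr rfl fun f hf => ?_
  rw [mem_monics] at hf
  rw [← Finset.sum_mul]
  congr 1
  have := sum_card_normPoly_dvd (κ := κ) hf.1.ne_zero
  rw [hf.2, show Finset.Icc 1 (n + 1) = Finset.Ico (0 + 1) (n + 1 + 1) from rfl,
    ← Finset.sum_Ico_add', ← Finset.range_eq_Ico] at this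
  exact_mod_cast this.symm
end

/-- `S` is the logarithmic derivative of `M` with respect to the Euler operator. -/
def IsEulerLogDeriv {R : Type*} [CommRing R] (M S : PowerSeries R) : Prop :=
  PowerSeries.X * PowerSeries.derivative (R := R) M = S * M

namespace IsEulerLogDeriv
variable {R : Type*} [CommRing R] {M N S T : PowerSeries R}

theorem one : IsEulerLogDeriv (1 : PowerSeries R) 0 := by
  simp [IsEulerLogDeriv]

theorem mul (hM : IsEulerLogDeriv M S) (hN : IsEulerLogDeriv N T) :
    IsEulerLogDeriv (M * N) (S + T) := by
  unfold IsEulerLogDeriv at *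
  rw [Derivation.leibniz, smul_eq_mul, smul_eq_mul]
  linear_combination M * hN + N * hM

theorem of_mul_eq_one (hM : IsEulerLogDeriv M S) (h : N * M = 1) : IsEulerLogDeriv N (-S) := by
  unfold IsEulerLogDeriv at *
  have h1 := congrArg (PowerSeries.derivative (R := R)) h
  rw [Derivation.leibniz, smul_eq_mul, smul_eq_mul, Derivation.map_one_eq_zero] at h1
  linear_combination (PowerSeries.X * N) * h1 - N * N * hM -
    (PowerSeries.X * PowerSeries.derivative (R := R) N + S * N) * h

theorem unique (hS : IsEulerLogDeriv M S) (hT : IsEulerLogDeriv M T) (hN : N * M = 1) : S = T := by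
  unfold IsEulerLogDeriv at *
  linear_combination (S - T) * (-hN) - N * hS + N * hT

theorem one_sub_mul_X (a : R) : IsEulerLogDeriv (1 - PowerSeries.C a * PowerSeries.X)
    (-PowerSeries.mk fun k => if k = 0 then 0 else a ^ k) := by
  unfold IsEulerLogDeriv
  ext n
  rw [neg_mul, mul_sub, mul_one, ← mul_assoc, mul_comm _ (PowerSeries.C a), mul_assoc]
  rcases n with - | n
  · simp
  · rw [PowerSeries.coeff_succ_X_mul, PowerSeries.coeff_derivative]
    simp only [map_neg, map_sub, PowerSeries.coeff_C_mul, PowerSeries.coeff_succ_mul_X,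
      PowerSeries.coeff_mk, PowerSeries.coeff_one]
    rcases n with - | n
    · simp
    · simp [pow_succ']

theorem mul_coeff {S M : PowerSeries ℂ} (h : IsEulerLogDeriv M S) (n : ℕ) :
    (n : ℂ) * PowerSeries.coeff n M =
      ∑ k ∈ Finset.range (n + 1), PowerSeries.coeff k S * PowerSeries.coeff (n - k) M := by
  have := congrArg (PowerSeries.coeff n) h
  rw [PowerSeries.coeff_mul n S M, Finset.Nat.sum_antidiagonal_eq_sum_range_succ_mk] at this
  rw [← this]
  rcases n with - | n
  · simp
  · rw [PowerSeries.coeff_succ_X_mul, PowerSeries.coeff_derivative, mul_comm]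
    push_cast
    rfl

theorem multiset_prod (s : Multiset ℂ) :
    IsEulerLogDeriv (s.map fun a => 1 - PowerSeries.C a * PowerSeries.X).prod
      (-PowerSeries.mk fun k => if k = 0 then 0 else (s.map (· ^ k)).sum) := by
  induction s using Multiset.induction with
  | empty =>
    simp only [Multiset.map_zero, Multiset.prod_zero, Multiset.sum_zero, ite_self]
    convert one
    ext
    simp
  | cons a s ih =>
    rw [Multiset.map_cons, Multiset.prod_cons]
    convert (one_sub_mul_X a).mul ih using 1
    ext k
    simp only [map_neg, map_add, PowerSeries.coeff_mk]
    split_ifs <;> simp [add_comm]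

end IsEulerLogDeriv

theorem exists_prod_one_sub (p : ℂ[X]) (hp : p.coeff 0 = 1) :
    ∃ s : Multiset ℂ, s.card ≤ p.natDegree ∧ p = (s.map fun a => 1 - C a * X).prod := by
  refine ⟨p.roots.map (·⁻¹), by rw [Multiset.card_map]; exact card_roots' p, ?_⟩
  have hs := (IsAlgClosed.splits p).eq_prod_roots
  have h0 : ∀ a ∈ p.roots, a ≠ 0 := by
    rintro a ha rfl
    have := (mem_roots'.1 ha).2
    rw [IsRoot.def, ← coeff_zero_eq_eval_zero, hp] at this
    exact one_ne_zero this
  have h1 : (p.roots.map fun a => X - C a).prod =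
      C (p.roots.map fun a => -a).prod * ((p.roots.map (·⁻¹)).map fun a => 1 - C a * X).prod := by
    rw [Multiset.map_map, ← Multiset.prod_hom, Multiset.map_map, ← Multiset.prod_map_mul]
    congr 1
    refine Multiset.map_congr rfl fun a ha => ?_
    have : C a * C a⁻¹ = (1 : ℂ[X]) := by rw [← C_mul, mul_inv_cancel₀ (h0 a ha), C_1]
    simp only [Function.comp_apply, C_neg]
    linear_combination X * (-this)
  rw [h1, ← mul_assoc, ← C_mul] at hs
  have h2 : ∀ t : Multiset ℂ, ((t.map fun a => 1 - C a * X).prod : ℂ[X]).eval 0 = 1 := by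
    intro t
    rw [eval_multiset_prod, Multiset.map_map]
    simp
  have h3 := congrArg (eval 0) hs
  rw [← coeff_zero_eq_eval_zero, hp, eval_mul, eval_C, h2, mul_one] at h3
  rw [← h3, C_1, one_mul] at hs
  exact hs

theorem exists_powerSum_of_isEulerLogDeriv {M S N : PowerSeries ℂ} (h : IsEulerLogDeriv M S)
    (hN : N * M = 1) (h0 : PowerSeries.coeff 0 M = 1) {D : ℕ}
    (hD : ∀ n, D ≤ n → PowerSeries.coeff n M = 0) :
    ∃ s : Multiset ℂ, s.card ≤ D ∧
      ∀ k, 0 < k → PowerSeries.coeff k S = -(s.map (· ^ k)).sum := by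
  obtain ⟨s, hs, hp⟩ := exists_prod_one_sub (PowerSeries.trunc D M) (by
    rw [PowerSeries.coeff_trunc, if_pos, h0]
    by_contra hD0
    exact one_ne_zero (h0.symm.trans (hD 0 (not_lt.1 hD0))))
  have hM : M = (s.map fun a => 1 - PowerSeries.C a * PowerSeries.X).prod := by
    have h1 : (PowerSeries.trunc D M : PowerSeries ℂ) = M := by
      ext n
      rw [Polynomial.coeff_coe, PowerSeries.coeff_trunc]
      split_ifs with hn
      · rfl
      · exact (hD n (not_lt.1 hn)).symm
    rw [← h1, hp, ← Polynomial.coeToPowerSeries.ringHom_apply, map_multiset_prod,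
      Multiset.map_map]
    congr 2
    funext a
    simp [Polynomial.coeToPowerSeries.ringHom_apply]
  refine ⟨s, hs.trans ?_, fun k hk => ?_⟩
  · exact natDegree_le_of_degree_le (PowerSeries.degree_trunc_lt M D).le
  · have := IsEulerLogDeriv.multiset_prod s
    rw [← hM] at this
    rw [h.unique this hN]
    simp [hk.ne']

theorem exists_re_pow_ge (s : Finset ℂ) (N : ℕ) (hN : 0 < N) (K : ℕ) :
    ∃ k, K ≤ k ∧ 0 < k ∧ N ∣ k ∧ ∀ a ∈ s, ‖a‖ ^ k / 2 ≤ (a ^ k).re := by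
  let u : ℂ → ℂ := fun a => a / ‖a‖
  let N' := N * (K + 1)
  have hu : ∀ a, ‖u a‖ ≤ 1 := fun a => by
    simp only [u, norm_div, Complex.norm_real, norm_norm]
    exact div_self_le_one _
  let x : ℕ → s → ℂ := fun j a => u a ^ (N' * j)
  have hx : ∀ j, x j ∈ Metric.closedBall (0 : s → ℂ) 1 := by
    intro j
    rw [mem_closedBall_zero_iff, pi_norm_le_iff_of_nonneg zero_le_one]
    intro a
    rw [norm_pow]
    exact pow_le_one₀ (norm_nonneg _) (hu _)
  obtain ⟨y, -, φ, hφ, hlim⟩ := (isCompact_closedBall (0 : s → ℂ) 1).tendsto_subseq hx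
  obtain ⟨n, hn⟩ := Metric.cauchySeq_iff'.1 hlim.cauchySeq (1 / 2) (by norm_num)
  have h1 := hn (n + 1) n.le_succ
  have hlt : φ n < φ (n + 1) := hφ n.lt_succ_self
  obtain ⟨d, hd⟩ := Nat.exists_eq_add_of_lt hlt
  refine ⟨N' * (d + 1), ?_, by positivity, ⟨(K + 1) * (d + 1), by simp only [N']; ring⟩, ?_⟩
  · calc K ≤ K + 1 := K.le_succ
      _ ≤ N' := Nat.le_mul_of_pos_left _ hN
      _ ≤ _ := Nat.le_mul_of_pos_right _ d.succ_pos
  intro a ha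
  by_cases ha0 : a = 0
  · subst ha0
    have : N' * (d + 1) ≠ 0 := by positivity
    simp [this]
  have hna : (‖a‖ : ℂ) ≠ 0 := by
    exact_mod_cast norm_ne_zero_iff.2 ha0
  have hu1 : ‖u a‖ = 1 := by
    simp only [u, norm_div, Complex.norm_real, norm_norm]
    exact div_self (norm_ne_zero_iff.2 ha0)
  have h2 := (dist_le_pi_dist _ _ ⟨a, ha⟩).trans_lt h1
  simp only [Function.comp_apply, x, dist_eq_norm] at h2
  have h3 : u a ^ (N' * φ (n + 1)) - u a ^ (N' * φ n) =
      u a ^ (N' * φ n) * (u a ^ (N' * (d + 1)) - 1) := by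
    rw [hd, mul_sub, ← pow_add]
    congr 2 <;> ring
  rw [h3, norm_mul, norm_pow, hu1, one_pow, one_mul] at h2
  have h4 : 1 / 2 ≤ (u a ^ (N' * (d + 1))).re := by
    have := (Complex.abs_re_le_norm _).trans h2.le
    rw [Complex.sub_re, Complex.one_re, abs_le] at this
    linarith [this.1]
  have h5 : a ^ (N' * (d + 1)) = ((‖a‖ ^ (N' * (d + 1)) : ℝ) : ℂ) * u a ^ (N' * (d + 1)) := by
    rw [Complex.ofReal_pow, ← mul_pow]
    congr 1
    simp only [u]
    rw [mul_div_cancel₀ _ hna]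
  rw [h5, Complex.re_ofReal_mul]
  have := mul_le_mul_of_nonneg_left h4 (pow_nonneg (norm_nonneg a) (N' * (d + 1)))
  linarith

theorem exists_re_powerSum_ge (s : Multiset ℂ) (N : ℕ) (hN : 0 < N) (K : ℕ) :
    ∃ k, K ≤ k ∧ 0 < k ∧ N ∣ k ∧ 0 ≤ ((s.map (· ^ k)).sum).re ∧
      ∀ a ∈ s, ‖a‖ ^ k / 2 ≤ ((s.map (· ^ k)).sum).re := by
  obtain ⟨k, hk, hk0, hNk, h⟩ := exists_re_pow_ge s.toFinset N hN K
  have hre : ((s.map (· ^ k)).sum).re = (s.map fun a => (a ^ k).re).sum := by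
    have := map_multiset_sum Complex.reCLM (s.map (· ^ k))
    rw [Multiset.map_map] at this
    exact this
  have hnn : ∀ a ∈ s, 0 ≤ (a ^ k).re := fun a ha =>
    le_trans (by positivity) (h a (Multiset.mem_toFinset.2 ha))
  refine ⟨k, hk, hk0, hNk, ?_, fun a ha => ?_⟩ <;> rw [hre]
  · refine Multiset.sum_nonneg fun x hx => ?_
    obtain ⟨a, ha, rfl⟩ := Multiset.mem_map.1 hx
    exact hnn a ha
  · refine (h a (Multiset.mem_toFinset.2 ha)).trans (Multiset.single_le_sum ?_ _
      (Multiset.mem_map_of_mem _ ha))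
    intro x hx
    obtain ⟨a, ha, rfl⟩ := Multiset.mem_map.1 hx
    exact hnn a ha

theorem norm_le_of_powerSum_le (s : Multiset ℂ) (N : ℕ) (hN : 0 < N) {B r : ℝ} (hr : 0 < r)
    (h : ∀ k, 0 < k → N ∣ k → ‖(s.map (· ^ k)).sum‖ ≤ B * r ^ k) : ∀ a ∈ s, ‖a‖ ≤ r := by
  intro a ha
  by_contra! hlt
  have h1 : 1 < ‖a‖ / r := (one_lt_div hr).2 hlt
  obtain ⟨K, hK⟩ := pow_unbounded_of_one_lt (2 * B) h1
  obtain ⟨k, hk, hk0, hNk, -, h2⟩ := exists_re_powerSum_ge s N hN K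
  have h3 := (h2 a ha).trans ((Complex.re_le_norm _).trans (h k hk0 hNk))
  have h4 := hK.trans_le (pow_le_pow_right₀ h1.le hk)
  rw [div_pow, lt_div_iff₀ (by positivity)] at h4
  linarith

/-- The degree-`n` homogenization of `f` evaluated at `(α, β)`. -/
noncomputable def homogEval {K R : Type*} [CommRing K] [Ring R] [Algebra K R] (α β : R) (n : ℕ)
    (f : K[X]) : R :=
  ∑ i ∈ Finset.range (n + 1), f.coeff i • (α ^ i * β ^ (n - i))

section
variable {K R : Type*} [CommRing K] [Ring R] [Algebra K R] {α β : R}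

theorem homogEval_mul_X_sub_C (h : Commute α β) {n : ℕ} {f : K[X]} (hf : f.natDegree ≤ n) (x : K) :
    homogEval α β (n + 1) (f * (X - C x)) = homogEval α β n f * (α - x • β) := by
  have h1 : homogEval α β n f * α =
      ∑ i ∈ Finset.range (n + 1), f.coeff i • (α ^ (i + 1) * β ^ (n - i)) := by
    rw [homogEval, Finset.sum_mul]
    refine Finset.sum_congr rfl fun i _ => ?_
    rw [smul_mul_assoc, mul_assoc, ← (h.pow_right _).eq, ← mul_assoc, pow_succ]
  have h2 : homogEval α β n f * (x • β) =
      ∑ i ∈ Finset.range (n + 1), (f.coeff i * x) • (α ^ i * β ^ (n + 1 - i)) := by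
    rw [homogEval, Finset.sum_mul]
    refine Finset.sum_congr rfl fun i hi => ?_
    rw [Finset.mem_range] at hi
    rw [smul_mul_smul_comm, mul_assoc, ← pow_succ, Nat.sub_add_comm (Nat.le_of_lt_succ hi)]
  rw [mul_sub (homogEval α β n f), h1, h2, homogEval]
  simp only [mul_sub, coeff_sub, coeff_mul_C, sub_smul]
  rw [Finset.sum_sub_distrib, Finset.sum_range_succ', Finset.sum_range_succ _ (n + 1)]
  simp [coeff_eq_zero_of_natDegree_lt (Nat.lt_succ_of_le hf)]

theorem map_homogEval {L S : Type*} [CommRing L] [Ring S] [Algebra L S] (θ : R →+* S) (φ : K →+* L)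
    (h : ∀ (c : K) (r : R), θ (c • r) = φ c • θ r) (n : ℕ) (f : K[X]) :
    θ (homogEval α β n f) = homogEval (θ α) (θ β) n (f.map φ) := by
  simp [homogEval, h]

theorem commute_homogEval {r : R} (hα : Commute α r) (hβ : Commute β r) (n : ℕ) (f : K[X]) :
    Commute (homogEval α β n f) r :=
  Commute.sum_left _ _ _ fun _ _ => ((hα.pow_left _).mul_left (hβ.pow_left _)).smul_left _
end

section
variable {F κ ι : Type*} [Field F] [Fintype F] [Field κ] [Algebra F κ] [Fintype ι] [DecidableEq ι]

theorem frobNorm_mul {u v : Matrix ι ι κ}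
    (h : ∀ k, Commute ((qFrob F κ 1).mapMatrix (frobNorm F v k)) u) (k : ℕ) :
    frobNorm F (u * v) k = frobNorm F u k * frobNorm F v k := by
  induction k with
  | zero => simp [frobNorm]
  | succ k ih =>
    rw [frobNorm, ih, map_mul, frobNorm, frobNorm, mul_assoc, mul_assoc, ← mul_assoc _ u v,
      (h k).eq, mul_assoc]

theorem frobNorm_sub_smul {α β : Matrix ι ι κ} (h : Commute α β)
    (hα : (qFrob F κ 1).mapMatrix α = α) (hβ : (qFrob F κ 1).mapMatrix β = β) (x : κ) (k : ℕ) :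
    frobNorm F (α - x • β) k =
      homogEval α β k (∏ i ∈ Finset.range k, (X - C (x ^ Fintype.card F ^ i))) ∧
    (qFrob F κ 1).mapMatrix (frobNorm F (α - x • β) k) =
      homogEval α β k (∏ i ∈ Finset.range k, (X - C (x ^ Fintype.card F ^ (i + 1)))) := by
  have hmap : ∀ k, (qFrob F κ 1).mapMatrix
      (homogEval α β k (∏ i ∈ Finset.range k, (X - C (x ^ Fintype.card F ^ i)))) =
      homogEval α β k (∏ i ∈ Finset.range k, (X - C (x ^ Fintype.card F ^ (i + 1)))) := by
    intro k
    refine (map_homogEval (((qFrob F κ 1).mapMatrix : Matrix ι ι κ →ₐ[F] Matrix ι ι κ) :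
      Matrix ι ι κ →+* Matrix ι ι κ)
      (qFrob F κ 1 : κ →+* κ) ?_ k _).trans ?_
    · intro c r
      ext i j
      simp
    · simp only [RingHom.coe_coe, hα, hβ]
      rw [Polynomial.map_prod]
      congr 1
      refine Finset.prod_congr rfl fun i _ => ?_
      simp [qFrob_apply, ← pow_mul, pow_succ']
  have h1 : frobNorm F (α - x • β) k =
      homogEval α β k (∏ i ∈ Finset.range k, (X - C (x ^ Fintype.card F ^ i))) := by
    induction k with
    | zero => simp [frobNorm, homogEval]
    | succ k ih =>
      rw [frobNorm, ih, hmap, ← homogEval_mul_X_sub_C h, Finset.prod_range_succ', pow_zero, pow_one]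
      refine (natDegree_prod_le _ _).trans ?_
      simp only [natDegree_X_sub_C]
      simp
  exact ⟨h1, by rw [h1, hmap]⟩
end

section
variable {F κ B : Type*} [Field F] [Fintype F] [Field κ] [Algebra F κ] [IsAlgClosed κ]
  [CommRing B] [Algebra F B] [Finite B]

open scoped Classical in
/-- Equidistribution bounds for the classes of the norm polynomials. -/
theorem exists_normPoly_curve (α β : B) (ψ : F[X] →* B)
    (hψ : ∀ f, f.Monic → ψ f = homogEval α β f.natDegree f) (x₀ : κ) (hx₀ : IsIntegral F x₀)
    (hu : IsUnit (ψ (minpoly F x₀))) :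
    ∃ (s d K : ℕ) (H : Subgroup Bˣ) (bad : Finset κ), 0 < s ∧ Nat.card H ≤ d ∧
      (∀ k, 0 < k → s ∣ k → ∀ x ∈ frobFix F κ k, x ∉ bad → ∀ a : Bˣ, ψ (normPoly F x k) = a →
        a ∈ H) ∧
      ∀ k, 0 < k → s ∣ k → ∀ a : Bˣ,
        d * ((frobFix F κ (k + k)).filter fun x => ψ (normPoly F x (k + k)) = a).card ≤
          Fintype.card F ^ (k + k) + K * Fintype.card F ^ k := by
  let b := Module.Free.chooseBasis F B
  let ι := Module.Free.ChooseBasisIndex F B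
  have : Module.Finite F B := Module.Finite.of_finite
  let ρ : B →ₐ[F] Matrix ι ι κ :=
    ((Algebra.ofId F κ).mapMatrix).comp (Algebra.leftMulMatrix b)
  have hρinj : Function.Injective ρ :=
    (Matrix.map_injective (algebraMap F κ).injective).comp (Algebra.leftMulMatrix_injective b)
  have hρfix : ∀ m y, (qFrob F κ m).mapMatrix (ρ y) = ρ y := by
    intro m y
    ext i j
    exact (qFrob F κ m).commutes _
  have hcomm : ∀ y z, Commute (ρ y) (ρ z) := fun y z => (Commute.all y z).map ρ
  have hψρ : ∀ (x : κ) (k : ℕ), 0 < k → x ^ Fintype.card F ^ k = x →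
      frobNorm F (ρ α - x • ρ β) k = ρ (ψ (normPoly F x k)) := by
    intro x k hk hx
    obtain ⟨h3, h4⟩ := map_normPoly (F := F) x k hk hx
    have hm : (normPoly F x k).Monic := by
      refine monic_of_injective (algebraMap F κ).injective ?_
      rw [h4]
      exact monic_prod_X_sub_C _ _
    have hd : (normPoly F x k).natDegree = k := by
      rw [normPoly, natDegree_pow, Nat.div_mul_cancel h3]
    rw [(frobNorm_sub_smul (hcomm α β) (hρfix 1 α) (hρfix 1 β) x k).1, hψ _ hm, hd, ← h4]
    refine (map_homogEval (ρ : B →+* Matrix ι ι κ) (algebraMap F κ) ?_ k _).symm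
    intro c r
    rw [RingHom.coe_coe, map_smul, algebraMap_smul]
  set r := (minpoly F x₀).natDegree with hr
  have hr0 : 0 < r := minpoly.natDegree_pos hx₀
  obtain ⟨e, he⟩ := hu
  have hnorm₀ : ∀ k, 0 < k → r * Nat.card Bˣ ∣ k → x₀ ^ Fintype.card F ^ k = x₀ ∧
      frobNorm F (ρ α - x₀ • ρ β) k = 1 := by
    rintro k hk ⟨t, rfl⟩
    have hx : x₀ ^ Fintype.card F ^ (r * Nat.card Bˣ * t) = x₀ :=
      pow_card_pow_eq_self hx₀ ⟨Nat.card Bˣ * t, by rw [mul_assoc]⟩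
    refine ⟨hx, ?_⟩
    rw [hψρ _ _ hk hx, normPoly, ← hr, mul_assoc, Nat.mul_div_cancel_left _ hr0, map_pow, ← he,
      pow_mul, ← Units.val_pow_eq_pow_val, pow_card_eq_one', Units.val_one, one_pow, map_one]
  have hs0 : 0 < r * Nat.card Bˣ := Nat.mul_pos hr0 Nat.card_pos
  obtain ⟨M₀, hM₀⟩ : IsUnit (ρ α - x₀ • ρ β) := by
    have h := (hnorm₀ _ hs0 dvd_rfl).2
    obtain ⟨t, ht⟩ := Nat.exists_eq_succ_of_ne_zero hs0.ne'
    rw [ht, frobNorm] at h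
    exact ⟨⟨_, _, mul_eq_one_comm.1 h, h⟩, rfl⟩
  have hc1 : ∀ y, Commute (ρ y) (M₀ : Matrix ι ι κ) := fun y => by
    rw [hM₀]
    exact (hcomm y α).sub_right ((hcomm y β).smul_right _)
  let γ : Matrix ι ι κ := ρ β * ((M₀⁻¹ : (Matrix ι ι κ)ˣ) : Matrix ι ι κ)
  have hcγ : ∀ y, Commute (ρ y) γ := fun y =>
    (hcomm y β).mul_right (hc1 y).units_inv_right
  have hγs : (qFrob F κ (r * Nat.card Bˣ)).mapMatrix γ = γ := by
    have h1 : Units.map ((qFrob F κ (r * Nat.card Bˣ)).mapMatrix :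
        Matrix ι ι κ →ₐ[F] Matrix ι ι κ).toMonoidHom M₀ = M₀ := by
      ext1
      refine Eq.trans (b := (qFrob F κ (r * Nat.card Bˣ)).mapMatrix (M₀ : Matrix ι ι κ)) rfl ?_
      rw [hM₀, map_sub, hρfix]
      congr 1
      ext i j
      have h1 := (hnorm₀ _ hs0 dvd_rfl).1
      have h2 := congrFun (congrFun (hρfix (r * Nat.card Bˣ) β) i) j
      rw [AlgHom.mapMatrix_apply, Matrix.map_apply, qFrob_apply] at h2 ⊢
      rw [Matrix.smul_apply, smul_eq_mul, mul_pow, h1, h2]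
    have h2 := congrArg (fun u : (Matrix ι ι κ)ˣ => ((u⁻¹ : (Matrix ι ι κ)ˣ) : Matrix ι ι κ)) h1
    rw [← map_inv] at h2
    rw [map_mul, hρfix]
    exact congrArg (ρ β * ·) h2
  have hfac : ∀ z : κ, ρ α - (x₀ + z) • ρ β = (1 - z • γ) * M₀ := by
    intro z
    rw [sub_mul, one_mul, smul_mul_assoc, Units.inv_mul_cancel_right, hM₀, add_smul]
    abel
  have hkey : ∀ k, 0 < k → r * Nat.card Bˣ ∣ k → ∀ x : κ, x ^ Fintype.card F ^ k = x →
      frobNorm F (1 - (x - x₀) • γ) k = ρ (ψ (normPoly F x k)) := by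
    intro k hk hsk x hx
    have h1 := hfac (x - x₀)
    rw [add_sub_cancel] at h1
    rw [← hψρ x k hk hx, h1, frobNorm_mul, hM₀, (hnorm₀ k hk hsk).2, mul_one]
    intro j
    rw [hM₀, (frobNorm_sub_smul (hcomm α β) (hρfix 1 α) (hρfix 1 β) x₀ j).2]
    have h2 : ∀ y, Commute (ρ y) (1 - (x - x₀) • γ) := fun y =>
      (Commute.one_right _).sub_right ((hcγ y).smul_right _)
    exact commute_homogEval (h2 α) (h2 β) _ _
  obtain ⟨d, K, H, bad, h1, h2, h3⟩ := exists_lang_curve (F := F) γ (r * Nat.card Bˣ) hγs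
    ((ρ : B →* Matrix ι ι κ).comp (Units.coeHom B)) (hρinj.comp Units.val_injective)
  have hsub : ∀ k, 0 < k → r * Nat.card Bˣ ∣ k → ∀ x : κ, x ^ Fintype.card F ^ k = x →
      (x - x₀) ^ Fintype.card F ^ k = x - x₀ := by
    intro k hk hsk x hx
    rw [← qFrob_apply, map_sub, qFrob_apply, qFrob_apply, hx, (hnorm₀ k hk hsk).1]
  refine ⟨r * Nat.card Bˣ, d, K, H, bad.image (· + x₀), hs0, h1, ?_, ?_⟩
  · intro k hk hsk x hx hbad a ha
    rw [mem_frobFix hk] at hx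
    refine h2 k hsk (x - x₀) ?_ (hsub k hk hsk x hx) a ?_
    · intro hmem
      exact hbad (Finset.mem_image.2 ⟨_, hmem, sub_add_cancel _ _⟩)
    · rw [hkey k hk hsk x hx, ha]
      rfl
  · intro k hk hsk a
    have hsk' := hsk.trans (Dvd.intro_left 2 (two_mul k))
    have hk' : 0 < k + k := by omega
    refine le_trans (le_of_eq ?_) (h3 k hk a (((frobFix F κ (k + k)).filter fun x =>
      ψ (normPoly F x (k + k)) = a).image (· - x₀)) ?_)
    · rw [Finset.card_image_of_injective _ sub_left_injective]
    · intro z hz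
      obtain ⟨x, hx, rfl⟩ := Finset.mem_image.1 hz
      rw [Finset.mem_filter, mem_frobFix hk'] at hx
      refine ⟨hsub _ hk' hsk' x hx.1, ?_⟩
      rw [hkey _ hk' hsk' x hx.1, hx.2]
      rfl
end

theorem exists_hom_eq_one_on {G : Type*} [CommGroup G] [Finite G] (H : Subgroup G) {a : G}
    (ha : a ∉ H) : ∃ φ : G →* ℂˣ, (∀ h ∈ H, φ h = 1) ∧ φ a ≠ 1 := by
  obtain ⟨φ, hφ⟩ := CommGroup.exists_apply_ne_one_of_hasEnoughRootsOfUnity (G ⧸ H) ℂ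
    (a := (a : G ⧸ H)) (by rwa [Ne, QuotientGroup.eq_one_iff])
  refine ⟨φ.comp (QuotientGroup.mk' H), fun h hh => ?_, hφ⟩
  rw [MonoidHom.comp_apply, QuotientGroup.mk'_apply, (QuotientGroup.eq_one_iff h).2 hh, map_one]

open scoped Classical in
theorem sum_mulChar_subgroup {B : Type*} [CommRing B] (χ : MulChar B ℂ) (A : Subgroup Bˣ)
    [Fintype A] (a : A)
    (ha : χ (a : Bˣ) ≠ 1) : ∑ b : A, χ ((b : Bˣ) : B) = 0 := by
  refine eq_zero_of_mul_eq_self_left ha ?_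
  rw [Finset.mul_sum]
  refine Fintype.sum_bijective _ (Group.mulLeft_bijective a) _ _ fun b => ?_
  rw [← map_mul, Subgroup.coe_mul, Units.val_mul]

section
variable {B : Type*} [CommRing B] [Finite B]

theorem norm_mulChar_unit (χ : MulChar B ℂ) (a : Bˣ) : ‖χ a‖ = 1 := by
  refine Complex.norm_eq_one_of_pow_eq_one (n := Nat.card Bˣ) ?_ Nat.card_pos.ne'
  rw [← map_pow, ← Units.val_pow_eq_pow_val, pow_card_eq_one', Units.val_one, map_one]

theorem norm_mulChar_le (χ : MulChar B ℂ) (b : B) : ‖χ b‖ ≤ 1 := by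
  by_cases hb : IsUnit b
  · obtain ⟨a, rfl⟩ := hb
    exact (norm_mulChar_unit χ a).le
  · rw [MulChar.map_nonunit χ hb, norm_zero]
    exact zero_le_one

theorem exists_mulChar_eq_one_on (H : Subgroup Bˣ) {a : Bˣ} (ha : a ∉ H) :
    ∃ χ : MulChar B ℂ, (∀ h ∈ H, χ (h : Bˣ) = 1) ∧ χ a ≠ 1 := by
  obtain ⟨φ, h1, h2⟩ := exists_hom_eq_one_on H ha
  refine ⟨MulChar.ofUnitHom φ, fun h hh => ?_, fun h => h2 ?_⟩
  · rw [MulChar.ofUnitHom_coe, h1 h hh, Units.val_one]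
  · rw [MulChar.ofUnitHom_coe] at h
    exact Units.ext h
end

section
variable {F κ : Type*} [Field F] [Field κ] [Algebra F κ] [Algebra.IsAlgebraic F κ]

theorem normPoly_monic (x : κ) (k : ℕ) : (normPoly F x k).Monic :=
  (minpoly.monic (Algebra.IsAlgebraic.isAlgebraic x).isIntegral).pow _

theorem isCoprime_minpoly {Q : F[X]} {x : κ} (hx : aeval x Q ≠ 0) : IsCoprime (minpoly F x) Q :=
  ((minpoly.irreducible (Algebra.IsAlgebraic.isAlgebraic x).isIntegral).coprime_iff_not_dvd).2
    fun h => hx ((minpoly.dvd_iff).1 h)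

theorem isCoprime_normPoly {Q : F[X]} {x : κ} (hx : aeval x Q ≠ 0) (k : ℕ) :
    IsCoprime (normPoly F x k) Q :=
  (isCoprime_minpoly hx).pow_left
end

section
variable {F κ B : Type*} [Field F] [Fintype F] [Field κ] [Algebra F κ] [IsAlgClosed κ]
  [Algebra.IsAlgebraic F κ] [CommRing B] [Algebra F B] [Finite B]

/-- The Riemann hypothesis for the character sums attached to `ψ`. -/
theorem exists_powerSum_norm_le_sqrt {Q : F[X]} (hQ : Q ≠ 0) (α β : B) (ψ : F[X] →* B)
    (hψ : ∀ f, f.Monic → ψ f = homogEval α β f.natDegree f)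
    (hu : ∀ f, f.Monic → IsCoprime f Q → IsUnit (ψ f)) (A : Subgroup Bˣ)
    (hA : ∀ f, f.Monic → ∀ a : Bˣ, ψ f = a → a ∈ A) (D : ℕ)
    (hD : ∀ χ : MulChar B ℂ, (∃ a ∈ A, χ (a : Bˣ) ≠ 1) → ∀ n, D ≤ n →
      ∑ f ∈ monics F n, χ (ψ f) = 0) (χ : MulChar B ℂ) (hχ : ∃ a ∈ A, χ (a : Bˣ) ≠ 1) :
    ∃ s : Multiset ℂ, s.card ≤ D ∧ (∀ z ∈ s, ‖z‖ ≤ √(Fintype.card F)) ∧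
      ∀ k, 0 < k → pointSum κ ((χ : B →* ℂ).comp ψ) k = -(s.map (· ^ k)).sum := by
  classical
  have hpow : ∀ χ : MulChar B ℂ, (∃ a ∈ A, χ (a : Bˣ) ≠ 1) → ∃ s : Multiset ℂ, s.card ≤ D ∧
      ∀ k, 0 < k → pointSum κ ((χ : B →* ℂ).comp ψ) k = -(s.map (· ^ k)).sum := by
    intro χ hχ
    obtain ⟨s, hs, h⟩ := exists_powerSum_of_isEulerLogDeriv
      (monicSeries_logDeriv κ ((χ : B →* ℂ).comp ψ)) (moebiusSeries_mul_monicSeries _)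
      (by simp [monicSeries, monics_zero]) (D := D) (fun n hn => by
        rw [monicSeries, PowerSeries.coeff_mk]
        exact hD χ hχ n hn)
    refine ⟨s, hs, fun k hk => ?_⟩
    rw [← h k hk, PowerSeries.coeff_mk]
  set R : Finset κ := (Q.map (algebraMap F κ)).roots.toFinset with hR
  have hmemR : ∀ x, x ∈ R ↔ aeval x Q = 0 := fun x => by
    rw [hR, Multiset.mem_toFinset, mem_roots (Polynomial.map_ne_zero hQ), IsRoot.def,
      eval_map_algebraMap]
  have hunit : ∀ x ∉ R, ∀ k, ∃ a ∈ A, ψ (normPoly F x k) = (a : Bˣ) := fun x hx k => by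
    obtain ⟨a, ha⟩ := hu _ (normPoly_monic x k)
      (isCoprime_normPoly (fun h => hx ((hmemR x).2 h)) k)
    exact ⟨a, hA _ (normPoly_monic x k) a ha.symm, ha.symm⟩
  obtain ⟨x₀, hx₀⟩ := Infinite.exists_notMem_finset R
  have hi₀ : IsIntegral F x₀ := (Algebra.IsAlgebraic.isAlgebraic x₀).isIntegral
  obtain ⟨s, d, K, H, bad, hs, hHd, hH, hN⟩ := exists_normPoly_curve α β ψ hψ x₀ hi₀
    (hu _ (minpoly.monic hi₀) (isCoprime_minpoly fun h => hx₀ ((hmemR x₀).2 h)))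
  have hq : 1 < Fintype.card F := Fintype.one_lt_card
  have hAH : A ≤ H := by
    intro a haA
    by_contra haH
    obtain ⟨χ, h1, h2⟩ := exists_mulChar_eq_one_on H haH
    obtain ⟨t, -, ht⟩ := hpow χ ⟨a, haA, h2⟩
    obtain ⟨k₀, hk₀⟩ := pow_unbounded_of_one_lt (2 * (bad ∪ R).card) hq
    obtain ⟨k, hk, hk0, hsk, h3, -⟩ := exists_re_powerSum_ge t s hs k₀
    have h4 := ht k hk0
    rw [pointSum, if_neg hk0.ne'] at h4
    have h5 : ‖∑ x ∈ frobFix F κ k, (((χ : B →* ℂ).comp ψ) (normPoly F x k) - 1)‖ ≤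
        2 * (bad ∪ R).card := by
      rw [← Finset.sum_filter_add_sum_filter_not _ (· ∈ bad ∪ R)]
      have h6 : ∑ x ∈ (frobFix F κ k).filter (¬ · ∈ bad ∪ R),
          (((χ : B →* ℂ).comp ψ) (normPoly F x k) - 1) = 0 := by
        refine Finset.sum_eq_zero fun x hx => ?_
        rw [Finset.mem_filter, Finset.mem_union, not_or] at hx
        obtain ⟨b, -, hb⟩ := hunit x hx.2.2 k
        rw [MonoidHom.comp_apply, hb]
        exact sub_eq_zero.2 (h1 b (hH k hk0 hsk x hx.1 hx.2.1 b hb))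
      rw [h6, add_zero]
      refine (norm_sum_le_of_le (n := fun _ => (2 : ℝ)) _ fun x _ => ?_).trans ?_
      · refine (norm_sub_le _ _).trans ?_
        rw [norm_one]
        have := norm_mulChar_le χ (ψ (normPoly F x k))
        change ‖χ (ψ (normPoly F x k))‖ + 1 ≤ 2
        linarith
      · rw [Finset.sum_const, nsmul_eq_mul, mul_comm]
        gcongr
        intro x hx
        exact (Finset.mem_filter.1 hx).2
    rw [Finset.sum_sub_distrib, h4, Finset.sum_const, card_frobFix hk0, nsmul_one] at h5
    have h7 := (Complex.abs_re_le_norm _).trans h5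
    have h8 := (abs_le.1 h7).1
    have h9 : Fintype.card F ^ k₀ ≤ Fintype.card F ^ k := Nat.pow_le_pow_right hq.le hk
    have h10 : (2 * (bad ∪ R).card : ℝ) < (Fintype.card F : ℝ) ^ k := by
      exact_mod_cast hk₀.trans_le h9
    have h11 : (((Fintype.card F ^ k : ℕ) : ℂ)).re = (Fintype.card F : ℝ) ^ k := by
      rw [Complex.natCast_re]
      push_cast
      rfl
    rw [Complex.sub_re, Complex.neg_re, h11] at h8
    linarith
  have hAd : Nat.card A ≤ d := (Subgroup.card_le_of_le hAH).trans hHd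
  obtain ⟨t, ht, htk⟩ := hpow χ hχ
  refine ⟨t, ht, ?_, htk⟩
  have hqr : (0 : ℝ) < Fintype.card F := by exact_mod_cast hq.le
  refine norm_le_of_powerSum_le t (2 * s) (by omega) (B := K + R.card) (Real.sqrt_pos.2 hqr) ?_
  rintro k' hk' ⟨j, rfl⟩
  set k := s * j with hkdef
  have hk : 0 < k := by
    rw [mul_assoc, ← hkdef] at hk'
    omega
  have hk2 : 2 * s * j = k + k := by rw [mul_assoc, two_mul]
  rw [hk2, ← norm_neg, ← htk (k + k) (by omega), pointSum, if_neg (by omega), pow_add, ← mul_pow,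
    Real.mul_self_sqrt hqr.le]
  have : Fintype A := Fintype.ofFinite A
  let N : A → ℕ := fun a =>
    ((frobFix F κ (k + k)).filter fun x => ψ (normPoly F x (k + k)) = ((a : Bˣ) : B)).card
  have hsum : ∀ φ : B → ℂ, ∑ x ∈ (frobFix F κ (k + k)).filter
      (fun x => ∃ a ∈ A, ψ (normPoly F x (k + k)) = (a : Bˣ)), φ (ψ (normPoly F x (k + k))) =
      ∑ a : A, N a * φ ((a : Bˣ) : B) := by
    intro φ
    have h1 : (frobFix F κ (k + k)).filter
        (fun x => ∃ a ∈ A, ψ (normPoly F x (k + k)) = (a : Bˣ)) =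
        (Finset.univ : Finset A).biUnion fun a => (frobFix F κ (k + k)).filter
          fun x => ψ (normPoly F x (k + k)) = ((a : Bˣ) : B) := by
      ext x
      simp only [Finset.mem_filter, Finset.mem_biUnion, Finset.mem_univ, true_and, Subtype.exists]
      constructor
      · rintro ⟨h, a, ha, h'⟩
        exact ⟨a, ha, h, h'⟩
      · rintro ⟨a, ha, h, h'⟩
        exact ⟨h, a, ha, h'⟩
    rw [h1, Finset.sum_biUnion]
    · refine Finset.sum_congr rfl fun a _ => ?_
      rw [Finset.sum_congr rfl fun x hx => by rw [(Finset.mem_filter.1 hx).2], Finset.sum_const,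
        nsmul_eq_mul]
    · intro a _ b _ hab
      refine Finset.disjoint_left.2 fun x hx hx' => hab ?_
      exact Subtype.ext (Units.ext ((Finset.mem_filter.1 hx).2.symm.trans
        (Finset.mem_filter.1 hx').2))
  have hS : ∑ x ∈ frobFix F κ (k + k), ((χ : B →* ℂ).comp ψ) (normPoly F x (k + k)) =
      ∑ a : A, N a * χ ((a : Bˣ) : B) := by
    rw [← hsum χ]
    symm
    refine Finset.sum_filter_of_ne fun x hx h => ?_
    by_cases hb : IsUnit (ψ (normPoly F x (k + k)))
    · obtain ⟨a, ha⟩ := hb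
      exact ⟨a, hA _ (normPoly_monic x _) a ha.symm, ha.symm⟩
    · exact (h (MulChar.map_nonunit χ hb)).elim
  have hcount : (Fintype.card F : ℝ) ^ (k + k) - R.card ≤ ∑ a : A, (N a : ℝ) := by
    have h1 := hsum fun _ => 1
    simp only [mul_one, Finset.sum_const, nsmul_one] at h1
    have h2 : (frobFix F κ (k + k)).card ≤ ((frobFix F κ (k + k)).filter
      (fun x => ∃ a ∈ A, ψ (normPoly F x (k + k)) = (a : Bˣ))).card + R.card := by
      rw [← Finset.card_filter_add_card_filter_not (s := frobFix F κ (k + k))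
        (fun x => ∃ a ∈ A, ψ (normPoly F x (k + k)) = (a : Bˣ))]
      gcongr
      intro x hx
      by_contra hxR
      exact (Finset.mem_filter.1 hx).2 (hunit x hxR _)
    rw [card_frobFix (by omega)] at h2
    have h3 : (((frobFix F κ (k + k)).filter
      (fun x => ∃ a ∈ A, ψ (normPoly F x (k + k)) = (a : Bˣ))).card) = ∑ a : A, N a := by
      exact_mod_cast h1
    rw [h3] at h2
    have h4 : ((Fintype.card F ^ (k + k) : ℕ) : ℝ) ≤ ((∑ a : A, N a + R.card : ℕ) : ℝ) := by
      exact_mod_cast h2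
    push_cast at h4
    linarith
  have hcA : (0 : ℝ) < Nat.card A := by exact_mod_cast Nat.card_pos
  set T : ℝ := ((Fintype.card F : ℝ) ^ (k + k) + K * (Fintype.card F : ℝ) ^ k) / Nat.card A with hT
  have hNT : ∀ a : A, (N a : ℝ) ≤ T := by
    intro a
    rw [hT, le_div_iff₀' hcA]
    have h1 := (Nat.mul_le_mul_right (N a) hAd).trans (hN k hk (Dvd.intro _ rfl) a)
    exact_mod_cast h1
  obtain ⟨a, haA, haχ⟩ := hχ
  have h0 := sum_mulChar_subgroup χ A ⟨a, haA⟩ haχ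
  have hS' : ∑ a : A, N a * χ ((a : Bˣ) : B) = ∑ a : A, -((T - N a : ℝ) : ℂ) *
      χ ((a : Bˣ) : B) := by
    rw [← add_zero (∑ a : A, N a * χ ((a : Bˣ) : B)), ← mul_zero (-(T : ℂ)), ← h0, Finset.mul_sum,
      ← Finset.sum_add_distrib]
    refine Finset.sum_congr rfl fun a _ => ?_
    push_cast
    ring
  rw [hS, hS']
  refine (norm_sum_le_of_le (n := fun a : A => T - N a) _ fun a _ => ?_).trans ?_
  · rw [norm_mul, norm_mulChar_unit, mul_one, norm_neg, Complex.norm_real, Real.norm_eq_abs,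
      abs_of_nonneg (sub_nonneg.2 (hNT a))]
  · rw [Finset.sum_sub_distrib, Finset.sum_const, Finset.card_univ, nsmul_eq_mul,
      ← Nat.card_eq_fintype_card, hT, mul_div_cancel₀ _ hcA.ne']
    have h1 : (1 : ℝ) ≤ (Fintype.card F : ℝ) ^ k := one_le_pow₀ (by exact_mod_cast hq.le)
    have h2 : (R.card : ℝ) ≤ R.card * (Fintype.card F : ℝ) ^ k :=
      le_mul_of_one_le_right (Nat.cast_nonneg _) h1
    linarith
end

/-- A sequence with logarithmic derivative bounded by `u` is bounded by `exp (∑ u k / k)`. -/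
theorem norm_le_exp_of_logDeriv {a T : ℕ → ℂ} {u : ℕ → ℝ} (h0 : a 0 = 1) (hT0 : T 0 = 0)
    (hT : ∀ k, 0 < k → ‖T k‖ ≤ u k)
    (h : ∀ n : ℕ, (n : ℂ) * a n = ∑ k ∈ Finset.range (n + 1), T k * a (n - k)) (n : ℕ) :
    ‖a n‖ ≤ Real.exp (∑ k ∈ Finset.Icc 1 n, u k / k) := by
  have hu : ∀ k, 0 < k → 0 ≤ u k := fun k hk => (norm_nonneg _).trans (hT k hk)
  let A : ℝ[X] := ∑ i ∈ Finset.range (n + 1), C ‖a i‖ * X ^ i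
  let U : ℝ[X] := ∑ k ∈ Finset.Icc 1 n, C (u k / k) * X ^ k
  have hA : ∀ x, A.eval x = ∑ i ∈ Finset.range (n + 1), ‖a i‖ * x ^ i := fun x => by
    simp [A, eval_finsetSum]
  have hA' : ∀ x, x * (derivative A).eval x = ∑ i ∈ Finset.range (n + 1), i * ‖a i‖ * x ^ i :=
      fun x => by
    simp only [A, derivative_sum, eval_finsetSum, Finset.mul_sum]
    refine Finset.sum_congr rfl fun i _ => ?_
    rcases i with _ | i
    · simp
    · simp
      ring
  have hU' : ∀ x, x * (derivative U).eval x = ∑ k ∈ Finset.Icc 1 n, u k * x ^ k := fun x => by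
    simp only [U, derivative_sum, eval_finsetSum, Finset.mul_sum]
    refine Finset.sum_congr rfl fun k hk => ?_
    have hk := (Finset.mem_Icc.1 hk).1
    obtain ⟨k, rfl⟩ := Nat.exists_eq_succ_of_ne_zero (by omega : k ≠ 0)
    simp
    field_simp
    ring
  have hkey : ∀ x, 0 ≤ x → x * (derivative A).eval x ≤ x * (derivative U).eval x * A.eval x := by
    intro x hx
    rw [hA', hU', hA]
    have h1 : ∀ i : ℕ, (i : ℝ) * ‖a i‖ ≤ ∑ k ∈ Finset.Icc 1 i, u k * ‖a (i - k)‖ := by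
      intro i
      have h2 := congrArg norm (h i)
      rw [norm_mul, Complex.norm_natCast] at h2
      rw [h2, Finset.sum_range_eq_add_Ico _ (by omega), hT0, zero_mul, zero_add]
      refine norm_sum_le_of_le _ fun k hk => ?_
      rw [norm_mul]
      exact mul_le_mul_of_nonneg_right (hT k (Finset.mem_Ico.1 hk).1) (norm_nonneg _)
    calc ∑ i ∈ Finset.range (n + 1), i * ‖a i‖ * x ^ i
        ≤ ∑ i ∈ Finset.range (n + 1), ∑ k ∈ Finset.Icc 1 i,
            (u k * x ^ k) * (‖a (i - k)‖ * x ^ (i - k)) := by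
          refine Finset.sum_le_sum fun i _ => ?_
          refine (mul_le_mul_of_nonneg_right (h1 i) (pow_nonneg hx i)).trans (le_of_eq ?_)
          rw [Finset.sum_mul]
          refine Finset.sum_congr rfl fun k hk => ?_
          rw [mul_mul_mul_comm, ← pow_add, Nat.add_sub_cancel' (Finset.mem_Icc.1 hk).2]
      _ = ∑ p ∈ (Finset.range (n + 1)).sigma fun i => Finset.Icc 1 i,
            (u p.2 * x ^ p.2) * (‖a (p.1 - p.2)‖ * x ^ (p.1 - p.2)) := by
          rw [Finset.sum_sigma]
      _ = ∑ p ∈ ((Finset.range (n + 1)).sigma fun i => Finset.Icc 1 i).image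
            (fun p => (p.2, p.1 - p.2)), (u p.1 * x ^ p.1) * (‖a p.2‖ * x ^ p.2) := by
          rw [Finset.sum_image]
          rintro ⟨i, k⟩ hp ⟨j, l⟩ hp' heq
          simp only [Finset.coe_sigma, Set.mem_sigma_iff, Finset.mem_coe, Finset.mem_range,
            Finset.mem_Icc, Prod.mk.injEq] at hp hp' heq
          obtain ⟨rfl, h2⟩ := heq
          have : i = j := by omega
          rw [this]
      _ ≤ ∑ p ∈ Finset.Icc 1 n ×ˢ Finset.range (n + 1),
            (u p.1 * x ^ p.1) * (‖a p.2‖ * x ^ p.2) := by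
          refine Finset.sum_le_sum_of_subset_of_nonneg ?_ ?_
          · rintro ⟨k, j⟩ hp
            simp only [Finset.mem_image, Finset.mem_sigma, Finset.mem_range, Finset.mem_Icc,
              Prod.mk.injEq] at hp
            obtain ⟨⟨i, k'⟩, h2, rfl, rfl⟩ := hp
            simp only [Finset.mem_product, Finset.mem_range, Finset.mem_Icc]
            simp only at h2
            omega
          · intro p hp _
            have := hu p.1 (Finset.mem_Icc.1 (Finset.mem_product.1 hp).1).1
            positivity
      _ = _ := by rw [Finset.sum_product, Finset.sum_mul_sum]
  have hanti : AntitoneOn (fun x : ℝ => A.eval x * Real.exp (-U.eval x)) (Set.Icc 0 1) := by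
    refine antitoneOn_of_deriv_nonpos (convex_Icc 0 1) (by fun_prop) (by fun_prop) ?_
    intro x hx
    rw [interior_Icc] at hx
    have hd : HasDerivAt (fun x : ℝ => A.eval x * Real.exp (-U.eval x))
        ((derivative A).eval x * Real.exp (-U.eval x) +
          A.eval x * (Real.exp (-U.eval x) * (-(derivative U).eval x))) x :=
      (A.hasDerivAt x).mul (U.hasDerivAt x).neg.exp
    rw [hd.deriv]
    have h1 : (derivative A).eval x ≤ (derivative U).eval x * A.eval x := by
      have := hkey x hx.1.le
      rw [mul_assoc] at this
      exact le_of_mul_le_mul_left this hx.1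
    nlinarith [Real.exp_pos (-U.eval x)]
  have h1 := hanti (Set.left_mem_Icc.2 zero_le_one) (Set.right_mem_Icc.2 zero_le_one) zero_le_one
  have hU0 : U.eval 0 = 0 := by
    simp only [U, eval_finsetSum]
    refine Finset.sum_eq_zero fun k hk => ?_
    have := (Finset.mem_Icc.1 hk).1
    simp [show k ≠ 0 by omega]
  have hA0 : A.eval 0 = 1 := by
    rw [hA, Finset.sum_range_succ']
    simp [h0]
  have hU1 : U.eval 1 = ∑ k ∈ Finset.Icc 1 n, u k / k := by simp [U, eval_finsetSum]
  simp only [hU0, hA0, neg_zero, Real.exp_zero, mul_one] at h1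
  rw [Real.exp_neg, ← div_eq_mul_inv, div_le_one (Real.exp_pos _), hU1] at h1
  refine le_trans ?_ h1
  rw [hA]
  simp only [one_pow, mul_one]
  exact Finset.single_le_sum (f := fun i => ‖a i‖) (fun i _ => norm_nonneg _)
    (Finset.self_mem_range_succ n)

/-- Square-root type growth for a sequence with small logarithmic derivative. -/
theorem exists_norm_le_of_logDeriv {q : ℝ} (hq : 1 < q) {ε : ℝ} (hε : 0 < ε) :
    ∃ C : ℝ, 0 ≤ C ∧ ∀ (D : ℕ) (a T : ℕ → ℂ), a 0 = 1 → T 0 = 0 → (∀ k, 0 < k → ‖T k‖ ≤ q ^ k) →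
      (∀ k, 0 < k → ‖T k‖ ≤ D * √q ^ k) →
      (∀ n : ℕ, (n : ℂ) * a n = ∑ k ∈ Finset.range (n + 1), T k * a (n - k)) →
      ∀ n : ℕ, ‖a n‖ ≤ C * q ^ ((1 / 2 + ε) * n + ε * D) := by
  have hq0 : 0 < q := zero_lt_one.trans hq
  set R : ℝ := q ^ (-(1 / 2 + ε)) with hR
  have hR0 : 0 < R := Real.rpow_pos_of_pos hq0 _
  set r : ℝ := q ^ (-ε) with hr
  have hr0 : 0 < r := Real.rpow_pos_of_pos hq0 _
  have hr1 : r < 1 := Real.rpow_lt_one_of_one_lt_of_neg hq (neg_lt_zero.2 hε)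
  have hsR : √q * R = r := by
    rw [Real.sqrt_eq_rpow, hR, hr, ← Real.rpow_add hq0]
    congr 1
    ring
  obtain ⟨s, hs⟩ := summable_iff_vanishing_norm.1 (summable_geometric_of_lt_one hr0.le hr1)
    (ε * Real.log q) (mul_pos hε (Real.log_pos hq))
  refine ⟨Real.exp (∑ k ∈ s, (q * R) ^ k), (Real.exp_pos _).le, ?_⟩
  intro D a T h0 hT0 hT1 hT2 h n
  have hb := norm_le_exp_of_logDeriv (a := fun n => a n * (R : ℂ) ^ n)
    (T := fun k => T k * (R : ℂ) ^ k) (u := fun k => ‖T k‖ * R ^ k) (by simp [h0]) (by simp [hT0])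
    (fun k _ => by simp [abs_of_pos hR0]) (fun n => by
      rw [← mul_assoc, h, Finset.sum_mul]
      refine Finset.sum_congr rfl fun k hk => ?_
      rw [mul_mul_mul_comm, ← pow_add,
        Nat.add_sub_cancel' (Nat.le_of_lt_succ (Finset.mem_range.1 hk))]) n
  have h1 : ∑ k ∈ Finset.Icc 1 n, ‖T k‖ * R ^ k / k ≤
      ∑ k ∈ s, (q * R) ^ k + D * (ε * Real.log q) := by
    classical
    rw [← Finset.sum_filter_add_sum_filter_not _ (· ∈ s)]
    have hdiv : ∀ k ∈ Finset.Icc 1 n, ‖T k‖ * R ^ k / k ≤ ‖T k‖ * R ^ k := fun k hk =>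
      div_le_self (by positivity) (by exact_mod_cast (Finset.mem_Icc.1 hk).1)
    refine add_le_add ?_ ?_
    · refine (Finset.sum_le_sum (g := fun k => (q * R) ^ k) fun k hk => ?_).trans
        (Finset.sum_le_sum_of_subset_of_nonneg (fun k hk => (Finset.mem_filter.1 hk).2) ?_)
      · have hk := (Finset.mem_filter.1 hk).1
        refine (hdiv k hk).trans ?_
        rw [mul_pow]
        exact mul_le_mul_of_nonneg_right (hT1 k (Finset.mem_Icc.1 hk).1) (by positivity)
      · intro k _ _
        positivity
    · refine (Finset.sum_le_sum (g := fun k => D * r ^ k) fun k hk => ?_).trans ?_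
      · have hk := (Finset.mem_filter.1 hk).1
        refine (hdiv k hk).trans ?_
        rw [← hsR, mul_pow, ← mul_assoc]
        exact mul_le_mul_of_nonneg_right (hT2 k (Finset.mem_Icc.1 hk).1) (by positivity)
      · rw [← Finset.mul_sum]
        refine mul_le_mul_of_nonneg_left ?_ (Nat.cast_nonneg D)
        refine (Real.le_norm_self _).trans (hs _ ?_).le
        refine Finset.disjoint_left.2 fun k hk => ?_
        exact (Finset.mem_filter.1 hk).2
  have h2 := hb.trans (Real.exp_le_exp.2 h1)
  rw [norm_mul, norm_pow, Complex.norm_real, Real.norm_eq_abs, abs_of_pos hR0, Real.exp_add] at h2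
  have h3 : Real.exp (D * (ε * Real.log q)) = q ^ (ε * D) := by
    rw [Real.rpow_def_of_pos hq0]
    congr 1
    ring
  have h4 : R ^ n = (q ^ ((1 / 2 + ε) * n))⁻¹ := by
    rw [hR, ← Real.rpow_natCast, ← Real.rpow_mul hq0.le, ← Real.rpow_neg hq0.le, neg_mul]
  rw [h3, h4, ← div_eq_mul_inv, div_le_iff₀ (Real.rpow_pos_of_pos hq0 _)] at h2
  rw [Real.rpow_add hq0]
  calc _ ≤ _ := h2
    _ = _ := by ring

section
variable {F B : Type*} [Field F] [Fintype F] [CommRing B] [Algebra F B]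

/-- A multiplicative parametrization `ψ` of the classes of monic polynomials coprime to `Q` by a
group `A` of units, for which nontrivial character sums vanish from degree `D` on. -/
structure IsRayClassMap (Q : F[X]) (D : ℕ) (α β : B) (ψ : F[X] →* B) (A : Subgroup Bˣ) : Prop where
  ne_zero : Q ≠ 0
  natDegree_le : Q.natDegree ≤ D
  map_monic : ∀ f, f.Monic → ψ f = homogEval α β f.natDegree f
  isUnit_iff : ∀ f, f.Monic → (IsUnit (ψ f) ↔ IsCoprime f Q)
  mem : ∀ f, f.Monic → ∀ a : Bˣ, ψ f = a → a ∈ A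
  sum_eq_zero : ∀ χ : MulChar B ℂ, (∃ a ∈ A, χ (a : Bˣ) ≠ 1) → ∀ n, D ≤ n →
    ∑ f ∈ monics F n, χ (ψ f) = 0
end

theorem isCoprime_normPoly_iff {F κ : Type*} [Field F] [Fintype F] [Field κ] [Algebra F κ]
    [IsAlgClosed κ] [Algebra.IsAlgebraic F κ] {Q : F[X]} {x : κ} {k : ℕ} (hk : 0 < k)
    (hx : x ∈ frobFix F κ k) : IsCoprime (normPoly F x k) Q ↔ aeval x Q ≠ 0 := by
  refine ⟨fun h h0 => ?_, fun h => isCoprime_normPoly h k⟩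
  have hd := (map_normPoly (F := F) x k hk ((mem_frobFix hk).1 hx)).1
  have hi : IsIntegral F x := (Algebra.IsAlgebraic.isAlgebraic x).isIntegral
  have h1 : minpoly F x ∣ normPoly F x k :=
    dvd_pow_self _ (Nat.div_pos (Nat.le_of_dvd hk hd) (minpoly.natDegree_pos hi)).ne'
  exact (minpoly.irreducible hi).not_isUnit
    (h.isUnit_of_dvd' h1 (minpoly.dvd F x h0))

section
variable {F : Type*} [Field F] [Fintype F]

theorem norm_pointSum_le (κ : Type*) [Field κ] [Algebra F κ] [IsAlgClosed κ] {c : F[X] →* ℂ}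
    (hc : ∀ f, ‖c f‖ ≤ 1) (k : ℕ) : ‖pointSum κ c k‖ ≤ (Fintype.card F : ℝ) ^ k := by
  rw [pointSum]
  split_ifs with hk
  · simp only [norm_zero]
    positivity
  · refine (norm_sum_le_of_le (n := fun _ => (1 : ℝ)) _ fun x _ => hc _).trans ?_
    rw [Finset.sum_const, card_frobFix (by omega), nsmul_one]
    push_cast
    exact le_rfl

/-- Square-root cancellation in sums of the Möbius function twisted by characters. -/
theorem exists_norm_sum_polyMu_mulChar_le {ε : ℝ} (hε : 0 < ε) :
    ∃ C : ℝ, 0 ≤ C ∧ ∀ (B : Type*) [CommRing B] [Algebra F B] [Finite B] (Q : F[X]) (D : ℕ)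
      (α β : B) (ψ : F[X] →* B) (A : Subgroup Bˣ), IsRayClassMap Q D α β ψ A →
      ∀ (χ : MulChar B ℂ) (n : ℕ), ‖∑ f ∈ monics F n, (polyMu f : ℂ) * χ (ψ f)‖ ≤
        C * (Fintype.card F : ℝ) ^ ((1 / 2 + ε) * n + ε * D) := by
  classical
  set q : ℝ := (Fintype.card F : ℝ) with hqdef
  have hq : 1 < q := by
    rw [hqdef]
    exact_mod_cast Fintype.one_lt_card
  have hq0 : 0 < q := zero_lt_one.trans hq
  obtain ⟨C, hC0, hC⟩ := exists_norm_le_of_logDeriv hq hε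
  refine ⟨C * (1 + q), by positivity, ?_⟩
  intro B _ _ _ Q D α β ψ A hψ χ n
  let κ := AlgebraicClosure F
  set c : F[X] →* ℂ := (χ : B →* ℂ).comp ψ with hc
  have hc1 : ∀ f, ‖c f‖ ≤ 1 := fun f => norm_mulChar_le χ _
  have hlog : IsEulerLogDeriv (monicSeries c) (PowerSeries.mk (pointSum κ c)) :=
    monicSeries_logDeriv κ c
  have hlog' := hlog.of_mul_eq_one (moebiusSeries_mul_monicSeries c)
  have hcoeff : ∑ f ∈ monics F n, (polyMu f : ℂ) * χ (ψ f) = PowerSeries.coeff n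
      (moebiusSeries c) := by
    rw [moebiusSeries, PowerSeries.coeff_mk]
    rfl
  have hmoeb0 : PowerSeries.coeff 0 (moebiusSeries c) = 1 := by
    simp [moebiusSeries, monics_zero, polyMu_one]
  have hmono : ∀ i : ℕ, i ≤ n → C * q ^ ((1 / 2 + ε) * i + ε * D) ≤
      C * q ^ ((1 / 2 + ε) * n + ε * D) := fun i hi => by
    have : (i : ℝ) ≤ n := by exact_mod_cast hi
    exact mul_le_mul_of_nonneg_left (Real.rpow_le_rpow_of_exponent_le hq.le (by gcongr)) hC0
  rw [hcoeff]
  by_cases hχ : ∃ a ∈ A, χ (a : Bˣ) ≠ 1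
  · obtain ⟨s, hs, hs1, hs2⟩ := exists_powerSum_norm_le_sqrt (κ := κ) hψ.ne_zero α β ψ hψ.map_monic
      (fun f hf h => (hψ.isUnit_iff f hf).2 h) A hψ.mem D hψ.sum_eq_zero χ hχ
    refine (hC D (fun n => PowerSeries.coeff n (moebiusSeries c))
      (fun k => PowerSeries.coeff k (-PowerSeries.mk (pointSum κ c))) hmoeb0 ?_ ?_ ?_
      hlog'.mul_coeff n).trans ?_
    · simp [pointSum]
    · intro k _
      rw [map_neg, PowerSeries.coeff_mk, norm_neg]
      exact norm_pointSum_le κ hc1 k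
    · intro k hk
      rw [map_neg, PowerSeries.coeff_mk, norm_neg, hs2 k hk, norm_neg]
      refine (norm_multiset_sum_le _).trans ?_
      rw [Multiset.map_map]
      refine (Multiset.sum_le_card_nsmul _ (√q ^ k) ?_).trans ?_
      · intro y hy
        obtain ⟨z, hz, rfl⟩ := Multiset.mem_map.1 hy
        rw [Function.comp_apply, norm_pow]
        exact pow_le_pow_left₀ (norm_nonneg _) (hs1 z hz) k
      · rw [Multiset.card_map, nsmul_eq_mul]
        gcongr
    · rw [mul_right_comm]
      exact le_mul_of_one_le_right (by positivity) (by linarith)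
  · push Not at hχ
    set R : Finset κ := (Q.map (algebraMap F κ)).roots.toFinset with hR
    have hmemR : ∀ x, x ∈ R ↔ aeval x Q = 0 := fun x => by
      rw [hR, Multiset.mem_toFinset, mem_roots (Polynomial.map_ne_zero hψ.ne_zero), IsRoot.def,
        eval_map_algebraMap]
    have hRD : R.card ≤ D := (Multiset.toFinset_card_le _).trans
      ((card_roots' _).trans ((natDegree_map_le).trans hψ.natDegree_le))
    have hcx : ∀ k, 0 < k → ∀ x ∈ frobFix F κ k, c (normPoly F x k) = if x ∈ R then 0 else 1 := by
      intro k hk x hx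
      rw [hc, MonoidHom.comp_apply]
      change χ _ = _
      split_ifs with h
      · refine MulChar.map_nonunit χ fun h1 => ?_
        rw [hψ.isUnit_iff _ (normPoly_monic x k), isCoprime_normPoly_iff hk hx] at h1
        exact h1 ((hmemR x).1 h)
      · obtain ⟨a, ha⟩ := (hψ.isUnit_iff _ (normPoly_monic x k)).2
          (isCoprime_normPoly (fun h0 => h ((hmemR x).2 h0)) k)
        rw [← ha]
        exact hχ a (hψ.mem _ (normPoly_monic x k) a ha.symm)
    let Z : ℕ → ℂ := fun k => if k = 0 then 0 else (((frobFix F κ k).filter (· ∈ R)).card : ℂ)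
    have hS : ∀ k, 0 < k → pointSum κ c k = q ^ k - Z k := by
      intro k hk
      rw [pointSum, if_neg hk.ne', Finset.sum_congr rfl (hcx k hk)]
      simp only [Z, if_neg hk.ne']
      have h1 := Finset.card_filter_add_card_filter_not (s := frobFix F κ k) (· ∈ R)
      rw [card_frobFix hk] at h1
      have h2 : (((frobFix F κ k).filter (· ∈ R)).card : ℂ) +
          ((frobFix F κ k).filter (¬ · ∈ R)).card = (q : ℂ) ^ k := by
        rw [hqdef]
        exact_mod_cast h1
      rw [Finset.sum_ite, Finset.sum_const_zero, zero_add, Finset.sum_const, nsmul_one]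
      linear_combination h2
    let G : PowerSeries ℂ := PowerSeries.mk fun k => (q : ℂ) ^ k
    have hG : G * (1 - PowerSeries.C (q : ℂ) * PowerSeries.X) = 1 := by
      ext k
      rw [mul_sub, mul_one, mul_left_comm, map_sub, PowerSeries.coeff_C_mul, PowerSeries.coeff_one]
      rcases k with - | k
      · simp [G]
      · simp [G, pow_succ']
    have hlogA := hlog'.mul ((IsEulerLogDeriv.one_sub_mul_X (q : ℂ)).of_mul_eq_one hG)
    have hprod : moebiusSeries c = (moebiusSeries c * G) *
      (1 - PowerSeries.C (q : ℂ) * PowerSeries.X) := by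
      rw [mul_assoc, hG, mul_one]
    have hT : ∀ k, 0 < k → PowerSeries.coeff k (-PowerSeries.mk (pointSum κ c) +
        - -PowerSeries.mk fun k => if k = 0 then 0 else (q : ℂ) ^ k) = Z k := by
      intro k hk
      rw [neg_neg, map_add, map_neg, PowerSeries.coeff_mk, PowerSeries.coeff_mk, if_neg hk.ne',
        hS k hk]
      ring
    have hZ : ∀ k, 0 < k → Z k = (((frobFix F κ k).filter (· ∈ R)).card : ℂ) := fun k hk =>
      if_neg hk.ne'
    have hb := hC D (fun n => PowerSeries.coeff n (moebiusSeries c * G)) _ (by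
        rw [PowerSeries.coeff_mul]
        simp [hmoeb0, G]) (by simp [pointSum]) (by
        intro k hk
        rw [hT k hk, hZ k hk, Complex.norm_natCast]
        have h1 := Finset.card_filter_le (frobFix F κ k) (· ∈ R)
        rw [card_frobFix hk] at h1
        rw [hqdef]
        exact_mod_cast h1) (by
        intro k hk
        rw [hT k hk, hZ k hk, Complex.norm_natCast]
        have h1 : ((frobFix F κ k).filter (· ∈ R)).card ≤ R.card :=
          Finset.card_le_card fun x hx => (Finset.mem_filter.1 hx).2
        have h2 : (((frobFix F κ k).filter (· ∈ R)).card : ℝ) ≤ D := by exact_mod_cast h1.trans hRD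
        refine h2.trans (le_mul_of_one_le_right (Nat.cast_nonneg D) (one_le_pow₀ ?_))
        exact Real.one_le_sqrt.2 hq.le) hlogA.mul_coeff
    rw [hprod, mul_sub, mul_one, mul_left_comm, map_sub, PowerSeries.coeff_C_mul]
    refine (norm_sub_le _ _).trans ?_
    rw [norm_mul, Complex.norm_real, Real.norm_eq_abs, abs_of_pos hq0]
    have h1 := hb n
    have h2 : ‖PowerSeries.coeff n (moebiusSeries c * G * PowerSeries.X)‖ ≤
        C * q ^ ((1 / 2 + ε) * n + ε * D) := by
      rcases n with - | n
      · simp only [PowerSeries.coeff_zero_mul_X, norm_zero]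
        positivity
      · rw [PowerSeries.coeff_succ_mul_X]
        exact (hb n).trans (hmono n n.le_succ)
    have h3 := mul_le_mul_of_nonneg_left h2 hq0.le
    linarith
end

section
variable {F : Type*} [Field F]

theorem exists_degree_lt_reflect {Q : F[X]} (hQ : Q ≠ 0) {l n : ℕ} (hn : Q.natDegree + l ≤ n)
    (g h : F[X]) : ∃ p : F[X], p.degree < n ∧ Q ∣ p - g ∧ X ^ (l + 1) ∣ p.reflect n - X * h := by
  set k := X * (h %ₘ X ^ l) with hk
  have hkc : ∀ i, l < i → k.coeff i = 0 := by
    intro i hi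
    obtain ⟨i, rfl⟩ := Nat.exists_eq_succ_of_ne_zero (by omega : i ≠ 0)
    rw [hk, coeff_X_mul]
    refine coeff_eq_zero_of_degree_lt ((degree_modByMonic_lt h (monic_X_pow l)).trans_le ?_)
    rw [degree_X_pow]
    exact_mod_cast Nat.le_of_lt_succ hi
  set r := (g - k.reflect n) % Q with hr
  have hrQ : r.degree < Q.degree := degree_mod_lt _ hQ
  have hrc : ∀ i, n - l ≤ i → r.coeff i = 0 := by
    intro i hi
    refine coeff_eq_zero_of_degree_lt (hrQ.trans_le ?_)
    rw [degree_eq_natDegree hQ]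
    exact_mod_cast (by omega)
  refine ⟨k.reflect n + r, ?_, ?_, ?_⟩
  · rw [degree_lt_iff_coeff_zero]
    intro i hi
    rw [coeff_add, coeff_reflect, hrc i (by omega), add_zero]
    rcases hi.eq_or_lt with rfl | hi
    · rw [revAt_le le_rfl, Nat.sub_self, hk, mul_coeff_zero, coeff_X_zero, zero_mul]
    · rw [revAt_eq_self_of_lt hi, hkc i (by omega)]
  · have h1 := EuclideanDomain.div_add_mod (g - k.reflect n) Q
    refine ⟨-((g - k.reflect n) / Q), ?_⟩
    rw [hr]
    linear_combination h1
  · rw [reflect_add]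
    have h1 : (k.reflect n).reflect n = k := by
      ext i
      rw [coeff_reflect, coeff_reflect, revAt_invol]
    have h2 : X ^ (l + 1) ∣ r.reflect n := by
      rw [X_pow_dvd_iff]
      intro d hd
      rw [coeff_reflect, revAt_le (by omega), hrc _ (by omega)]
    have h3 : X ^ (l + 1) ∣ k - X * h := by
      rw [hk, ← mul_sub, pow_succ']
      refine mul_dvd_mul_left _ ?_
      have := modByMonic_add_div h (X ^ l : F[X])
      exact ⟨-(h /ₘ X ^ l), by linear_combination this⟩
    rw [h1, add_sub_right_comm]
    exact dvd_add h3 h2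

theorem isUnit_adjoinRoot_mk_iff {Q f : F[X]} : IsUnit (AdjoinRoot.mk Q f) ↔ IsCoprime f Q := by
  constructor
  · intro h
    obtain ⟨y, hy⟩ := h.exists_left_inv
    obtain ⟨g, rfl⟩ := AdjoinRoot.mk_surjective y
    rw [← map_mul, ← map_one (AdjoinRoot.mk Q), AdjoinRoot.mk_eq_mk] at hy
    obtain ⟨k, hk⟩ := hy
    exact ⟨g, -k, by linear_combination hk⟩
  · rintro ⟨a, b, h⟩
    refine IsUnit.of_mul_eq_one_right (AdjoinRoot.mk Q a) ?_
    rw [← map_mul, ← map_one (AdjoinRoot.mk Q), AdjoinRoot.mk_eq_mk]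
    exact ⟨-b, by linear_combination h⟩

/-- The ring classifying residues modulo `Q` and the first `l` coefficients. -/
abbrev RayRing (Q : F[X]) (l : ℕ) : Type _ := AdjoinRoot Q × AdjoinRoot (X ^ (l + 1) : F[X])

/-- The class of a polynomial in the ring `RayRing Q l`. -/
noncomputable def rayMap (Q : F[X]) (l : ℕ) : F[X] →* RayRing Q l where
  toFun f := (AdjoinRoot.mk Q f, AdjoinRoot.mk _ f.reverse)
  map_one' := by rw [← C_1, reverse_C, C_1, map_one, map_one]; rfl
  map_mul' f g := by rw [reverse_mul_of_domain, map_mul, map_mul]; rfl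

theorem rayMap_apply (Q : F[X]) (l : ℕ) (f : F[X]) :
    rayMap Q l f = (AdjoinRoot.mk Q f, AdjoinRoot.mk _ f.reverse) := rfl

/-- The constant coefficient of the second component. -/
noncomputable def rayConst (Q : F[X]) (l : ℕ) : RayRing Q l →+* F :=
  (AdjoinRoot.lift (RingHom.id F) 0 (by simp)).comp (RingHom.snd _ _)

theorem rayConst_mk (Q : F[X]) (l : ℕ) (y : AdjoinRoot Q) (f : F[X]) :
    rayConst Q l (y, AdjoinRoot.mk _ f) = f.coeff 0 := by
  rw [rayConst, RingHom.comp_apply, RingHom.coe_snd, AdjoinRoot.lift_mk, coeff_zero_eq_eval_zero]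
  rfl

/-- The units of `RayRing Q l` whose second component has constant coefficient `1`. -/
noncomputable def rayUnits (Q : F[X]) (l : ℕ) : Subgroup (RayRing Q l)ˣ :=
  (Units.map (rayConst Q l : RayRing Q l →* F)).ker

theorem mem_rayUnits {Q : F[X]} {l : ℕ} {a : (RayRing Q l)ˣ} :
    a ∈ rayUnits Q l ↔ rayConst Q l a = 1 := by
  rw [rayUnits, MonoidHom.mem_ker, Units.ext_iff]
  rfl

theorem rayConst_rayMap (Q : F[X]) (l : ℕ) {f : F[X]} (hf : f.Monic) :
    rayConst Q l (rayMap Q l f) = 1 := by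
  rw [rayMap_apply, rayConst_mk, coeff_zero_reverse, hf.leadingCoeff]

theorem rayMap_eq_homogEval (Q : F[X]) (l : ℕ) (f : F[X]) : rayMap Q l f =
    homogEval ((AdjoinRoot.root Q, 1) : RayRing Q l) (1, AdjoinRoot.root _) f.natDegree f := by
  rw [rayMap_apply, homogEval]
  refine Prod.ext ?_ ?_
  · rw [Prod.fst_sum, ← AdjoinRoot.aeval_eq, aeval_eq_sum_range]
    simp
  · change AdjoinRoot.mk _ f.reverse = _
    rw [Prod.snd_sum, ← AdjoinRoot.aeval_eq,
      aeval_eq_sum_range' (Nat.lt_succ_of_le (reverse_natDegree_le f)), ← Finset.sum_range_reflect]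
    refine Finset.sum_congr rfl fun i hi => ?_
    have hi := Finset.mem_range.1 hi
    simp only [Prod.smul_snd, Prod.snd_mul, Prod.pow_snd, one_pow, one_mul]
    rw [coeff_reverse, revAt_le (by omega)]
    congr 2; omega

theorem isUnit_rayMap_iff (Q : F[X]) (l : ℕ) {f : F[X]} (hf : f.Monic) :
    IsUnit (rayMap Q l f) ↔ IsCoprime f Q := by
  rw [rayMap_apply, Prod.isUnit_iff, isUnit_adjoinRoot_mk_iff, isUnit_adjoinRoot_mk_iff,
    and_iff_left_iff_imp]
  intro _
  refine (IsCoprime.pow_right ?_)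
  refine (irreducible_X.coprime_iff_not_dvd.2 fun h => ?_).symm
  rw [X_dvd_iff, coeff_zero_reverse, hf.leadingCoeff] at h
  exact one_ne_zero h

theorem rayMap_eq_iff {Q : F[X]} {l : ℕ} {f g : F[X]} (hfg : rayMap Q l f = rayMap Q l g) :
    Q ∣ f - g ∧ ∀ i ≤ l, firstCoeff f i = firstCoeff g i := by
  rw [rayMap_apply, rayMap_apply, Prod.mk.injEq, AdjoinRoot.mk_eq_mk, AdjoinRoot.mk_eq_mk,
    X_pow_dvd_iff] at hfg
  refine ⟨hfg.1, fun i hi => ?_⟩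
  have h : ∀ f : F[X], firstCoeff f i = f.reverse.coeff i := by
    intro f
    rw [firstCoeff, coeff_reverse]
    split_ifs with h
    · rw [revAt_le h]
    · rw [revAt_eq_self_of_lt (by omega), coeff_eq_zero_of_natDegree_lt (by omega)]
  rw [h, h, ← sub_eq_zero, ← coeff_sub]
  exact hfg.2 i (by omega)

variable [Fintype F]

theorem finite_rayRing {Q : F[X]} (hQ : Q ≠ 0) (l : ℕ) : Finite (RayRing Q l) ∧
    Nat.card (RayRing Q l) = Fintype.card F ^ (Q.natDegree + l + 1) := by
  have h : ∀ P : F[X], P ≠ 0 → Finite (AdjoinRoot P) ∧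
      Nat.card (AdjoinRoot P) = Fintype.card F ^ P.natDegree := by
    intro P hP
    have := (AdjoinRoot.powerBasis hP).finite
    have hfin : Finite (AdjoinRoot P) := Module.finite_of_finite F
    refine ⟨hfin, ?_⟩
    rw [Module.natCard_eq_pow_finrank (K := F), Nat.card_eq_fintype_card,
      (AdjoinRoot.powerBasis hP).finrank, AdjoinRoot.powerBasis_dim]
  have h1 := h Q hQ
  have h2 := h (X ^ (l + 1)) (monic_X_pow _).ne_zero
  have := h1.1
  have := h2.1
  refine ⟨inferInstance, ?_⟩
  rw [Nat.card_prod, h1.2, h2.2, natDegree_X_pow, ← pow_add, add_assoc]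

theorem sum_monics_rayMap_mul {Q : F[X]} (hQ : Q ≠ 0) {l n : ℕ} (hn : Q.natDegree + l ≤ n)
    {a : (RayRing Q l)ˣ} (ha : a ∈ rayUnits Q l) (φ : RayRing Q l → ℂ) :
    ∑ f ∈ monics F n, φ (a * rayMap Q l f) = ∑ f ∈ monics F n, φ (rayMap Q l f) := by
  have hlift : ∀ b : RayRing Q l, ∃ p : F[X], rayConst Q l b = 0 → p.degree < n ∧
      ∀ f ∈ monics F n, rayMap Q l (f + p) = rayMap Q l f + b := by
    rintro ⟨y, z⟩
    obtain ⟨g, rfl⟩ := AdjoinRoot.mk_surjective y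
    obtain ⟨k, rfl⟩ := AdjoinRoot.mk_surjective z
    by_cases hk0 : k.coeff 0 = 0
    swap
    · exact ⟨0, fun h => (hk0 (by rwa [rayConst_mk] at h)).elim⟩
    obtain ⟨h, rfl⟩ := X_dvd_iff.2 hk0
    obtain ⟨p, hp, h1, h2⟩ := exists_degree_lt_reflect hQ hn g h
    refine ⟨p, fun _ => ⟨hp, fun f hf => ?_⟩⟩
    rw [mem_monics] at hf
    have hp' : p.degree < f.degree := by rwa [degree_eq_natDegree hf.1.ne_zero, hf.2]
    have hd : (f + p).natDegree = n := by
      rw [natDegree_add_eq_left_of_degree_lt hp', hf.2]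
    rw [rayMap_apply, rayMap_apply, Prod.mk_add_mk, ← map_add, ← map_add]
    refine Prod.ext ?_ ?_
    · refine AdjoinRoot.mk_eq_mk.2 ?_
      convert h1 using 1
      ring
    · refine AdjoinRoot.mk_eq_mk.2 ?_
      convert h2 using 1
      rw [reverse, reverse, hd, hf.2, reflect_add]
      ring
  choose r hr using hlift
  have hr' : ∀ f ∈ monics F n, f + r (a * rayMap Q l f - rayMap Q l f) ∈ monics F n ∧
      rayMap Q l (f + r (a * rayMap Q l f - rayMap Q l f)) = a * rayMap Q l f := by
    intro f hf
    obtain ⟨h1, h2⟩ := hr (a * rayMap Q l f - rayMap Q l f)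
      (by rw [map_sub, map_mul, mem_rayUnits.1 ha, one_mul, sub_self])
    refine ⟨?_, by rw [h2 f hf, add_sub_cancel]⟩
    rw [mem_monics] at hf ⊢
    rw [← hf.2, ← degree_eq_natDegree hf.1.ne_zero] at h1
    exact ⟨hf.1.add_of_left h1, by rw [natDegree_add_eq_left_of_degree_lt h1, hf.2]⟩
  have hinj : Set.InjOn (fun f => f + r (a * rayMap Q l f - rayMap Q l f)) (monics F n) := by
    intro f hf g hg h
    have h1 := congrArg (rayMap Q l) h
    simp only at h h1
    rw [(hr' f hf).2, (hr' g hg).2, Units.mul_right_inj] at h1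
    rw [h1] at h
    exact add_right_cancel h
  exact Finset.sum_bij (fun f _ => f + r (a * rayMap Q l f - rayMap Q l f))
    (fun f hf => (hr' f hf).1)
    (fun f hf g hg h => hinj hf hg h)
    (fun g hg => by
      obtain ⟨f, hf, h⟩ := Finset.surj_on_of_inj_on_of_card_le _ (fun f hf => (hr' f hf).1)
        (fun f g hf hg h => hinj hf hg h) le_rfl g hg
      exact ⟨f, hf, h.symm⟩)
    fun f hf => by rw [(hr' f hf).2]

theorem isRayClassMap_rayMap {Q : F[X]} (hQ : Q ≠ 0) (l : ℕ) :
    IsRayClassMap Q (Q.natDegree + l) ((AdjoinRoot.root Q, 1) : RayRing Q l) (1, AdjoinRoot.root _)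
      (rayMap Q l) (rayUnits Q l) where
  ne_zero := hQ
  natDegree_le := Nat.le_add_right _ _
  map_monic f _ := rayMap_eq_homogEval Q l f
  isUnit_iff f hf := isUnit_rayMap_iff Q l hf
  mem f hf a ha := by rw [mem_rayUnits, ← ha, rayConst_rayMap Q l hf]
  sum_eq_zero χ hχ n hn := by
    obtain ⟨a, ha, hχa⟩ := hχ
    refine eq_zero_of_mul_eq_self_left hχa ?_
    have h := sum_monics_rayMap_mul hQ hn ha (fun b => χ b)
    simp only [map_mul] at h
    rwa [← Finset.mul_sum] at h
end

section
variable {B : Type*} [CommRing B] [Finite B]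

open scoped Classical in
theorem sum_mulChar_mul_conj [Fintype (MulChar B ℂ)] (u v : Bˣ) :
    ∑ χ : MulChar B ℂ, χ u * starRingEnd ℂ (χ v) = if u = v then (Nat.card Bˣ : ℂ) else 0 := by
  have h : ∀ χ : MulChar B ℂ, χ u * starRingEnd ℂ (χ v) = χ ((u * v⁻¹ : Bˣ) : B) := by
    intro χ
    have h1 : χ v * starRingEnd ℂ (χ v) = 1 := by
      rw [Complex.mul_conj', norm_mulChar_unit]
      norm_num
    have h2 : χ ((u * v⁻¹ : Bˣ) : B) * χ v = χ u := by
      rw [← map_mul, ← Units.val_mul, inv_mul_cancel_right]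
    rw [← h2, mul_assoc, h1, mul_one]
  rw [Finset.sum_congr rfl fun χ _ => h χ]
  split_ifs with huv
  · rw [huv, mul_inv_cancel, Units.val_one]
    simp only [map_one, Finset.sum_const, nsmul_one]
    rw [Finset.card_univ, ← Nat.card_eq_fintype_card,
      MulChar.card_eq_card_units_of_hasEnoughRootsOfUnity]
  · obtain ⟨χ, hχ⟩ := MulChar.exists_apply_ne_one_of_hasEnoughRootsOfUnity B ℂ
      (a := ((u * v⁻¹ : Bˣ) : B)) (by
        rw [Ne, Units.val_eq_one, mul_inv_eq_one]
        exact huv)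
    refine eq_zero_of_mul_eq_self_left hχ ?_
    rw [Finset.mul_sum]
    simp only [← MulChar.mul_apply]
    exact Fintype.sum_bijective _ (Group.mulLeft_bijective χ) _ _ fun _ => rfl

theorem sum_norm_sq_mulChar [Fintype Bˣ] [Fintype (MulChar B ℂ)] (W : Bˣ → ℂ) :
    ∑ χ : MulChar B ℂ, ‖∑ u, W u * χ u‖ ^ 2 = Nat.card Bˣ * ∑ u, ‖W u‖ ^ 2 := by
  classical
  rw [← Complex.ofReal_inj]
  push_cast
  simp only [← Complex.mul_conj', map_sum, Finset.sum_mul_sum, map_mul]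
  rw [Finset.sum_comm, Finset.mul_sum]
  refine Finset.sum_congr rfl fun u _ => ?_
  rw [Finset.sum_comm]
  have h : ∀ v, ∑ χ : MulChar B ℂ, W u * χ u * (starRingEnd ℂ (W v) * starRingEnd ℂ (χ v)) =
      W u * starRingEnd ℂ (W v) * if u = v then (Nat.card Bˣ : ℂ) else 0 := by
    intro v
    rw [← sum_mulChar_mul_conj, Finset.mul_sum]
    refine Finset.sum_congr rfl fun χ _ => ?_
    ring
  rw [Finset.sum_congr rfl fun v _ => h v]
  simp [mul_comm]

open scoped Classical in
/-- Bounds for character sums bound the correlation with all bounded functions of the class. -/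
theorem norm_sum_mul_le_of_mulChar {ι : Type*} (S : Finset ι) (w : ι → ℂ) (ψ : ι → B) (g : B → ℂ)
    (hg : ∀ i ∈ S, ‖g (ψ i)‖ ≤ 1) {M : ℝ} (hM0 : 0 ≤ M)
    (hM : ∀ χ : MulChar B ℂ, ‖∑ i ∈ S, w i * χ (ψ i)‖ ≤ M) :
    ‖∑ i ∈ S.filter (fun i => IsUnit (ψ i)), w i * g (ψ i)‖ ≤ √(Nat.card Bˣ) * M := by
  have : Fintype Bˣ := Fintype.ofFinite _
  have : Fintype (MulChar B ℂ) := Fintype.ofFinite _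
  let W : Bˣ → ℂ := fun u => ∑ i ∈ S.filter (ψ · = u), w i
  have hsum : ∀ φ : B → ℂ, ∑ i ∈ S.filter (fun i => IsUnit (ψ i)), w i * φ (ψ i) =
      ∑ u : Bˣ, W u * φ u := by
    intro φ
    have h1 : S.filter (fun i => IsUnit (ψ i)) =
        (Finset.univ : Finset Bˣ).biUnion fun u => S.filter (ψ · = u) := by
      ext i
      simp only [Finset.mem_filter, Finset.mem_biUnion, Finset.mem_univ, true_and]
      constructor
      · rintro ⟨h, u, hu⟩
        exact ⟨u, h, hu.symm⟩
      · rintro ⟨u, h, hu⟩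
        exact ⟨h, u, hu.symm⟩
    rw [h1, Finset.sum_biUnion]
    · refine Finset.sum_congr rfl fun u _ => ?_
      rw [Finset.sum_mul]
      refine Finset.sum_congr rfl fun i hi => ?_
      rw [(Finset.mem_filter.1 hi).2]
    · intro u _ v _ huv
      refine Finset.disjoint_left.2 fun i hi hi' => huv ?_
      exact Units.ext ((Finset.mem_filter.1 hi).2.symm.trans (Finset.mem_filter.1 hi').2)
  have hM' : ∀ χ : MulChar B ℂ, ‖∑ u : Bˣ, W u * χ u‖ ≤ M := by
    intro χ
    rw [← hsum χ, Finset.sum_filter_of_ne]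
    · exact hM χ
    · intro i _ h
      by_contra hi
      exact h (by rw [MulChar.map_nonunit χ hi, mul_zero])
  have hN : (0 : ℝ) < Nat.card Bˣ := by exact_mod_cast Nat.card_pos
  have hW : ∑ u, ‖W u‖ ^ 2 ≤ M ^ 2 := by
    refine le_of_mul_le_mul_left ?_ hN
    rw [← sum_norm_sq_mulChar]
    refine (Finset.sum_le_sum fun χ _ => pow_le_pow_left₀ (norm_nonneg _) (hM' χ) 2).trans ?_
    rw [Finset.sum_const, nsmul_eq_mul, Finset.card_univ, ← Nat.card_eq_fintype_card,
      MulChar.card_eq_card_units_of_hasEnoughRootsOfUnity]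
  have hWg : ∀ u, ‖W u * g u‖ ≤ ‖W u‖ := by
    intro u
    rw [norm_mul]
    by_cases h : ∃ i ∈ S, ψ i = u
    · obtain ⟨i, hi, hiu⟩ := h
      rw [← hiu]
      exact mul_le_of_le_one_right (norm_nonneg _) (hg i hi)
    · have : W u = 0 := by
        refine Finset.sum_eq_zero fun i hi => (h ⟨i, ?_⟩).elim
        exact Finset.mem_filter.1 hi
      rw [this, norm_zero, zero_mul]
  refine (congrArg norm ((Finset.sum_congr (by congr) fun _ _ => rfl).trans (hsum g))).trans_le ?_
  refine (norm_sum_le_of_le _ fun u _ => hWg u).trans ?_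
  refine (sq_le_sq₀ (by positivity) (by positivity)).1 ?_
  rw [mul_pow, Real.sq_sqrt hN.le]
  refine (sq_sum_le_card_mul_sum_sq).trans ?_
  rw [Finset.card_univ, ← Nat.card_eq_fintype_card]
  gcongr
end

section
variable {F : Type*} [Field F] [Fintype F]

open scoped Classical in
theorem card_squarefree_divisors_le {Q : F[X]} (hQ : Q ≠ 0) {k : ℕ} {S : Finset F[X]}
    (hS : ∀ D ∈ S, D.Monic ∧ Squarefree D ∧ D ∣ Q) :
    ∃ j : ℕ, j * k ≤ Q.natDegree ∧
      S.card ≤ 2 ^ (((Finset.range k).biUnion (monics F)).card + j) := by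
  set P := (UniqueFactorizationMonoid.normalizedFactors Q).toFinset with hP
  have hPm : ∀ p ∈ P, p.Monic := fun p hp =>
    (normalize_eq_self_iff_monic (UniqueFactorizationMonoid.ne_zero_of_mem_normalizedFactors
      (Multiset.mem_toFinset.1 hp))).1
      (UniqueFactorizationMonoid.normalize_normalized_factor p (Multiset.mem_toFinset.1 hp))
  refine ⟨(P.filter (k ≤ natDegree ·)).card, ?_, ?_⟩
  · have h1 : (∏ p ∈ P, p) ∣ Q := by
      refine dvd_trans ?_ (UniqueFactorizationMonoid.prod_normalizedFactors hQ).dvd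
      rw [Finset.prod_eq_multiset_prod, Multiset.map_id', Multiset.toFinset_val]
      exact Multiset.prod_dvd_prod_of_le (Multiset.dedup_le _)
    refine le_trans ?_ (natDegree_le_of_dvd h1 hQ)
    rw [natDegree_prod_of_monic _ _ hPm, ← smul_eq_mul]
    refine (Finset.card_nsmul_le_sum _ natDegree k fun p hp => (Finset.mem_filter.1 hp).2).trans ?_
    exact Finset.sum_le_sum_of_subset (Finset.filter_subset _ _)
  · have h1 : S.card ≤ P.powerset.card := by
      refine Finset.card_le_card_of_injOn
        (fun D => (UniqueFactorizationMonoid.normalizedFactors D).toFinset) ?_ ?_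
      · intro D hD
        obtain ⟨h1, h2, h3⟩ := hS D hD
        rw [Finset.mem_coe, Finset.mem_powerset]
        exact Multiset.toFinset_subset.2 (Multiset.subset_of_le
          ((UniqueFactorizationMonoid.dvd_iff_normalizedFactors_le_normalizedFactors
            h1.ne_zero hQ).1 h3))
      · intro D hD E hE hDE
        obtain ⟨h1, h2, -⟩ := hS D hD
        obtain ⟨h3, h4, -⟩ := hS E hE
        rw [UniqueFactorizationMonoid.squarefree_iff_nodup_normalizedFactors h1.ne_zero] at h2
        rw [UniqueFactorizationMonoid.squarefree_iff_nodup_normalizedFactors h3.ne_zero] at h4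
        have h5 := congrArg Finset.val hDE
        simp only [Multiset.toFinset_val, h2.dedup, h4.dedup] at h5
        have h6 := (UniqueFactorizationMonoid.prod_normalizedFactors h1.ne_zero).symm
        rw [h5] at h6
        exact eq_of_monic_of_associated h1 h3
          (h6.trans (UniqueFactorizationMonoid.prod_normalizedFactors h3.ne_zero))
    rw [Finset.card_powerset] at h1
    refine h1.trans (Nat.pow_le_pow_right two_pos ?_)
    rw [← Finset.card_filter_add_card_filter_not (s := P) (fun p => k ≤ natDegree p), add_comm]
    refine Nat.add_le_add_right (Finset.card_le_card fun p hp => ?_) _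
    rw [Finset.mem_filter, not_le] at hp
    exact Finset.mem_biUnion.2 ⟨p.natDegree, Finset.mem_range.2 hp.2,
      mem_monics.2 ⟨hPm p hp.1, rfl⟩⟩

theorem exists_card_squarefree_divisors_le {ε : ℝ} (hε : 0 < ε) : ∃ C : ℝ, 0 ≤ C ∧
    ∀ Q : F[X], Q ≠ 0 → ∀ S : Finset F[X], (∀ D ∈ S, D.Monic ∧ Squarefree D ∧ D ∣ Q) →
      (S.card : ℝ) ≤ C * (Fintype.card F : ℝ) ^ (ε * Q.natDegree) := by
  classical
  obtain ⟨k, hk⟩ := exists_nat_ge (1 / ε)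
  have hk : 1 ≤ ε * k := by rwa [div_le_iff₀' hε] at hk
  have hq : (2 : ℝ) ≤ Fintype.card F := by exact_mod_cast Fintype.one_lt_card
  refine ⟨2 ^ ((Finset.range k).biUnion (monics F)).card, by positivity, fun Q hQ S hS => ?_⟩
  obtain ⟨j, hj, h⟩ := card_squarefree_divisors_le hQ (k := k) hS
  have h : (S.card : ℝ) ≤ 2 ^ (((Finset.range k).biUnion (monics F)).card + j) := by
    exact_mod_cast h
  refine h.trans ?_
  rw [pow_add]
  refine mul_le_mul_of_nonneg_left ?_ (by positivity)
  refine (pow_le_pow_left₀ zero_le_two hq j).trans ?_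
  rw [← Real.rpow_natCast]
  refine Real.rpow_le_rpow_of_exponent_le (by linarith) ?_
  have hj' : (j : ℝ) * k ≤ Q.natDegree := by exact_mod_cast hj
  nlinarith [Nat.cast_nonneg (α := ℝ) j]

open scoped Classical in
/-- Sorting squarefree polynomials by their greatest common divisor with `Q`. -/
theorem exists_sum_polyMu_eq (Q : F[X]) (n : ℕ) : ∃ S : Finset F[X],
    (∀ D ∈ S, D.Monic ∧ Squarefree D ∧ D ∣ Q ∧ D.natDegree ≤ n) ∧
    ∀ φ : F[X] → ℂ, ∑ f ∈ monics F n, (polyMu f : ℂ) * φ f =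
      ∑ D ∈ S, (polyMu D : ℂ) * ∑ f ∈ (monics F (n - D.natDegree)).filter (IsCoprime · Q),
        (polyMu f : ℂ) * φ (D * f) := by
  let d : F[X] → F[X] := fun f => normalize (EuclideanDomain.gcd f Q)
  have hdf : ∀ f, d f ∣ f := fun f => normalize_dvd_iff.2 (EuclideanDomain.gcd_dvd_left _ _)
  have hdQ : ∀ f, d f ∣ Q := fun f => normalize_dvd_iff.2 (EuclideanDomain.gcd_dvd_right _ _)
  have hd : ∀ f g, g ∣ f → g ∣ Q → g ∣ d f := fun f g h1 h2 =>
    dvd_normalize_iff.2 (EuclideanDomain.dvd_gcd h1 h2)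
  have hdm : ∀ f, f ≠ 0 → (d f).Monic := fun f hf =>
    monic_normalize fun h => hf (EuclideanDomain.gcd_eq_zero_iff.1 h).1
  set T := (monics F n).filter Squarefree with hT
  have hTmem : ∀ {f}, f ∈ T ↔ (f.Monic ∧ f.natDegree = n) ∧ Squarefree f := by
    intro f
    rw [hT, Finset.mem_filter, mem_monics]
  refine ⟨T.image d, fun D hD => ?_, fun φ => ?_⟩
  · obtain ⟨f, hf, rfl⟩ := Finset.mem_image.1 hD
    obtain ⟨⟨h1, h2⟩, h3⟩ := hTmem.1 hf
    exact ⟨hdm f h1.ne_zero, h3.squarefree_of_dvd (hdf f), hdQ f,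
      h2 ▸ natDegree_le_of_dvd (hdf f) h1.ne_zero⟩
  have hzero : ∀ {f : F[X]}, ¬ Squarefree f → polyMu f = 0 := fun h => if_neg h
  have h1 : ∑ f ∈ monics F n, (polyMu f : ℂ) * φ f = ∑ f ∈ T, (polyMu f : ℂ) * φ f := by
    refine (Finset.sum_filter_of_ne fun f _ h => ?_).symm
    by_contra hf
    exact h (by rw [hzero hf, Int.cast_zero, zero_mul])
  rw [h1, ← Finset.sum_fiberwise_of_maps_to fun f hf => Finset.mem_image_of_mem d hf]
  refine Finset.sum_congr rfl fun D hD => ?_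
  obtain ⟨f₀, hf₀, rfl⟩ := Finset.mem_image.1 hD
  obtain ⟨⟨hm₀, hn₀⟩, -⟩ := hTmem.1 hf₀
  have hDm := hdm f₀ hm₀.ne_zero
  have hDQ := hdQ f₀
  have hDn : (d f₀).natDegree ≤ n := hn₀ ▸ natDegree_le_of_dvd (hdf f₀) hm₀.ne_zero
  have hDs : Squarefree (d f₀) := (hTmem.1 hf₀).2.squarefree_of_dvd (hdf f₀)
  generalize d f₀ = D at hDm hDQ hDn hDs ⊢
  have h2 : ∑ f ∈ (monics F (n - D.natDegree)).filter (IsCoprime · Q),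
      (polyMu f : ℂ) * φ (D * f) =
      ∑ f ∈ ((monics F (n - D.natDegree)).filter (IsCoprime · Q)).filter Squarefree,
        (polyMu f : ℂ) * φ (D * f) := by
    refine (Finset.sum_filter_of_ne fun f _ h => ?_).symm
    by_contra hf
    exact h (by rw [hzero hf, Int.cast_zero, zero_mul])
  rw [h2, Finset.mul_sum]
  symm
  refine Finset.sum_nbij (D * ·) ?_ ?_ ?_ ?_
  · intro f hf
    simp only [Finset.mem_filter, mem_monics] at hf
    obtain ⟨⟨⟨hf1, hf2⟩, hf3⟩, hf4⟩ := hf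
    rw [Finset.mem_filter, hTmem]
    refine ⟨⟨⟨hDm.mul hf1, by rw [hDm.natDegree_mul hf1, hf2]; omega⟩, ?_⟩, ?_⟩
    · rw [squarefree_mul_iff]
      exact ⟨(hf3.of_isCoprime_of_dvd_right hDQ).symm.isRelPrime, hDs, hf4⟩
    · have hne : D * f ≠ 0 := (hDm.mul hf1).ne_zero
      refine eq_of_monic_of_associated (hdm _ hne) hDm (associated_of_dvd_dvd ?_ ?_)
      · exact (hf3.symm.of_isCoprime_of_dvd_left (hdQ _)).dvd_of_dvd_mul_right (hdf _)
      · exact hd _ _ (dvd_mul_right _ _) hDQ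
  · intro f _ g _ h
    exact mul_left_cancel₀ hDm.ne_zero h
  · intro f hf
    rw [Finset.mem_coe, Finset.mem_filter, hTmem] at hf
    obtain ⟨⟨⟨hf1, hf2⟩, hf3⟩, hf4⟩ := hf
    obtain ⟨g, hg⟩ := hf4 ▸ hdf f
    have hgm : g.Monic := hDm.of_mul_monic_left (hg ▸ hf1)
    refine ⟨g, ?_, hg.symm⟩
    simp only [Finset.coe_filter, Set.mem_ofPred_eq, Finset.mem_filter, mem_monics]
    refine ⟨⟨⟨hgm, ?_⟩, ?_⟩, hf3.squarefree_of_dvd (hg ▸ dvd_mul_left _ _)⟩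
    · rw [← hf2, hg, hDm.natDegree_mul hgm]
      omega
    · rw [← isRelPrime_iff_isCoprime]
      intro p hp1 hp2
      refine hf3 p ?_
      rw [hg]
      refine mul_dvd_mul ?_ hp1
      rw [← hf4]
      exact hd _ _ (hp1.trans (hg ▸ dvd_mul_left _ _)) hp2
  · intro f hf
    simp only [Finset.mem_filter, mem_monics] at hf
    have hc := (hf.1.2.of_isCoprime_of_dvd_right hDQ).symm.isRelPrime
    rw [polyMu_mul hc, Int.cast_mul, mul_assoc]

theorem exists_norm_sum_polyMu_coprime_le {ε : ℝ} (hε : 0 < ε) : ∃ C : ℝ, 0 ≤ C ∧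
    ∀ (l : ℕ) (Q : F[X]), Q ≠ 0 → ∀ (n : ℕ) (g : RayRing Q l → ℂ),
      (∀ f ∈ monics F n, ‖g (rayMap Q l f)‖ ≤ 1) → ∀ [DecidablePred (IsCoprime · Q)],
      ‖∑ f ∈ (monics F n).filter (IsCoprime · Q), (polyMu f : ℂ) * g (rayMap Q l f)‖ ≤
        C * (Fintype.card F : ℝ) ^ ((1 / 2 + ε) * (n + Q.natDegree + l)) := by
  classical
  obtain ⟨C, hC, h⟩ := exists_norm_sum_polyMu_mulChar_le (F := F) hε
  have hq : (1 : ℝ) ≤ Fintype.card F := by exact_mod_cast Fintype.card_pos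
  refine ⟨√(Fintype.card F) * C, by positivity, fun l Q hQ n g hg _ => ?_⟩
  obtain ⟨hfin, hcard⟩ := finite_rayRing hQ l
  have h1 := norm_sum_mul_le_of_mulChar (monics F n) (fun f => (polyMu f : ℂ)) (rayMap Q l) g hg
    (by positivity) (fun χ => h _ Q _ _ _ _ _ (isRayClassMap_rayMap hQ l) χ n)
  have h2 : ∑ f ∈ (monics F n).filter (IsCoprime · Q), (polyMu f : ℂ) * g (rayMap Q l f) =
      ∑ f ∈ (monics F n).filter (fun f => IsUnit (rayMap Q l f)),
        (polyMu f : ℂ) * g (rayMap Q l f) := by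
    refine Finset.sum_congr (Finset.filter_congr fun f hf => ?_) fun _ _ => rfl
    exact (isUnit_rayMap_iff Q l (mem_monics.1 hf).1).symm
  rw [h2]
  refine h1.trans ?_
  have h3 : (Nat.card (RayRing Q l)ˣ : ℝ) ≤
      Fintype.card F * (Fintype.card F : ℝ) ^ ((Q.natDegree : ℝ) + l) := by
    have h4 : Nat.card (RayRing Q l)ˣ ≤ Nat.card (RayRing Q l) :=
      Nat.card_le_card_of_injective _ Units.val_injective
    rw [hcard] at h4
    have h5 : (Nat.card (RayRing Q l)ˣ : ℝ) ≤ (Fintype.card F : ℝ) ^ (Q.natDegree + l + 1) := by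
      exact_mod_cast h4
    refine h5.trans_eq ?_
    rw [pow_succ', ← Real.rpow_natCast _ (_ + _), Nat.cast_add]
  have h6 : √(Nat.card (RayRing Q l)ˣ) ≤
      √(Fintype.card F) * (Fintype.card F : ℝ) ^ (((Q.natDegree : ℝ) + l) / 2) := by
    refine (Real.sqrt_le_sqrt h3).trans_eq ?_
    rw [Real.sqrt_mul (by positivity), Real.sqrt_eq_rpow ((_ : ℝ) ^ (_ : ℝ)),
      ← Real.rpow_mul (by positivity), mul_one_div]
  refine (mul_le_mul_of_nonneg_right h6 (by positivity)).trans_eq ?_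
  rw [mul_mul_mul_comm, ← Real.rpow_add (by linarith)]
  congr 2
  push_cast
  ring

theorem exists_norm_sum_polyMu_le {ε : ℝ} (hε : 0 < ε) : ∃ C : ℝ, 0 ≤ C ∧
    ∀ (l : ℕ) (Q : F[X]), Q ≠ 0 → ∀ g : RayRing Q l → ℂ,
      (∀ f : F[X], f.Monic → ‖g (rayMap Q l f)‖ ≤ 1) → ∀ n : ℕ,
      ‖∑ f ∈ monics F n, (polyMu f : ℂ) * g (rayMap Q l f)‖ ≤
        C * (Fintype.card F : ℝ) ^ ((1 / 2 + ε) * (n + Q.natDegree + l)) := by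
  classical
  obtain ⟨C₁, hC₁, h₁⟩ := exists_card_squarefree_divisors_le (F := F) (half_pos hε)
  obtain ⟨C₂, hC₂, h₂⟩ := exists_norm_sum_polyMu_coprime_le (F := F) (half_pos hε)
  have hq : (1 : ℝ) ≤ Fintype.card F := by exact_mod_cast Fintype.card_pos
  refine ⟨C₁ * C₂, by positivity, fun l Q hQ g hg n => ?_⟩
  obtain ⟨S, hS, hsum⟩ := exists_sum_polyMu_eq Q n
  rw [hsum fun f => g (rayMap Q l f)]
  have h3 : ∀ D ∈ S, ‖(polyMu D : ℂ) * ∑ f ∈ (monics F (n - D.natDegree)).filter (IsCoprime · Q),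
      (polyMu f : ℂ) * g (rayMap Q l (D * f))‖ ≤
      C₂ * (Fintype.card F : ℝ) ^ ((1 / 2 + ε / 2) * (n + Q.natDegree + l)) := by
    intro D hD
    have hmu : ‖(polyMu D : ℂ)‖ ≤ 1 := by
      rw [Complex.norm_intCast]
      exact_mod_cast abs_polyMu_le D
    rw [norm_mul]
    refine (mul_le_of_le_one_left (norm_nonneg _) hmu).trans ?_
    simp only [map_mul]
    refine (h₂ l Q hQ _ (fun b => g (rayMap Q l D * b)) fun f hf => ?_).trans ?_
    · rw [← map_mul]
      exact hg _ ((hS D hD).1.mul (mem_monics.1 hf).1)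
    · refine mul_le_mul_of_nonneg_left (Real.rpow_le_rpow_of_exponent_le hq ?_) hC₂
      refine mul_le_mul_of_nonneg_left ?_ (by linarith)
      have : ((n - D.natDegree : ℕ) : ℝ) ≤ n := by exact_mod_cast Nat.sub_le _ _
      linarith
  refine (norm_sum_le_of_le _ h3).trans ?_
  rw [Finset.sum_const, nsmul_eq_mul]
  refine (mul_le_mul_of_nonneg_right
    (h₁ Q hQ S fun D hD => ⟨(hS D hD).1, (hS D hD).2.1, (hS D hD).2.2.1⟩) (by positivity)).trans ?_
  rw [mul_mul_mul_comm, ← Real.rpow_add (by linarith)]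
  refine mul_le_mul_of_nonneg_left (Real.rpow_le_rpow_of_exponent_le hq ?_) (by positivity)
  nlinarith [mul_nonneg hε.le (Nat.cast_nonneg (α := ℝ) n),
    mul_nonneg hε.le (Nat.cast_nonneg (α := ℝ) l)]
end

/-- The Möbius function does not correlate with `R_{l,Q}`-periodic `1`-bounded functions:
for every `ε > 0` there is `C = C(ε,q)` such that for every `l ≥ 0`, every nonzero `Q` of
degree `m`, every `1`-bounded function `G` on monic polynomials depending only on the
residue class mod `Q` and on the first `l` coefficients, and every `n ≥ 1`,
`|∑_{f monic, deg f = n} G(f) μ(f)| ≤ C q^((1/2+ε)(n+m+l))`. -/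
theorem moebius_periodic_orthogonality {F : Type*} [Field F] [Fintype F] (q : ℕ)
    (hq : Fintype.card F = q) (ε : ℝ) (hε : 0 < ε) :
    ∃ C : ℝ, ∀ (l : ℕ) (Q : Polynomial F), Q ≠ 0 →
      ∀ G : Polynomial F → ℂ,
        (∀ f : Polynomial F, f.Monic → ‖G f‖ ≤ 1) →
        (∀ f g : Polynomial F, f.Monic → g.Monic → Q ∣ f - g →
          (∀ i : ℕ, 1 ≤ i → i ≤ l → firstCoeff f i = firstCoeff g i) → G f = G g) →
        ∀ n : ℕ, 1 ≤ n →
          ‖∑ x : Fin n → F, G (monicPoly F n x) * (polyMu (monicPoly F n x) : ℂ)‖ ≤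
            C * (q : ℝ) ^ ((1 / 2 + ε) * ((n : ℝ) + (Q.natDegree : ℝ) + l)) := by
  classical
  subst hq
  obtain ⟨C, -, h⟩ := exists_norm_sum_polyMu_le (F := F) hε
  refine ⟨C, fun l Q hQ G hG hper n _ => ?_⟩
  let g : RayRing Q l → ℂ := fun b =>
    if hb : ∃ f : F[X], f.Monic ∧ rayMap Q l f = b then G hb.choose else 0
  have hg : ∀ f : F[X], f.Monic → g (rayMap Q l f) = G f := by
    intro f hf
    have hb : ∃ f' : F[X], f'.Monic ∧ rayMap Q l f' = rayMap Q l f := ⟨f, hf, rfl⟩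
    have h1 := rayMap_eq_iff hb.choose_spec.2
    exact (dif_pos hb).trans
      (hper _ _ hb.choose_spec.1 hf h1.1 fun i _ hi => h1.2 i hi)
  rw [← sum_monics n fun f => G f * (polyMu f : ℂ)]
  refine (congrArg norm (Finset.sum_congr rfl fun f hf => ?_)).trans_le
    (h l Q hQ g (fun f hf => (hg f hf).symm ▸ hG f hf) n)
  rw [hg f (mem_monics.1 hf).1, mul_comm]
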